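/- Fix constants p ∈ (0,1) and c < 1/2. Then there is no sequence of intervals [s_n, t_n] with t_n − s_n ≤ n^c such that P(χ(G_{n,p}) ∈ [s_n, t_n]) → 1 as n → ∞. Equivalently: for every sequence of pairs of reals (s_n, t_n) with P(χ(G_{n,p}) ∈ [s_n, t_n]) → 1, there exist infinitely many n with t_n − s_n > n^c. -/

import Mathlib

open Filter Real

/-- Number of edges of a graph on `Fin n`. -/
noncomputable def edgeCount {n : ℕ} (G : SimpleGraph (Fin n)) : ℕ := G.edgeSet.ncard

/-- The probability that the binomial random graph `G_{n,p}` equals `G`. -/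
noncomputable def gnpWeight (n : ℕ) (p : ℝ) (G : SimpleGraph (Fin n)) : ℝ :=
  p ^ edgeCount G * (1 - p) ^ (n.choose 2 - edgeCount G)

open scoped Classical in
/-- The probability that `G_{n,p}` lies in the set `A` of graphs. -/
noncomputable def gnpProb (n : ℕ) (p : ℝ) (A : Set (SimpleGraph (Fin n))) : ℝ :=
  ∑ G : SimpleGraph (Fin n), if G ∈ A then gnpWeight n p G else 0

/-- The chromatic number, as a natural number. -/
noncomputable def chrom {n : ℕ} (G : SimpleGraph (Fin n)) : ℕ := G.chromaticNumber.toNat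

/-- Expectation of `f` over a random subset of `Q` containing each element independently with
probability `p`. -/
noncomputable def bernSum {α : Type*} (p : ℝ) (Q : Finset α) (f : Finset α → ℝ) : ℝ :=
  ∑ S ∈ Q.powerset, p ^ S.card * (1 - p) ^ (Q.card - S.card) * f S

lemma bernSum_one {α : Type*} (p : ℝ) (Q : Finset α) : bernSum p Q (fun _ => 1) = 1 := by
  simp [bernSum, Finset.sum_pow_mul_eq_add_pow]

lemma bernSum_congr {α : Type*} {p : ℝ} {Q : Finset α} {f g : Finset α → ℝ}
    (h : ∀ S ⊆ Q, f S = g S) : bernSum p Q f = bernSum p Q g :=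
  Finset.sum_congr rfl fun S hS => by rw [h S (Finset.mem_powerset.mp hS)]

lemma bernSum_mono {α : Type*} {p : ℝ} (hp0 : 0 ≤ p) (hp1 : p ≤ 1) {Q : Finset α}
    {f g : Finset α → ℝ} (h : ∀ S ⊆ Q, f S ≤ g S) : bernSum p Q f ≤ bernSum p Q g := by
  have := sub_nonneg.mpr hp1
  exact Finset.sum_le_sum fun S hS =>
    mul_le_mul_of_nonneg_left (h S (Finset.mem_powerset.mp hS)) (by positivity)

lemma bernSum_const_mul {α : Type*} (p : ℝ) (Q : Finset α) (c : ℝ) (f : Finset α → ℝ) :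
    bernSum p Q (fun S => c * f S) = c * bernSum p Q f := by
  simp only [bernSum, Finset.mul_sum]
  exact Finset.sum_congr rfl fun S _ => by ring

lemma bernSum_mul_const {α : Type*} (p : ℝ) (Q : Finset α) (c : ℝ) (f : Finset α → ℝ) :
    bernSum p Q (fun S => f S * c) = bernSum p Q f * c := by
  simp only [mul_comm _ c, bernSum_const_mul]

lemma bernSum_comm {α β : Type*} (p : ℝ) (Q : Finset α) (R : Finset β)
    (f : Finset α → Finset β → ℝ) :
    bernSum p Q (fun S => bernSum p R (f S)) = bernSum p R (fun T => bernSum p Q fun S => f S T) := by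
  simp only [bernSum, Finset.mul_sum]
  rw [Finset.sum_comm]
  exact Finset.sum_congr rfl fun S _ => Finset.sum_congr rfl fun T _ => by ring

lemma bernSum_pos {α : Type*} {p : ℝ} (hp0 : 0 ≤ p) (hp1 : p ≤ 1) {Q : Finset α}
    {f : Finset α → ℝ} (h : ∀ S ⊆ Q, 0 < f S) : 0 < bernSum p Q f := by
  obtain ⟨S, hS, hmin⟩ := Q.powerset.exists_min_image f ⟨∅, by simp⟩
  calc 0 < f S := h S (Finset.mem_powerset.mp hS)
    _ = bernSum p Q (fun _ => f S * 1) := by rw [bernSum_const_mul, bernSum_one, mul_one]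
    _ ≤ _ := bernSum_mono hp0 hp1 fun T hT => by
      simpa using hmin T (Finset.mem_powerset.mpr hT)

lemma bernSum_union {α : Type*} [DecidableEq α] (p : ℝ) {Q R : Finset α} (hQR : Disjoint Q R)
    (f : Finset α → ℝ) :
    bernSum p (Q ∪ R) f = bernSum p Q (fun S => bernSum p R fun T => f (S ∪ T)) := by
  simp only [bernSum, Finset.mul_sum]
  rw [← Finset.sum_product']
  refine Finset.sum_nbij' (fun S => (S ∩ Q, S ∩ R)) (fun A => A.1 ∪ A.2) ?_ ?_ ?_ ?_ ?_
  · intro S _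
    simp
  · rintro ⟨A, B⟩ h
    simp only [Finset.mem_product, Finset.mem_powerset] at h ⊢
    exact Finset.union_subset_union h.1 h.2
  · intro S hS
    rw [Finset.mem_powerset] at hS
    simp only [← Finset.inter_union_distrib_left]
    exact Finset.inter_eq_left.mpr hS
  · rintro ⟨A, B⟩ h
    simp only [Finset.mem_product, Finset.mem_powerset] at h
    have h1 : B ∩ Q = ∅ := Finset.disjoint_iff_inter_eq_empty.mp (hQR.symm.mono_left h.2)
    have h2 : A ∩ R = ∅ := Finset.disjoint_iff_inter_eq_empty.mp (hQR.mono_left h.1)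
    simp only [Finset.union_inter_distrib_right, h1, h2, Finset.union_empty, Finset.empty_union,
      Finset.inter_eq_left.mpr h.1, Finset.inter_eq_left.mpr h.2]
  · intro S hS
    rw [Finset.mem_powerset] at hS
    have e : S ∩ Q ∪ S ∩ R = S := by
      rw [← Finset.inter_union_distrib_left]; exact Finset.inter_eq_left.mpr hS
    have hd : Disjoint (S ∩ Q) (S ∩ R) :=
      hQR.mono Finset.inter_subset_right Finset.inter_subset_right
    have hc : S.card = (S ∩ Q).card + (S ∩ R).card := by
      rw [← Finset.card_union_of_disjoint hd, e]
    have h1 : (S ∩ Q).card ≤ Q.card := Finset.card_le_card Finset.inter_subset_right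
    have h2 : (S ∩ R).card ≤ R.card := Finset.card_le_card Finset.inter_subset_right
    simp only [e]
    rw [Finset.card_union_of_disjoint hQR, hc, pow_add,
      show Q.card + R.card - ((S ∩ Q).card + (S ∩ R).card)
        = (Q.card - (S ∩ Q).card) + (R.card - (S ∩ R).card) by omega, pow_add]
    ring

/-- The probability that a random subset of `Q` contains `T` and avoids `F`. -/
lemma bernSum_cylinder {α : Type*} [DecidableEq α] (p : ℝ) {Q T F : Finset α} (hT : T ⊆ Q)
    (hF : F ⊆ Q) (hTF : Disjoint T F) :
    bernSum p Q (fun S => if T ⊆ S ∧ Disjoint F S then 1 else 0)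
      = p ^ T.card * (1 - p) ^ F.card := by
  have hQ : Q = T ∪ (F ∪ (Q \ (T ∪ F))) := by
    rw [← Finset.union_assoc, Finset.union_sdiff_of_subset (Finset.union_subset hT hF)]
  have hd : Disjoint T (F ∪ (Q \ (T ∪ F))) := by
    rw [Finset.disjoint_union_right]
    exact ⟨hTF, Finset.disjoint_sdiff.mono_left Finset.subset_union_left⟩
  have hd' : Disjoint F (Q \ (T ∪ F)) := Finset.disjoint_sdiff.mono_left Finset.subset_union_right
  rw [hQ, bernSum_union p hd]
  have key : ∀ A ⊆ T, bernSum p (F ∪ (Q \ (T ∪ F)))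
      (fun B => if T ⊆ A ∪ B ∧ Disjoint F (A ∪ B) then (1 : ℝ) else 0)
      = if A = T then (1 - p) ^ F.card else 0 := by
    intro A hA
    rw [bernSum_union p hd']
    have : ∀ B ⊆ F, bernSum p (Q \ (T ∪ F)) (fun C => if T ⊆ A ∪ (B ∪ C) ∧
        Disjoint F (A ∪ (B ∪ C)) then (1 : ℝ) else 0) = if A = T ∧ B = ∅ then 1 else 0 := by
      intro B hB
      rw [← bernSum_one p (Q \ (T ∪ F)), ← mul_one (if A = T ∧ B = ∅ then (_ : ℝ) else 0)]
      rw [bernSum_one, show (if A = T ∧ B = ∅ then (1:ℝ) else 0) * 1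
        = (if A = T ∧ B = ∅ then (1:ℝ) else 0) * bernSum p (Q \ (T ∪ F)) (fun _ => 1) by
          rw [bernSum_one], ← bernSum_const_mul]
      refine bernSum_congr fun C hC => ?_
      rw [mul_one]
      refine if_congr ⟨fun h => ⟨?_, ?_⟩, ?_⟩ rfl rfl
      · refine hA.antisymm fun x hx => ?_
        rcases Finset.mem_union.mp (h.1 hx) with h1 | h1
        · exact h1
        · exfalso
          rcases Finset.mem_union.mp h1 with h2 | h2
          · exact Finset.disjoint_left.mp hTF hx (hB h2)
          · have := Finset.mem_sdiff.mp (hC h2)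
            exact this.2 (Finset.mem_union_left _ hx)
      · rw [Finset.eq_empty_iff_forall_notMem]
        intro x hx
        exact Finset.disjoint_left.mp h.2 (hB hx) (by simp [hx])
      · rintro ⟨rfl, rfl⟩
        refine ⟨Finset.subset_union_left, ?_⟩
        rw [Finset.empty_union, Finset.disjoint_union_right]
        exact ⟨hTF.symm, hd'.mono_right hC⟩
    rw [bernSum_congr this]
    by_cases hAT : A = T
    · simp only [hAT, true_and, if_true]
      rw [bernSum, Finset.sum_eq_single ∅]
      · simp
      · intro B _ hB
        simp [hB]
      · simp
    · simp only [hAT, false_and, if_false]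
      simp [bernSum]
  rw [bernSum_congr key, bernSum, Finset.sum_eq_single T]
  · simp
  · intro A _ hA
    simp [hA]
  · simp

/-- The edges of the complete graph on `Fin n`. -/
def allEdges (n : ℕ) : Finset (Sym2 (Fin n)) := Finset.univ.filter fun e => ¬ e.IsDiag

lemma card_allEdges (n : ℕ) : (allEdges n).card = n.choose 2 := by
  have := Sym2.card_subtype_not_diag (α := Fin n)
  rw [Fintype.card_fin, Fintype.card_subtype] at this
  exact this

/-- Expectation over the binomial random graph. -/
noncomputable def gnpMean (n : ℕ) (p : ℝ) (f : SimpleGraph (Fin n) → ℝ) : ℝ :=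
  ∑ G : SimpleGraph (Fin n), gnpWeight n p G * f G

open scoped Classical in
lemma gnpProb_eq_gnpMean (n : ℕ) (p : ℝ) (A : Set (SimpleGraph (Fin n))) :
    gnpProb n p A = gnpMean n p (fun G => if G ∈ A then 1 else 0) := by
  simp [gnpProb, gnpMean]

open scoped Classical in
lemma gnpMean_eq_bernSum (n : ℕ) (p : ℝ) (f : SimpleGraph (Fin n) → ℝ) :
    gnpMean n p f
      = bernSum p (allEdges n) (fun S => f (SimpleGraph.fromEdgeSet (S : Set (Sym2 (Fin n))))) := by
  unfold gnpMean bernSum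
  refine Finset.sum_nbij' (fun G => G.edgeFinset)
    (fun S => SimpleGraph.fromEdgeSet (S : Set (Sym2 (Fin n)))) ?_ ?_ ?_ ?_ ?_
  · intro G _
    rw [Finset.mem_powerset]
    intro e he
    simp only [allEdges, Finset.mem_filter, Finset.mem_univ, true_and]
    exact G.not_isDiag_of_mem_edgeFinset he
  · simp
  · intro G _
    simp
  · intro S hS
    rw [Finset.mem_powerset] at hS
    ext e
    simp only [SimpleGraph.mem_edgeFinset, SimpleGraph.edgeSet_fromEdgeSet, Set.mem_sdiff,
      Finset.mem_coe]
    constructor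
    · exact fun h => h.1
    · intro h
      refine ⟨h, ?_⟩
      have := hS h
      simpa [allEdges] using this
  · intro G _
    have : G.edgeSet.ncard = G.edgeFinset.card := by
      rw [← SimpleGraph.coe_edgeFinset, Set.ncard_coe_finset]
    simp only [gnpWeight, edgeCount, card_allEdges, this, SimpleGraph.coe_edgeFinset,
      SimpleGraph.fromEdgeSet_edgeSet]

lemma gnpWeight_nonneg {n : ℕ} {p : ℝ} (hp0 : 0 ≤ p) (hp1 : p ≤ 1) (G : SimpleGraph (Fin n)) :
    0 ≤ gnpWeight n p G := by
  have := sub_nonneg.mpr hp1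
  unfold gnpWeight
  positivity

lemma gnpMean_mono {n : ℕ} {p : ℝ} (hp0 : 0 ≤ p) (hp1 : p ≤ 1) {f g : SimpleGraph (Fin n) → ℝ}
    (h : ∀ G, f G ≤ g G) : gnpMean n p f ≤ gnpMean n p g :=
  Finset.sum_le_sum fun G _ => mul_le_mul_of_nonneg_left (h G) (gnpWeight_nonneg hp0 hp1 G)

lemma gnpMean_const_mul (n : ℕ) (p c : ℝ) (f : SimpleGraph (Fin n) → ℝ) :
    gnpMean n p (fun G => c * f G) = c * gnpMean n p f := by
  simp only [gnpMean, Finset.mul_sum]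
  exact Finset.sum_congr rfl fun G _ => by ring

lemma gnpMean_sum {ι : Type*} (s : Finset ι) (n : ℕ) (p : ℝ) (f : ι → SimpleGraph (Fin n) → ℝ) :
    gnpMean n p (fun G => ∑ i ∈ s, f i G) = ∑ i ∈ s, gnpMean n p (f i) := by
  simp only [gnpMean, Finset.mul_sum]
  rw [Finset.sum_comm]

lemma gnpMean_one (n : ℕ) (p : ℝ) : gnpMean n p (fun _ => 1) = 1 := by
  rw [gnpMean_eq_bernSum, bernSum_one]

lemma gnpProb_mono {n : ℕ} {p : ℝ} (hp0 : 0 ≤ p) (hp1 : p ≤ 1) {A B : Set (SimpleGraph (Fin n))}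
    (h : A ⊆ B) : gnpProb n p A ≤ gnpProb n p B := by
  classical
  rw [gnpProb_eq_gnpMean, gnpProb_eq_gnpMean]
  refine gnpMean_mono hp0 hp1 fun G => ?_
  by_cases hA : G ∈ A
  · simp [hA, h hA]
  · simp only [hA, if_false]
    positivity

lemma gnpProb_nonneg {n : ℕ} {p : ℝ} (hp0 : 0 ≤ p) (hp1 : p ≤ 1) (A : Set (SimpleGraph (Fin n))) :
    0 ≤ gnpProb n p A := by
  classical
  exact Finset.sum_nonneg fun G _ => by
    have := gnpWeight_nonneg hp0 hp1 G
    positivity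

lemma gnpProb_union_le {n : ℕ} {p : ℝ} (hp0 : 0 ≤ p) (hp1 : p ≤ 1)
    (A B : Set (SimpleGraph (Fin n))) : gnpProb n p (A ∪ B) ≤ gnpProb n p A + gnpProb n p B := by
  classical
  unfold gnpProb
  rw [← Finset.sum_add_distrib]
  refine Finset.sum_le_sum fun G _ => ?_
  have := gnpWeight_nonneg hp0 hp1 G
  by_cases hA : G ∈ A <;> by_cases hB : G ∈ B <;> simp [hA, hB, this]

lemma gnpProb_compl (n : ℕ) (p : ℝ) (A : Set (SimpleGraph (Fin n))) :
    gnpProb n p Aᶜ = 1 - gnpProb n p A := by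
  classical
  rw [eq_sub_iff_add_eq, ← gnpMean_one n p]
  unfold gnpProb gnpMean
  rw [← Finset.sum_add_distrib]
  refine Finset.sum_congr rfl fun G _ => ?_
  by_cases hA : G ∈ A <;> simp [hA]

lemma gnpProb_cylinder {n : ℕ} (p : ℝ) {T F : Finset (Sym2 (Fin n))} (hT : T ⊆ allEdges n)
    (hF : F ⊆ allEdges n) (hTF : Disjoint T F) :
    gnpProb n p {G | (∀ e ∈ T, e ∈ G.edgeSet) ∧ ∀ e ∈ F, e ∉ G.edgeSet}
      = p ^ T.card * (1 - p) ^ F.card := by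
  classical
  rw [gnpProb_eq_gnpMean, gnpMean_eq_bernSum, ← bernSum_cylinder p hT hF hTF]
  refine bernSum_congr fun S hS => ?_
  have hmem : ∀ e ∈ allEdges n,
      (e ∈ (SimpleGraph.fromEdgeSet (S : Set (Sym2 (Fin n)))).edgeSet ↔ e ∈ S) := by
    intro e he
    simp only [allEdges, Finset.mem_filter] at he
    simp [he.2]
  have hiff : SimpleGraph.fromEdgeSet (S : Set (Sym2 (Fin n))) ∈
      {G | (∀ e ∈ T, e ∈ G.edgeSet) ∧ ∀ e ∈ F, e ∉ G.edgeSet} ↔ T ⊆ S ∧ Disjoint F S := by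
    rw [Set.mem_ofPred_eq]
    refine and_congr ⟨fun h e he => (hmem e (hT he)).mp (h e he),
      fun h e he => (hmem e (hT he)).mpr (h he)⟩ ?_
    rw [Finset.disjoint_left]
    exact ⟨fun h e he => mt (hmem e (hF he)).mpr (h e he),
      fun h e he => mt (hmem e (hF he)).mp (h he)⟩
  by_cases h : T ⊆ S ∧ Disjoint F S
  · rw [if_pos h, if_pos (hiff.mpr h)]
  · rw [if_neg h, if_neg (mt hiff.mp h)]

/-- A property of the graph induced on the range of `φ` is independent of the absence of a set of
edges that are not inside this range. -/
lemma gnpProb_comap_inter {n N : ℕ} (p : ℝ) (φ : Fin n ↪ Fin N) (A : Set (SimpleGraph (Fin n)))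
    {F : Finset (Sym2 (Fin N))} (hF : F ⊆ allEdges N) (hφ : ∀ e, Sym2.map φ e ∉ F) :
    gnpProb N p {G | G.comap φ ∈ A ∧ ∀ e ∈ F, e ∉ G.edgeSet}
      = gnpProb n p A * (1 - p) ^ F.card := by
  classical
  have hfib : ∀ H : SimpleGraph (Fin n),
      gnpProb N p {G | G.comap φ = H ∧ ∀ e ∈ F, e ∉ G.edgeSet}
        = gnpWeight n p H * (1 - p) ^ F.card := by
    intro H
    set T := H.edgeFinset.map φ.sym2Map with hT
    set F' := Hᶜ.edgeFinset.map φ.sym2Map with hF'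
    have hTe : T ⊆ allEdges N := by
      intro e he
      simp only [hT, Finset.mem_map, SimpleGraph.mem_edgeFinset] at he
      obtain ⟨e, he, rfl⟩ := he
      induction e with | _ u v =>
      simp only [allEdges, Finset.mem_filter, Finset.mem_univ, true_and,
        Function.Embedding.sym2Map_apply, Sym2.map_mk, Sym2.mk_isDiag_iff, φ.injective.eq_iff]
      exact H.ne_of_adj he
    have hFe : F' ⊆ allEdges N := by
      intro e he
      simp only [hF', Finset.mem_map, SimpleGraph.mem_edgeFinset] at he
      obtain ⟨e, he, rfl⟩ := he
      induction e with | _ u v =>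
      simp only [allEdges, Finset.mem_filter, Finset.mem_univ, true_and,
        Function.Embedding.sym2Map_apply, Sym2.map_mk, Sym2.mk_isDiag_iff, φ.injective.eq_iff]
      exact Hᶜ.ne_of_adj he
    have hTF : Disjoint T (F' ∪ F) := by
      rw [Finset.disjoint_union_right]
      constructor
      · rw [hT, hF', Finset.disjoint_map]
        rw [SimpleGraph.disjoint_edgeFinset]
        exact disjoint_compl_right
      · rw [Finset.disjoint_left]
        intro e he
        rw [hT, Finset.mem_map] at he
        obtain ⟨e, he, rfl⟩ := he
        exact hφ e
    have hF'F : Disjoint F' F := by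
      rw [Finset.disjoint_left]
      intro e he
      rw [hF', Finset.mem_map] at he
      obtain ⟨e, he, rfl⟩ := he
      exact hφ e
    have hset : {G : SimpleGraph (Fin N) | G.comap φ = H ∧ ∀ e ∈ F, e ∉ G.edgeSet}
        = {G | (∀ e ∈ T, e ∈ G.edgeSet) ∧ ∀ e ∈ F' ∪ F, e ∉ G.edgeSet} := by
      ext G
      simp only [Set.mem_ofPred_eq, Finset.mem_union, or_imp, forall_and, ← and_assoc]
      refine and_congr_left fun _ => ?_
      simp only [hT, hF', Finset.mem_map, SimpleGraph.mem_edgeFinset, forall_exists_index, and_imp,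
        forall_apply_eq_imp_iff₂, Function.Embedding.sym2Map_apply]
      constructor
      · rintro rfl
        constructor
        · intro e
          induction e with | _ u v => simp
        · intro e
          induction e with | _ u v =>
          simp only [SimpleGraph.mem_edgeSet, SimpleGraph.compl_adj, Sym2.map_mk]
          exact fun h => h.2
      · rintro ⟨h1, h2⟩
        ext u v
        rw [SimpleGraph.comap_adj]
        constructor
        · intro h
          by_contra hn
          refine h2 s(u, v) ?_ (by simpa using h)
          simp only [SimpleGraph.mem_edgeSet, SimpleGraph.compl_adj]
          exact ⟨fun huv => by simp [huv] at h, hn⟩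
        · intro h
          simpa using h1 s(u, v) h
    rw [hset, gnpProb_cylinder p hTe (Finset.union_subset hFe hF) hTF,
      Finset.card_union_of_disjoint hF'F, pow_add, ← mul_assoc, hT, hF', Finset.card_map,
      Finset.card_map]
    have h1 : H.edgeFinset.card = edgeCount H := by
      rw [edgeCount, ← SimpleGraph.coe_edgeFinset, Set.ncard_coe_finset]
    have h2 : Hᶜ.edgeFinset.card = n.choose 2 - edgeCount H := by
      have hu : H.edgeFinset ∪ Hᶜ.edgeFinset = allEdges n := by
        ext e
        induction e with | _ u v =>
        simp only [allEdges, Finset.mem_union, SimpleGraph.mem_edgeFinset, SimpleGraph.mem_edgeSet,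
          SimpleGraph.compl_adj, Finset.mem_filter, Finset.mem_univ, true_and, Sym2.mk_isDiag_iff]
        have := H.ne_of_adj (a := u) (b := v)
        tauto
      have hd : Disjoint H.edgeFinset Hᶜ.edgeFinset :=
        SimpleGraph.disjoint_edgeFinset.mpr disjoint_compl_right
      rw [← card_allEdges, ← hu, Finset.card_union_of_disjoint hd, h1]
      omega
    rw [h1, h2, gnpWeight]
  have : gnpProb N p {G | G.comap φ ∈ A ∧ ∀ e ∈ F, e ∉ G.edgeSet}
      = ∑ H : SimpleGraph (Fin n), if H ∈ A then
          gnpProb N p {G | G.comap φ = H ∧ ∀ e ∈ F, e ∉ G.edgeSet} else 0 := by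
    have hR : ∀ H : SimpleGraph (Fin n), (if H ∈ A then
          gnpProb N p {G | G.comap φ = H ∧ ∀ e ∈ F, e ∉ G.edgeSet} else 0)
        = ∑ G ∈ Finset.univ.filter (fun G : SimpleGraph (Fin N) =>
            H ∈ A ∧ G.comap φ = H ∧ ∀ e ∈ F, e ∉ G.edgeSet), gnpWeight N p G := by
      intro H
      by_cases hH : H ∈ A
      · rw [if_pos hH, Finset.sum_filter, gnpProb]
        refine Finset.sum_congr rfl fun G _ => ?_
        by_cases h : G.comap φ = H ∧ ∀ e ∈ F, e ∉ G.edgeSet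
        · exact (if_pos h).trans (if_pos ⟨hH, h⟩).symm
        · exact (if_neg h).trans (if_neg fun h' => h h'.2).symm
      · rw [if_neg hH, Finset.filter_eq_empty_iff.mpr fun _ _ h => hH h.1, Finset.sum_empty]
    rw [Finset.sum_congr rfl fun H _ => hR H]
    rw [gnpProb, Finset.sum_comm' (t' := Finset.univ) (s' := fun G =>
      Finset.univ.filter fun H => H ∈ A ∧ G.comap φ = H ∧ ∀ e ∈ F, e ∉ G.edgeSet)]
    · refine Finset.sum_congr rfl fun G _ => ?_
      rw [Finset.sum_const]
      by_cases h : G.comap φ ∈ A ∧ ∀ e ∈ F, e ∉ G.edgeSet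
      · have : (Finset.univ.filter fun H => H ∈ A ∧ G.comap φ = H ∧ ∀ e ∈ F, e ∉ G.edgeSet)
            = {G.comap φ} := by
          ext H
          simp only [Finset.mem_filter, Finset.mem_univ, true_and, Finset.mem_singleton]
          constructor
          · exact fun h => h.2.1.symm
          · rintro rfl
            exact ⟨h.1, rfl, h.2⟩
        rw [this, Finset.card_singleton, one_smul]
        exact if_pos h
      · have : (Finset.univ.filter fun H => H ∈ A ∧ G.comap φ = H ∧ ∀ e ∈ F, e ∉ G.edgeSet)
            = ∅ := by
          rw [Finset.filter_eq_empty_iff]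
          rintro H _ ⟨h1, rfl, h3⟩
          exact h ⟨h1, h3⟩
        rw [this, Finset.card_empty, zero_smul]
        exact if_neg h
    · intro H G
      simp
  rw [this, gnpProb, Finset.sum_mul]
  refine Finset.sum_congr rfl fun H _ => ?_
  rw [hfib]
  split_ifs <;> simp

lemma gnpProb_comap_perm {n : ℕ} (p : ℝ) (σ : Equiv.Perm (Fin n)) (A : Set (SimpleGraph (Fin n))) :
    gnpProb n p {G | G.comap σ ∈ A} = gnpProb n p A := by
  simpa using gnpProb_comap_inter p σ.toEmbedding A (F := ∅) (by simp) (by simp)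

lemma gnpProb_avoid {n : ℕ} (p : ℝ) {F : Finset (Sym2 (Fin n))} (hF : F ⊆ allEdges n) :
    gnpProb n p {G | ∀ e ∈ F, e ∉ G.edgeSet} = (1 - p) ^ F.card := by
  simpa using gnpProb_cylinder p (T := ∅) (by simp) hF (by simp)

lemma chrom_le_iff {n k : ℕ} {G : SimpleGraph (Fin n)} : chrom G ≤ k ↔ G.Colorable k := by
  have hc : G.Colorable n := by
    simpa using G.colorable_of_fintype
  have htop : G.chromaticNumber ≠ ⊤ := SimpleGraph.chromaticNumber_ne_top_iff_exists.mpr ⟨n, hc⟩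
  rw [← SimpleGraph.chromaticNumber_le_iff_colorable, chrom]
  conv_rhs => rw [← ENat.natCast_toNat htop]
  exact Nat.cast_le.symm

lemma colorable_chrom {n : ℕ} (G : SimpleGraph (Fin n)) : G.Colorable (chrom G) :=
  chrom_le_iff.mp le_rfl

lemma chrom_le_chrom_add_one {n : ℕ} {G H : SimpleGraph (Fin n)} (x : Fin n)
    (h : ∀ u v, u ≠ x → v ≠ x → G.Adj u v → H.Adj u v) : chrom G ≤ chrom H + 1 := by
  rw [chrom_le_iff]
  obtain ⟨C⟩ := colorable_chrom H
  refine ⟨SimpleGraph.Coloring.mk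
    (fun v => if v = x then Fin.last _ else (C v).castSucc) fun {u v} huv => ?_⟩
  by_cases hu : u = x <;> by_cases hv : v = x
  · exact absurd (hu.trans hv.symm) huv.ne
  · simpa [hu, hv] using (Fin.castSucc_ne_last _).symm
  · simp [hu, hv]
  · simpa [hu, hv] using C.valid (h u v hu hv huv)

lemma bernSum_const {α : Type*} (p : ℝ) (Q : Finset α) (c : ℝ) : bernSum p Q (fun _ => c) = c := by
  simpa [bernSum_one] using bernSum_const_mul p Q c fun _ => 1

lemma add_inv_le_two_mul_cosh {r t : ℝ} (hr : 0 < r) (h1 : r ≤ exp t) (h2 : r⁻¹ ≤ exp t) :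
    r + r⁻¹ ≤ 2 * cosh t := by
  have e : 0 < exp t := exp_pos t
  have h3 : 1 ≤ exp t * r := by
    have := mul_le_mul_of_nonneg_right h2 hr.le
    rwa [inv_mul_cancel₀ hr.ne'] at this
  rw [cosh_eq, exp_neg]
  have : 0 ≤ (exp t - r) * (exp t * r - 1) := mul_nonneg (by linarith) (by linarith)
  have h4 : exp t + (exp t)⁻¹ - (r + r⁻¹) = (exp t - r) * (exp t * r - 1) / (exp t * r) := by
    field_simp
    ring
  have : 0 ≤ exp t + (exp t)⁻¹ - (r + r⁻¹) := by rw [h4]; positivity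
  linarith

/-- Two-sided moment generating function bound for functions that change by at most one when one
block of coordinates is changed. -/
lemma bernSum_exp_mul_bernSum_exp_neg_le {α : Type*} [DecidableEq α] {p : ℝ} (hp0 : 0 ≤ p)
    (hp1 : p ≤ 1) (Q : ℕ → Finset α) (hQ : Pairwise fun i j => Disjoint (Q i) (Q j)) {t : ℝ}
    (ht : 0 ≤ t) (k : ℕ) (f : Finset α → ℝ)
    (hf : ∀ i < k, ∀ S T, S \ Q i = T \ Q i → f S ≤ f T + 1) :
    bernSum p ((Finset.range k).biUnion Q) (fun S => exp (t * f S))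
      * bernSum p ((Finset.range k).biUnion Q) (fun S => exp (-(t * f S)))
      ≤ exp (t ^ 2 / 2 * k) := by
  induction k generalizing f with
  | zero => simp [bernSum, ← exp_add]
  | succ k ih =>
    have hd : Disjoint (Q k) ((Finset.range k).biUnion Q) := by
      rw [Finset.disjoint_biUnion_right]
      intro i hi
      exact hQ (Finset.mem_range.mp hi).ne'
    rw [Finset.range_add_one, Finset.biUnion_insert, bernSum_union p hd, bernSum_union p hd]
    set U := (Finset.range k).biUnion Q
    set A : Finset α → ℝ := fun S => bernSum p U fun T => exp (t * f (S ∪ T)) with hA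
    set B : Finset α → ℝ := fun S => bernSum p U fun T => exp (-(t * f (S ∪ T))) with hB
    set E := exp (t ^ 2 / 2 * k)
    have hApos : ∀ S, 0 < A S := fun S => bernSum_pos hp0 hp1 fun _ _ => exp_pos _
    have hAB : ∀ S, A S * B S ≤ E := by
      intro S
      refine ih (fun T => f (S ∪ T)) fun i hi T T' h => hf i (by omega) _ _ ?_
      rw [Finset.union_sdiff_distrib, Finset.union_sdiff_distrib, h]
    have hAA : ∀ S ⊆ Q k, ∀ S' ⊆ Q k, A S ≤ exp t * A S' := by
      intro S hS S' hS'
      simp only [hA]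
      rw [← bernSum_const_mul]
      refine bernSum_mono hp0 hp1 fun T _ => ?_
      rw [← exp_add, exp_le_exp]
      have := hf k (by omega) (S ∪ T) (S' ∪ T) (by
        rw [Finset.union_sdiff_distrib, Finset.union_sdiff_distrib,
          Finset.sdiff_eq_empty_iff_subset.mpr hS, Finset.sdiff_eq_empty_iff_subset.mpr hS'])
      nlinarith
    have hBle : bernSum p (Q k) B ≤ E * bernSum p (Q k) (fun S => (A S)⁻¹) := by
      rw [← bernSum_const_mul]
      refine bernSum_mono hp0 hp1 fun S _ => ?_
      rw [← div_eq_mul_inv, le_div_iff₀ (hApos S), mul_comm]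
      exact hAB S
    have hsym : 2 * (bernSum p (Q k) A * bernSum p (Q k) (fun S => (A S)⁻¹)) ≤ 2 * cosh t := by
      have e1 : bernSum p (Q k) A * bernSum p (Q k) (fun S => (A S)⁻¹)
          = bernSum p (Q k) fun S => bernSum p (Q k) fun T => A S * (A T)⁻¹ := by
        simp only [bernSum_const_mul, bernSum_mul_const]
      have e2 : bernSum p (Q k) A * bernSum p (Q k) (fun S => (A S)⁻¹)
          = bernSum p (Q k) fun S => bernSum p (Q k) fun T => A T * (A S)⁻¹ := by
        rw [e1, bernSum_comm]
      have e3 : 2 * (bernSum p (Q k) A * bernSum p (Q k) (fun S => (A S)⁻¹))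
          = bernSum p (Q k) fun S => bernSum p (Q k) fun T => A S * (A T)⁻¹ + A T * (A S)⁻¹ := by
        rw [two_mul]
        nth_rewrite 1 [e1]
        rw [e2]
        simp only [bernSum, ← Finset.sum_add_distrib, ← mul_add]
      rw [e3]
      calc _ ≤ bernSum p (Q k) fun S => bernSum p (Q k) fun T => 2 * cosh t * 1 := by
            refine bernSum_mono hp0 hp1 fun S hS => bernSum_mono hp0 hp1 fun T hT => ?_
            have h1 := hApos S
            have h2 := hApos T
            have := add_inv_le_two_mul_cosh (r := A S * (A T)⁻¹) (t := t) (by positivity)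
              (by rw [← div_eq_mul_inv, div_le_iff₀ h2]; exact hAA S hS T hT)
              (by rw [mul_inv, inv_inv, mul_comm, ← div_eq_mul_inv, div_le_iff₀ h1]
                  exact hAA T hT S hS)
            rw [mul_inv, inv_inv, mul_comm (A S)⁻¹] at this
            linarith
        _ = 2 * cosh t := by simp only [mul_one, bernSum_const]
    have hcosh := cosh_le_exp_half_sq t
    have hpos : 0 ≤ bernSum p (Q k) A := (bernSum_pos hp0 hp1 fun S _ => hApos S).le
    calc bernSum p (Q k) A * bernSum p (Q k) B
        ≤ bernSum p (Q k) A * (E * bernSum p (Q k) (fun S => (A S)⁻¹)) := by gcongr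
      _ = E * (bernSum p (Q k) A * bernSum p (Q k) (fun S => (A S)⁻¹)) := by ring
      _ ≤ E * exp (t ^ 2 / 2) := by
        have : 0 < E := exp_pos _
        gcongr
        linarith
      _ = exp (t ^ 2 / 2 * (k + 1 : ℕ)) := by
        rw [← exp_add]; push_cast; ring_nf

/-- Concentration of the chromatic number: both tails cannot be large at the same time. -/
lemma gnpProb_chrom_le_mul_gnpProb_le_chrom {n : ℕ} {p : ℝ} (hp0 : 0 ≤ p) (hp1 : p ≤ 1) {t : ℝ}
    (ht : 0 ≤ t) (x y : ℝ) :
    gnpProb n p {G | (chrom G : ℝ) ≤ x} * gnpProb n p {G | y ≤ (chrom G : ℝ)}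
      ≤ exp (t ^ 2 / 2 * n - t * (y - x)) := by
  classical
  set Q : ℕ → Finset (Sym2 (Fin n)) := fun i => (allEdges n).filter fun e => (e.sup : ℕ) = i
  have hQ : Pairwise fun i j => Disjoint (Q i) (Q j) := by
    intro i j hij
    rw [Finset.disjoint_left]
    intro e he he'
    simp only [Q, Finset.mem_filter] at he he'
    exact hij (he.2.symm.trans he'.2)
  have hU : (Finset.range n).biUnion Q = allEdges n := by
    ext e
    simp only [Q, Finset.mem_biUnion, Finset.mem_range, Finset.mem_filter]
    constructor
    · rintro ⟨i, _, he, _⟩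
      exact he
    · exact fun he => ⟨e.sup, (e.sup).isLt, he, rfl⟩
  have key := bernSum_exp_mul_bernSum_exp_neg_le hp0 hp1 Q hQ ht n
    (fun S => (chrom (SimpleGraph.fromEdgeSet (S : Set (Sym2 (Fin n)))) : ℝ)) (by
      intro i hi S T hST
      have := chrom_le_chrom_add_one
        (G := SimpleGraph.fromEdgeSet (S : Set (Sym2 (Fin n))))
        (H := SimpleGraph.fromEdgeSet (T : Set (Sym2 (Fin n)))) ⟨i, hi⟩ (by
          intro u v hu hv huv
          rw [SimpleGraph.fromEdgeSet_adj] at huv ⊢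
          refine ⟨?_, huv.2⟩
          have hnot : s(u, v) ∉ Q i := by
            simp only [Q, Finset.mem_filter, not_and, Sym2.sup_mk]
            intro _ h
            rcases max_choice u v with h' | h'
            · rw [h'] at h; exact hu (Fin.ext h)
            · rw [h'] at h; exact hv (Fin.ext h)
          have : s(u, v) ∈ S \ Q i := Finset.mem_sdiff.mpr ⟨huv.1, hnot⟩
          rw [hST] at this
          exact (Finset.mem_sdiff.mp this).1)
      exact_mod_cast this)
  rw [hU] at key
  rw [← gnpMean_eq_bernSum n p (fun G => exp (t * chrom G)),
    ← gnpMean_eq_bernSum n p (fun G => exp (-(t * chrom G)))] at key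
  have h1 : exp (t * y) * gnpProb n p {G | y ≤ (chrom G : ℝ)}
      ≤ gnpMean n p (fun G => exp (t * chrom G)) := by
    rw [gnpProb_eq_gnpMean, ← gnpMean_const_mul]
    refine gnpMean_mono hp0 hp1 fun G => ?_
    split_ifs with h
    · rw [mul_one, exp_le_exp]
      exact mul_le_mul_of_nonneg_left h ht
    · rw [mul_zero]; positivity
  have h2 : exp (-(t * x)) * gnpProb n p {G | (chrom G : ℝ) ≤ x}
      ≤ gnpMean n p (fun G => exp (-(t * chrom G))) := by
    rw [gnpProb_eq_gnpMean, ← gnpMean_const_mul]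
    refine gnpMean_mono hp0 hp1 fun G => ?_
    split_ifs with h
    · rw [mul_one, exp_le_exp]
      exact neg_le_neg (mul_le_mul_of_nonneg_left h ht)
    · rw [mul_zero]; positivity
  have h3 := mul_le_mul h1 h2
    (mul_nonneg (exp_pos _).le (gnpProb_nonneg hp0 hp1 _))
    (le_trans (mul_nonneg (exp_pos _).le (gnpProb_nonneg hp0 hp1 _)) h1)
  have h4 := h3.trans key
  rw [sub_eq_add_neg, exp_add]
  have e : exp (t * y) * exp (-(t * x)) * exp (-(t * (y - x))) = 1 := by
    rw [← exp_add, ← exp_add, exp_eq_one_iff]; ring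
  have := mul_le_mul_of_nonneg_right h4 (exp_pos (-(t * (y - x)))).le
  calc _ = (exp (t * y) * exp (-(t * x)) * exp (-(t * (y - x))))
        * (gnpProb n p {G | (chrom G : ℝ) ≤ x} * gnpProb n p {G | y ≤ (chrom G : ℝ)}) := by
        rw [e, one_mul]
    _ = _ := by ring
    _ ≤ _ := this

/-- The pairs of vertices contained in a set `s`. -/
def innerPairs {V : Type*} [DecidableEq V] (s : Finset V) : Finset (Sym2 V) :=
  s.offDiag.image (Function.uncurry Sym2.mk)

lemma mk_mem_innerPairs {V : Type*} [DecidableEq V] {s : Finset V} {u v : V} :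
    s(u, v) ∈ innerPairs s ↔ u ∈ s ∧ v ∈ s ∧ u ≠ v := by
  simp only [innerPairs, Finset.mem_image, Finset.mem_offDiag, Prod.exists, Function.uncurry_apply_pair,
    Sym2.eq_iff]
  constructor
  · rintro ⟨a, b, h, ⟨rfl, rfl⟩ | ⟨rfl, rfl⟩⟩
    · exact h
    · exact ⟨h.2.1, h.1, h.2.2.symm⟩
  · exact fun h => ⟨u, v, h, Or.inl ⟨rfl, rfl⟩⟩

lemma card_innerPairs {V : Type*} [DecidableEq V] (s : Finset V) :
    (innerPairs s).card = s.card.choose 2 :=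
  Sym2.card_image_offDiag s

/-- The pairs of vertices contained in one of the blocks `B j`. -/
def blockPairs {V J : Type*} [DecidableEq V] [Fintype J] (B : J → Finset V) : Finset (Sym2 V) :=
  Finset.univ.biUnion fun j => innerPairs (B j)

lemma mk_mem_blockPairs {V J : Type*} [DecidableEq V] [Fintype J] {B : J → Finset V} {u v : V} :
    s(u, v) ∈ blockPairs B ↔ u ≠ v ∧ ∃ j, u ∈ B j ∧ v ∈ B j := by
  simp only [blockPairs, Finset.mem_biUnion, Finset.mem_univ, true_and, mk_mem_innerPairs]
  constructor
  · rintro ⟨j, h1, h2, h3⟩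
    exact ⟨h3, j, h1, h2⟩
  · rintro ⟨h3, j, h1, h2⟩
    exact ⟨j, h1, h2, h3⟩

lemma blockPairs_subset_allEdges {N : ℕ} {J : Type*} [Fintype J] (B : J → Finset (Fin N)) :
    blockPairs B ⊆ allEdges N := by
  intro e
  induction e with | _ u v =>
  rw [mk_mem_blockPairs]
  intro h
  simpa [allEdges] using h.1

/-- Permutations with prescribed values on a set. -/
lemma card_perm_eqOn_le {V : Type*} [Fintype V] [DecidableEq V] (U : Finset V)
    (S : Finset (Equiv.Perm V)) (hS : ∀ σ ∈ S, ∀ τ ∈ S, ∀ x ∈ U, σ x = τ x) :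
    S.card ≤ (Fintype.card V - U.card).factorial := by
  rcases S.eq_empty_or_nonempty with rfl | ⟨σ, hσ⟩
  · simp
  have h1 : Fintype.card {f : Equiv.Perm V // ∀ a, ¬ a ∉ U → f a = a}
      = (Fintype.card V - U.card).factorial := by
    rw [← Fintype.card_congr (Equiv.Perm.subtypeEquivSubtypePerm (fun x => x ∉ U)),
      Fintype.card_perm]
    congr 1
    rw [Fintype.card_subtype_compl]
    simp
  rw [← h1, Fintype.card_subtype]
  refine Finset.card_le_card_of_injOn (fun τ => σ⁻¹ * τ) ?_ ?_
  · intro τ hτ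
    simp only [Finset.coe_filter, Finset.mem_univ, true_and, not_not, Set.mem_ofPred_eq]
    intro x hx
    simp [← hS σ hσ τ hτ x hx]
  · intro τ _ τ' _ h
    exact mul_left_cancel h

/-- The number of permutations mapping prescribed disjoint sets into prescribed sets. -/
lemma card_perm_mapsTo_le {V K : Type*} [Fintype V] [DecidableEq V] [Fintype K] [DecidableEq K]
    (A : K → Finset V) (B : K → Finset V) (hA : Pairwise fun i j => Disjoint (A i) (A j)) :
    (Finset.univ.filter fun τ : Equiv.Perm V => ∀ k, ∀ x ∈ A k, τ x ∈ B k).card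
      ≤ (Fintype.card V - ∑ k, (A k).card).factorial
        * ∏ k, (B k).card.descFactorial (A k).card := by
  classical
  set S := Finset.univ.filter fun τ : Equiv.Perm V => ∀ k, ∀ x ∈ A k, τ x ∈ B k
  have hS : ∀ τ ∈ S, ∀ k, ∀ x ∈ A k, τ x ∈ B k := fun τ hτ => by simpa [S] using hτ
  set U := Finset.univ.biUnion A
  have hU : U.card = ∑ k, (A k).card := Finset.card_biUnion fun i _ j _ hij => hA hij
  let r : {τ // τ ∈ S} → ∀ k, {x // x ∈ A k} ↪ {x // x ∈ B k} := fun τ k =>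
    ⟨fun x => ⟨τ.1 x.1, hS τ.1 τ.2 k x.1 x.2⟩, fun x y h => by
      have := congrArg Subtype.val h
      exact Subtype.ext (τ.1.injective this)⟩
  have hcard : Fintype.card (∀ k, {x // x ∈ A k} ↪ {x // x ∈ B k})
      = ∏ k, (B k).card.descFactorial (A k).card := by
    rw [Fintype.card_pi]
    simp [Fintype.card_embedding_eq]
  have := Finset.card_le_mul_card_image (f := r) (Finset.univ : Finset {τ // τ ∈ S})
    (Fintype.card V - U.card).factorial (by
      intro b _
      rw [← Finset.card_map (Function.Embedding.subtype _)]
      refine card_perm_eqOn_le U _ ?_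
      intro σ hσ τ hτ x hx
      simp only [Finset.mem_map, Finset.mem_filter, Finset.mem_univ, true_and,
        Function.Embedding.subtype_apply, Subtype.exists, exists_and_right, exists_eq_right] at hσ hτ
      obtain ⟨hσ, h1⟩ := hσ
      obtain ⟨hτ, h2⟩ := hτ
      obtain ⟨k, -, hk⟩ := Finset.mem_biUnion.mp hx
      have := congrArg (fun f => (f k ⟨x, hk⟩ : V)) (h1.trans h2.symm)
      exact this)
  rw [Finset.card_univ, Fintype.card_coe] at this
  refine this.trans ?_
  rw [hU, ← hcard]
  exact Nat.mul_le_mul_left _ (Finset.card_le_univ _)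

/-- The weight of the overlaps between a block of size `n` and a block of size `n'`. -/
noncomputable def overlapSum (n n' : ℕ) (θ b : ℝ) : ℝ :=
  ∑ c ∈ Finset.Icc 2 n, (n.choose c : ℝ) * (n'.descFactorial c * θ ^ c * b ^ c.choose 2)

lemma sum_card_ne_one {V : Type*} [DecidableEq V] (s : Finset V) (f : ℕ → ℝ) :
    ∑ A ∈ s.powerset.filter (fun A => A.card ≠ 1), f A.card
      = f 0 + ∑ c ∈ Finset.Icc 2 s.card, (s.card.choose c : ℝ) * f c := by
  rw [Finset.sum_filter]
  rw [Finset.sum_powerset_apply_card (fun k => if k ≠ 1 then f k else 0)]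
  have : Finset.range (s.card + 1) = insert 0 (Finset.Icc 1 s.card) := by
    ext; simp; omega
  rw [this, Finset.sum_insert (by simp)]
  simp only [Nat.choose_zero_right, one_smul, ne_eq, zero_ne_one, not_false_eq_true, if_true]
  congr 1
  have : ∑ c ∈ Finset.Icc 2 s.card, (s.card.choose c : ℝ) * f c
      = ∑ c ∈ Finset.Icc 2 s.card, s.card.choose c • (if ¬ c = 1 then f c else 0) := by
    refine Finset.sum_congr rfl fun c hc => ?_
    rw [if_pos (by simp at hc; omega), nsmul_eq_mul]
  rw [this]
  symm
  refine Finset.sum_subset (Finset.Icc_subset_Icc_left (by norm_num)) ?_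
  intro c h1 h2
  have : c = 1 := by simp at h1 h2; omega
  simp [this]

/-- The exponential moment of the overlap of a fixed family of blocks with a random one. -/
lemma sum_perm_pow_overlap_le {N : ℕ} {J : Type*} [Fintype J] [DecidableEq J]
    (B : J → Finset (Fin N)) (hB : Pairwise fun i j => Disjoint (B i) (B j)) {b C : ℝ} (hb : 1 ≤ b)
    (hC : 0 ≤ C) {θ : J → ℝ} (hθ : ∀ i, 0 ≤ θ i)
    (h : ∀ m : J → ℕ, (∀ i, m i ≤ (B i).card) →
      ((N - ∑ i, m i).factorial : ℝ) ≤ C * N.factorial * ∏ i, θ i ^ m i) :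
    ∑ τ : Equiv.Perm (Fin N),
        b ^ (blockPairs B ∩ (blockPairs B).map τ.toEmbedding.sym2Map).card
      ≤ C * N.factorial * ∏ i, ∏ j, (1 + overlapSum (B i).card (B j).card (θ i) b) := by
  classical
  set 𝒜 : J × J → Finset (Finset (Fin N)) := fun ij =>
    (B ij.1).powerset.filter fun A => A.card ≠ 1
  have hb0 : 0 ≤ b := by linarith
  have hperm : ∀ τ : Equiv.Perm (Fin N),
      b ^ (blockPairs B ∩ (blockPairs B).map τ.toEmbedding.sym2Map).card
      ≤ ∑ A ∈ Fintype.piFinset 𝒜, ∏ ij : J × J,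
        if ∀ x ∈ A ij, τ⁻¹ x ∈ B ij.2 then b ^ (A ij).card.choose 2 else 0 := by
    intro τ
    rw [← Finset.prod_univ_sum 𝒜 fun ij A =>
      if ∀ x ∈ A, τ⁻¹ x ∈ B ij.2 then b ^ A.card.choose 2 else 0]
    calc b ^ (blockPairs B ∩ (blockPairs B).map τ.toEmbedding.sym2Map).card
        ≤ b ^ ∑ ij : J × J, ((B ij.1).filter fun x => τ⁻¹ x ∈ B ij.2).card.choose 2 := by
          refine pow_le_pow_right₀ hb ?_
          simp only [← card_innerPairs]
          refine (Finset.card_le_card ?_).trans Finset.card_biUnion_le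
          intro e
          induction e with | _ u v =>
          rw [Finset.mem_inter, mk_mem_blockPairs, Finset.mem_map]
          rintro ⟨⟨huv, i, hi⟩, e, he, heq⟩
          induction e with | _ u' v' =>
          rw [mk_mem_blockPairs] at he
          obtain ⟨-, j, hj⟩ := he
          have : s(τ u', τ v') = s(u, v) := heq
          rw [Finset.mem_biUnion]
          refine ⟨(i, j), Finset.mem_univ _, ?_⟩
          rw [mk_mem_innerPairs, Finset.mem_filter, Finset.mem_filter]
          rw [Sym2.eq_iff] at this
          rcases this with ⟨rfl, rfl⟩ | ⟨rfl, rfl⟩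
          · simp [hi, hj, huv]
          · simp [hi, hj, huv]
      _ = ∏ ij : J × J, b ^ ((B ij.1).filter fun x => τ⁻¹ x ∈ B ij.2).card.choose 2 := by
          rw [Finset.prod_pow_eq_pow_sum]
      _ ≤ _ := by
          refine Finset.prod_le_prod (fun _ _ => by positivity) fun ij _ => ?_
          set T := (B ij.1).filter fun x => τ⁻¹ x ∈ B ij.2
          have hnn : ∀ A ∈ 𝒜 ij, (0 : ℝ) ≤
              if ∀ x ∈ A, τ⁻¹ x ∈ B ij.2 then b ^ A.card.choose 2 else 0 := by
            intro A _
            split_ifs <;> positivity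
          by_cases hT : T.card = 1
          · refine le_trans (le_of_eq ?_) (Finset.single_le_sum hnn (a := ∅) ?_)
            · simp [hT]
            · simp [𝒜]
          · refine le_trans (le_of_eq ?_) (Finset.single_le_sum hnn (a := T) ?_)
            · rw [if_pos fun x hx => (Finset.mem_filter.mp hx).2]
            · simp only [𝒜, Finset.mem_filter, Finset.mem_powerset]
              exact ⟨Finset.filter_subset _ _, hT⟩
  have hpi : ∀ A ∈ Fintype.piFinset 𝒜,
      ((Finset.univ.filter fun τ : Equiv.Perm (Fin N) =>
        ∀ ij, ∀ x ∈ A ij, τ⁻¹ x ∈ B ij.2).card : ℝ)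
      ≤ C * N.factorial * ∏ ij : J × J,
        ((B ij.2).card.descFactorial (A ij).card * θ ij.1 ^ (A ij).card) := by
    intro A hA
    rcases (Finset.univ.filter fun τ : Equiv.Perm (Fin N) =>
        ∀ ij, ∀ x ∈ A ij, τ⁻¹ x ∈ B ij.2).eq_empty_or_nonempty with h0 | ⟨τ, hτ⟩
    · rw [h0, Finset.card_empty, Nat.cast_zero]
      have : ∀ ij : J × J, 0 ≤ θ ij.1 := fun ij => hθ _
      exact mul_nonneg (by positivity) (Finset.prod_nonneg fun ij _ =>
        mul_nonneg (by positivity) (pow_nonneg (this ij) _))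
    have hsub : ∀ ij, A ij ⊆ B ij.1 := by
      intro ij
      have := Fintype.mem_piFinset.mp hA ij
      simp only [𝒜, Finset.mem_filter, Finset.mem_powerset] at this
      exact this.1
    have hdisj : Pairwise fun k l => Disjoint (A k) (A l) := by
      rintro ⟨i, j⟩ ⟨i', j'⟩ hne
      rw [Finset.disjoint_left]
      intro x hx hx'
      apply hne
      simp only [Finset.mem_filter, Finset.mem_univ, true_and] at hτ
      have e1 : i = i' := by
        by_contra hii
        exact Finset.disjoint_left.mp (hB hii) (hsub _ hx) (hsub _ hx')
      have e2 : j = j' := by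
        by_contra hii
        exact Finset.disjoint_left.mp (hB hii) (hτ _ _ hx) (hτ _ _ hx')
      rw [e1, e2]
    have hcount := card_perm_mapsTo_le A (fun ij => B ij.2) hdisj
    rw [Fintype.card_fin, Fintype.sum_prod_type] at hcount
    have hm := h (fun i => ∑ j, (A (i, j)).card) (by
      intro i
      rw [← Finset.card_biUnion fun j _ j' _ hj => hdisj (by simpa using hj)]
      exact Finset.card_le_card (Finset.biUnion_subset.mpr fun j _ => hsub (i, j)))
    have hinv : (Finset.univ.filter fun τ : Equiv.Perm (Fin N) =>
        ∀ ij, ∀ x ∈ A ij, τ⁻¹ x ∈ B ij.2).card = (Finset.univ.filter fun τ : Equiv.Perm (Fin N) =>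
        ∀ ij, ∀ x ∈ A ij, τ x ∈ B ij.2).card := by
      refine Finset.card_bij (fun τ _ => τ⁻¹) ?_ ?_ ?_
      · intro τ hτ
        simpa using hτ
      · intro τ _ τ' _ h
        exact inv_injective h
      · intro τ hτ
        exact ⟨τ⁻¹, by simpa only [Finset.mem_filter, Finset.mem_univ, true_and, inv_inv] using hτ, inv_inv τ⟩
    rw [hinv]
    calc _ ≤ (((N - ∑ i, ∑ j, (A (i, j)).card).factorial
          * ∏ ij : J × J, (B ij.2).card.descFactorial (A ij).card : ℕ) : ℝ) := by
          refine Nat.cast_le.mpr (le_trans (le_of_eq ?_) hcount)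
          congr
      _ ≤ (C * N.factorial * ∏ i, θ i ^ ∑ j, (A (i, j)).card)
          * ((∏ ij : J × J, (B ij.2).card.descFactorial (A ij).card : ℕ) : ℝ) := by
          push_cast
          gcongr
      _ = _ := by
          rw [Finset.prod_mul_distrib, Fintype.prod_prod_type (f := fun ij => θ ij.1 ^ (A ij).card)]
          simp only [Finset.prod_pow_eq_pow_sum]
          push_cast
          ring
  calc _ ≤ ∑ τ : Equiv.Perm (Fin N), ∑ A ∈ Fintype.piFinset 𝒜, ∏ ij : J × J,
        (if ∀ x ∈ A ij, τ⁻¹ x ∈ B ij.2 then b ^ (A ij).card.choose 2 else 0) :=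
        Finset.sum_le_sum fun τ _ => hperm τ
    _ = ∑ A ∈ Fintype.piFinset 𝒜, (∏ ij : J × J, b ^ (A ij).card.choose 2) *
        ((Finset.univ.filter fun τ : Equiv.Perm (Fin N) =>
          ∀ ij, ∀ x ∈ A ij, τ⁻¹ x ∈ B ij.2).card : ℝ) := by
        rw [Finset.sum_comm]
        refine Finset.sum_congr rfl fun A _ => ?_
        rw [Finset.card_filter, Nat.cast_sum, Finset.mul_sum]
        refine Finset.sum_congr rfl fun τ _ => ?_
        rw [Finset.prod_ite_zero]
        simp
    _ ≤ ∑ A ∈ Fintype.piFinset 𝒜, (∏ ij : J × J, b ^ (A ij).card.choose 2) *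
        (C * N.factorial * ∏ ij : J × J,
        ((B ij.2).card.descFactorial (A ij).card * θ ij.1 ^ (A ij).card)) := by
        refine Finset.sum_le_sum fun A hA => ?_
        exact mul_le_mul_of_nonneg_left (hpi A hA) (Finset.prod_nonneg fun _ _ => by positivity)
    _ = C * N.factorial * ∑ A ∈ Fintype.piFinset 𝒜, ∏ ij : J × J,
        ((B ij.2).card.descFactorial (A ij).card * θ ij.1 ^ (A ij).card
          * b ^ (A ij).card.choose 2) := by
        rw [Finset.mul_sum]
        refine Finset.sum_congr rfl fun A _ => ?_
        rw [Finset.prod_mul_distrib (g := fun ij => b ^ (A ij).card.choose 2)]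
        ring
    _ = _ := by
        rw [← Finset.prod_univ_sum 𝒜 fun ij A =>
          (B ij.2).card.descFactorial A.card * θ ij.1 ^ A.card * b ^ A.card.choose 2, Fintype.prod_prod_type]
        congr 1
        refine Finset.prod_congr rfl fun i _ => Finset.prod_congr rfl fun j _ => ?_
        rw [sum_card_ne_one (B i) fun c => (B j).card.descFactorial c * θ i ^ c * b ^ c.choose 2]
        simp [overlapSum]

lemma gnpMean_mul_sq_le {n : ℕ} {p : ℝ} (hp0 : 0 ≤ p) (hp1 : p ≤ 1)
    (f g : SimpleGraph (Fin n) → ℝ) :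
    gnpMean n p (fun G => f G * g G) ^ 2
      ≤ gnpMean n p (fun G => f G ^ 2) * gnpMean n p (fun G => g G ^ 2) := by
  have := Finset.sum_mul_sq_le_sq_mul_sq Finset.univ (fun G => √(gnpWeight n p G) * f G)
    (fun G => √(gnpWeight n p G) * g G)
  have hw := fun G : SimpleGraph (Fin n) => Real.mul_self_sqrt (gnpWeight_nonneg hp0 hp1 G)
  simp only [gnpMean]
  have e : ∀ u v : SimpleGraph (Fin n) → ℝ, ∑ G, gnpWeight n p G * (u G * v G)
      = ∑ G, √(gnpWeight n p G) * u G * (√(gnpWeight n p G) * v G) := fun u v =>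
    Finset.sum_congr rfl fun G _ => by linear_combination (-(u G * v G)) * hw G
  simp only [sq (f _), sq (g _), e]
  simpa only [sq (_ * _)] using this

lemma ite_mul_ite_of_and_iff {P Q R : Prop} {_ : Decidable P} {_ : Decidable Q} {_ : Decidable R}
    (h : P ∧ Q ↔ R) :
    (if P then (1 : ℝ) else 0) * (if Q then 1 else 0) = if R then 1 else 0 := by
  by_cases hP : P <;> by_cases hQ : Q <;> simp [← h, hP, hQ]

/-- Second moment bound for an isomorphism-invariant set of graphs and a set of forbidden edges. -/
lemma gnpProb_inter_avoid_sq_le {N : ℕ} {p : ℝ} (hp0 : 0 ≤ p) (hp1 : p < 1)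
    {A : Set (SimpleGraph (Fin N))} (hA : ∀ (σ : Equiv.Perm (Fin N)) G, G.comap σ ∈ A ↔ G ∈ A)
    {F : Finset (Sym2 (Fin N))} (hF : F ⊆ allEdges N) :
    gnpProb N p {G | G ∈ A ∧ ∀ e ∈ F, e ∉ G.edgeSet} ^ 2 * N.factorial
      ≤ gnpProb N p A * (1 - p) ^ (2 * F.card) *
        ∑ τ : Equiv.Perm (Fin N), (1 - p)⁻¹ ^ (F ∩ F.map τ.toEmbedding.sym2Map).card := by
  classical
  set P := gnpProb N p {G | G ∈ A ∧ ∀ e ∈ F, e ∉ G.edgeSet} with hP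
  set Fs : Equiv.Perm (Fin N) → Finset (Sym2 (Fin N)) := fun σ => F.map σ.toEmbedding.sym2Map
  have hq : 0 < 1 - p := by linarith
  have hFs : ∀ σ, Fs σ ⊆ allEdges N := by
    intro σ e he
    obtain ⟨e, he', rfl⟩ := Finset.mem_map.mp he
    have := hF he'
    induction e with | _ u v =>
    simpa [allEdges] using this
  have h1 : gnpMean N p (fun G => (if G ∈ A then 1 else 0) *
      ∑ σ, if ∀ e ∈ Fs σ, e ∉ G.edgeSet then 1 else 0) = N.factorial * P := by
    have : ∀ σ : Equiv.Perm (Fin N), gnpMean N p (fun G => (if G ∈ A then 1 else 0) *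
        if ∀ e ∈ Fs σ, e ∉ G.edgeSet then 1 else 0) = P := by
      intro σ
      rw [hP, ← gnpProb_comap_perm p σ, gnpProb_eq_gnpMean]
      congr 1
      funext G
      refine ite_mul_ite_of_and_iff ?_
      simp only [Set.mem_ofPred_eq, hA, Fs, Finset.mem_map, forall_exists_index, and_imp,
        forall_apply_eq_imp_iff₂]
      refine and_congr_right fun _ => forall₂_congr fun e _ => ?_
      induction e with | _ u v => rfl
    simp only [Finset.mul_sum]
    rw [gnpMean_sum]
    simp only [this]
    simp [Fintype.card_perm]
  have h2 : gnpMean N p (fun G => (∑ σ, if ∀ e ∈ Fs σ, e ∉ G.edgeSet then (1 : ℝ) else 0) ^ 2)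
      = N.factorial * ((1 - p) ^ (2 * F.card) * ∑ τ, (1 - p)⁻¹ ^ (F ∩ Fs τ).card) := by
    have hterm : ∀ σ τ : Equiv.Perm (Fin N),
        gnpMean N p (fun G => (if ∀ e ∈ Fs σ, e ∉ G.edgeSet then (1 : ℝ) else 0) *
          if ∀ e ∈ Fs (σ * τ), e ∉ G.edgeSet then (1 : ℝ) else 0)
        = (1 - p) ^ (2 * F.card) * (1 - p)⁻¹ ^ (F ∩ Fs τ).card := by
      intro σ τ
      have e1 : gnpMean N p (fun G => (if ∀ e ∈ Fs σ, e ∉ G.edgeSet then (1 : ℝ) else 0) *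
          if ∀ e ∈ Fs (σ * τ), e ∉ G.edgeSet then (1 : ℝ) else 0)
          = gnpProb N p {G | ∀ e ∈ Fs σ ∪ Fs (σ * τ), e ∉ G.edgeSet} := by
        rw [gnpProb_eq_gnpMean]
        congr 1
        funext G
        refine ite_mul_ite_of_and_iff ?_
        simp only [Set.mem_ofPred_eq, Finset.mem_union, or_imp, forall_and]
      have e2 : Fs (σ * τ) = (Fs τ).map σ.toEmbedding.sym2Map := by
        simp only [Fs, Finset.map_map]
        congr 1
        ext e
        induction e with | _ u v => rfl
      have e3 : (Fs σ ∩ Fs (σ * τ)).card = (F ∩ Fs τ).card := by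
        rw [e2]
        change (F.map _ ∩ _).card = _
        rw [← Finset.map_inter, Finset.card_map]
      have e4 := Finset.card_union_add_card_inter (Fs σ) (Fs (σ * τ))
      have e5 : ∀ σ, (Fs σ).card = F.card := fun σ => Finset.card_map _
      rw [e3, e5, e5] at e4
      rw [e1, gnpProb_avoid p (Finset.union_subset (hFs _) (hFs _)), two_mul, ← e4, pow_add,
        mul_assoc, ← mul_pow, mul_inv_cancel₀ hq.ne', one_pow, mul_one]
    simp only [sq, Finset.sum_mul_sum]
    rw [gnpMean_sum]
    have : ∀ σ : Equiv.Perm (Fin N), gnpMean N p (fun G => ∑ τ,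
        (if ∀ e ∈ Fs σ, e ∉ G.edgeSet then (1 : ℝ) else 0) *
          if ∀ e ∈ Fs τ, e ∉ G.edgeSet then (1 : ℝ) else 0)
        = (1 - p) ^ (2 * F.card) * ∑ τ, (1 - p)⁻¹ ^ (F ∩ Fs τ).card := by
      intro σ
      rw [gnpMean_sum, Finset.mul_sum, ← Equiv.sum_comp (Equiv.mulLeft σ)]
      exact Finset.sum_congr rfl fun τ _ => hterm σ τ
    rw [Finset.sum_congr rfl fun σ _ => this σ]
    simp [Fintype.card_perm]
  have h3 : gnpMean N p (fun G => (if G ∈ A then (1 : ℝ) else 0) ^ 2) = gnpProb N p A := by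
    rw [gnpProb_eq_gnpMean]
    congr 1
    funext G
    by_cases h : G ∈ A
    · rw [if_pos h, one_pow]
    · rw [if_neg h, zero_pow two_ne_zero]
  have key := gnpMean_mul_sq_le hp0 hp1.le (fun G => if G ∈ A then (1 : ℝ) else 0)
    (fun G => ∑ σ, if ∀ e ∈ Fs σ, e ∉ G.edgeSet then (1 : ℝ) else 0)
  rw [h1, h2, h3] at key
  have hN : (0 : ℝ) < N.factorial := by positivity
  refine le_of_mul_le_mul_left ?_ hN
  calc _ = (N.factorial * P) ^ 2 := by ring
    _ ≤ _ := key
    _ = _ := by ring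

lemma overlapSum_nonneg {n n' : ℕ} {θ b : ℝ} (hθ : 0 ≤ θ) (hb : 0 ≤ b) :
    0 ≤ overlapSum n n' θ b :=
  Finset.sum_nonneg fun _ _ => by positivity

/-- The second moment bound for disjoint blocks of vertices to be independent. -/
lemma gnpProb_inter_blocks_sq_le {N : ℕ} {p : ℝ} (hp0 : 0 ≤ p) (hp1 : p < 1)
    {A : Set (SimpleGraph (Fin N))} (hA : ∀ (σ : Equiv.Perm (Fin N)) G, G.comap σ ∈ A ↔ G ∈ A)
    {J : Type*} [Fintype J] [DecidableEq J]
    (B : J → Finset (Fin N)) (hB : Pairwise fun i j => Disjoint (B i) (B j)) {C Z : ℝ}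
    (hC : 0 ≤ C) {θ : J → ℝ} (hθ : ∀ i, 0 ≤ θ i)
    (h : ∀ m : J → ℕ, (∀ i, m i ≤ (B i).card) →
      ((N - ∑ i, m i).factorial : ℝ) ≤ C * N.factorial * ∏ i, θ i ^ m i)
    (hZ : ∀ i j, overlapSum (B i).card (B j).card (θ i) (1 - p)⁻¹ ≤ Z) :
    gnpProb N p {G | G ∈ A ∧ ∀ e ∈ blockPairs B, e ∉ G.edgeSet} ^ 2
      ≤ gnpProb N p A * (1 - p) ^ (2 * (blockPairs B).card) *
        (C * exp (Fintype.card J * (Fintype.card J * Z))) := by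
  have hq : 0 < 1 - p := by linarith
  have hb : 1 ≤ (1 - p)⁻¹ := (one_le_inv₀ hq).mpr (by linarith)
  have h1 := gnpProb_inter_avoid_sq_le hp0 hp1 hA (blockPairs_subset_allEdges B)
  have h2 := sum_perm_pow_overlap_le B hB hb hC hθ h
  have h3 : ∏ i, ∏ j, (1 + overlapSum (B i).card (B j).card (θ i) (1 - p)⁻¹)
      ≤ exp (Fintype.card J * (Fintype.card J * Z)) := by
    calc _ ≤ ∏ _i : J, ∏ _j : J, exp Z := by
          have h0 : ∀ i j, 0 ≤ overlapSum (B i).card (B j).card (θ i) (1 - p)⁻¹ := fun i j =>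
            overlapSum_nonneg (hθ i) (by linarith)
          refine Finset.prod_le_prod (fun i _ => Finset.prod_nonneg fun j _ => ?_) fun i _ =>
            Finset.prod_le_prod (fun j _ => ?_) fun j _ => ?_
          · linarith [h0 i j]
          · linarith [h0 i j]
          · linarith [add_one_le_exp Z, hZ i j]
      _ = _ := by
          simp [← exp_nat_mul]
  have hN : (0 : ℝ) < N.factorial := by positivity
  refine le_of_mul_le_mul_right (h1.trans ?_) hN
  have hP := gnpProb_nonneg hp0 hp1.le A
  calc _ ≤ gnpProb N p A * (1 - p) ^ (2 * (blockPairs B).card) * (C * N.factorial *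
        exp (Fintype.card J * (Fintype.card J * Z))) := by
        refine mul_le_mul_of_nonneg_left (h2.trans ?_) (by positivity)
        exact mul_le_mul_of_nonneg_left h3 (by positivity)
    _ = _ := by ring

/-- A coloring of the graph outside a family of independent blocks extends by one new color per
block. -/
lemma colorable_of_blocks {N T : ℕ} {J : Type*} [Fintype J] {G : SimpleGraph (Fin N)}
    {B : J → Finset (Fin N)} (hG : ∀ e ∈ blockPairs B, e ∉ G.edgeSet)
    (hT : (G.induce {v | ∀ j, v ∉ B j}).Colorable T) : G.Colorable (Fintype.card J + T) := by
  classical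
  obtain ⟨C⟩ := hT
  have hcol : G.Coloring (J ⊕ Fin T) := SimpleGraph.Coloring.mk
    (fun v => if h : ∃ j, v ∈ B j then Sum.inl h.choose
      else Sum.inr (C ⟨v, fun j hj => h ⟨j, hj⟩⟩)) (by
      intro u v huv
      by_cases hu : ∃ j, u ∈ B j <;> by_cases hv : ∃ j, v ∈ B j
      · rw [dif_pos hu, dif_pos hv]
        intro h
        have h := Sum.inl_injective h
        refine hG s(u, v) (mk_mem_blockPairs.mpr ⟨huv.ne, hu.choose, hu.choose_spec, ?_⟩) huv
        rw [h]
        exact hv.choose_spec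
      · rw [dif_pos hu, dif_neg hv]
        exact Sum.inl_ne_inr
      · rw [dif_neg hu, dif_pos hv]
        exact Sum.inr_ne_inl
      · rw [dif_neg hu, dif_neg hv]
        intro h
        exact C.valid (v := ⟨u, _⟩) (w := ⟨v, _⟩) huv (Sum.inr_injective h))
  simpa using hcol.colorable

lemma chrom_comap_perm {n : ℕ} (σ : Equiv.Perm (Fin n)) (G : SimpleGraph (Fin n)) :
    chrom (G.comap σ) = chrom G := by
  have h : ∀ (σ : Equiv.Perm (Fin n)) (G : SimpleGraph (Fin n)), chrom (G.comap σ) ≤ chrom G := by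
    intro σ G
    rw [chrom_le_iff]
    obtain ⟨C⟩ := colorable_chrom G
    exact ⟨SimpleGraph.Coloring.mk (fun v => C (σ v)) fun huv => C.valid huv⟩
  refine le_antisymm (h σ G) ?_
  have := h σ⁻¹ (G.comap σ)
  have e : (G.comap σ).comap (σ⁻¹ : Equiv.Perm (Fin n)) = G := by
    ext u v
    simp
  rwa [e] at this

lemma factorial_sub_le {N m : ℕ} (h : 2 * m ^ 2 ≤ N) :
    ((N - m).factorial : ℝ) ≤ 2 * N.factorial * (1 / N) ^ m := by
  rcases Nat.eq_zero_or_pos m with rfl | hm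
  · simp
    have : (0 : ℝ) < N.factorial := by positivity
    linarith
  have hmN : m ≤ N := by nlinarith
  have hN : (0 : ℝ) < N := by exact_mod_cast (by omega : 0 < N)
  have h1 : (N - m) ^ m ≤ N.descFactorial m :=
    (Nat.pow_le_pow_left (by omega) m).trans (Nat.pow_sub_le_descFactorial N m)
  have h2 : (1 : ℝ) / 2 ≤ (1 - m / N) ^ m := by
    have := one_add_mul_le_pow (a := -(m / N : ℝ)) (by
      have : (m : ℝ) / N ≤ 1 := by rw [div_le_one hN]; exact_mod_cast hmN
      linarith) m
    have h3 : (m : ℝ) * (m / N) ≤ 1 / 2 := by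
      rw [← mul_div_assoc, div_le_div_iff₀ hN (by norm_num)]
      have : (2 * m ^ 2 : ℝ) ≤ N := by exact_mod_cast h
      nlinarith
    rw [← sub_eq_add_neg] at this
    linarith
  have h3 : ((N - m : ℕ) : ℝ) ^ m = N ^ m * (1 - m / N) ^ m := by
    rw [Nat.cast_sub hmN, ← mul_pow]
    congr 1
    field_simp
  have h4 : (N : ℝ) ^ m ≤ 2 * N.descFactorial m := by
    have : ((N - m : ℕ) : ℝ) ^ m ≤ N.descFactorial m := by exact_mod_cast h1
    rw [h3] at this
    have : (N : ℝ) ^ m * (1 / 2) ≤ N ^ m * (1 - m / N) ^ m := by gcongr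
    linarith
  have h5 : (N.factorial : ℝ) = (N - m).factorial * N.descFactorial m := by
    exact_mod_cast (Nat.factorial_mul_descFactorial hmN).symm
  rw [one_div, inv_pow, ← div_eq_mul_inv, le_div_iff₀ (by positivity), h5]
  calc ((N - m).factorial : ℝ) * N ^ m ≤ (N - m).factorial * (2 * N.descFactorial m) := by gcongr
    _ = _ := by ring

/-- Planting `r` disjoint independent sets of size `a`: the chromatic number of the enlarged graph
is at most `r` larger. -/
lemma gnpProb_chrom_le_sq_le {n a r : ℕ} {p : ℝ} (hp0 : 0 ≤ p) (hp1 : p < 1) {S T Z : ℝ}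
    (hN : 2 * (r * a) ^ 2 ≤ n + r * a) (hST : T + r < S)
    (hZ : overlapSum a a (1 / (n + r * a : ℕ)) (1 - p)⁻¹ ≤ Z) :
    gnpProb n p {G | (chrom G : ℝ) ≤ T} ^ 2
      ≤ gnpProb (n + r * a) p {G | (chrom G : ℝ) < S} * (2 * exp (r * (r * Z))) := by
  classical
  set B : Fin r → Finset (Fin (n + r * a)) := fun j => Finset.univ.map
    ⟨fun i : Fin a => Fin.natAdd n (finProdFinEquiv (j, i)), fun i i' h => by simpa using h⟩ with hB
  have hBcard : ∀ j, (B j).card = a := fun j => by simp [hB]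
  have hBmem : ∀ j x, x ∈ B j ↔ ∃ i, Fin.natAdd n (finProdFinEquiv (j, i)) = x := by
    intro j x
    simp only [hB, Finset.mem_map, Finset.mem_univ, true_and]
    rfl
  have hBdisj : Pairwise fun i j => Disjoint (B i) (B j) := by
    intro i j hij
    rw [Finset.disjoint_left]
    intro x hx hx'
    rw [hBmem] at hx hx'
    obtain ⟨k, rfl⟩ := hx
    obtain ⟨l, h⟩ := hx'
    simp only [Fin.natAdd_inj, EmbeddingLike.apply_eq_iff_eq, Prod.mk.injEq] at h
    exact hij h.1.symm
  have hind := gnpProb_comap_inter p (Fin.castAddEmb (r * a)) {G : SimpleGraph (Fin n) | (chrom G : ℝ) ≤ T}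
    (blockPairs_subset_allEdges B) (by
      intro e
      induction e with | _ u v =>
      rw [Sym2.map_mk, mk_mem_blockPairs]
      rintro ⟨-, j, h, -⟩
      rw [hBmem] at h
      obtain ⟨i, h⟩ := h
      exact absurd (congrArg Fin.val h) (by simp; omega))
  have hsub : gnpProb (n + r * a) p {G | G.comap (Fin.castAddEmb (r * a)) ∈
        {G : SimpleGraph (Fin n) | (chrom G : ℝ) ≤ T} ∧ ∀ e ∈ blockPairs B, e ∉ G.edgeSet}
      ≤ gnpProb (n + r * a) p {G | G ∈ {G | (chrom G : ℝ) < S} ∧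
          ∀ e ∈ blockPairs B, e ∉ G.edgeSet} := by
    refine gnpProb_mono hp0 hp1.le ?_
    rintro G ⟨h1, h2⟩
    refine ⟨?_, h2⟩
    have hG : chrom G ≤ Fintype.card (Fin r) + chrom (G.comap (Fin.castAddEmb (r * a))) := by
      rw [chrom_le_iff]
      refine colorable_of_blocks h2 ?_
      obtain ⟨C⟩ := colorable_chrom (G.comap (Fin.castAddEmb (r * a)))
      have hlt : ∀ v : {v // v ∈ {v | ∀ j, v ∉ B j}}, v.1.val < n := by
        intro ⟨v, hv⟩
        by_contra hn
        obtain ⟨w, rfl⟩ : ∃ w : Fin (r * a), Fin.natAdd n w = v :=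
          ⟨⟨v.val - n, by omega⟩, by ext; simp; simp at hn; omega⟩
        refine hv (finProdFinEquiv.symm w).1 ((hBmem _ _).mpr ⟨(finProdFinEquiv.symm w).2, ?_⟩)
        rw [Prod.mk.eta, Equiv.apply_symm_apply]
      exact ⟨SimpleGraph.Coloring.mk (fun v => C ⟨v.1.val, hlt v⟩) fun {u v} huv =>
        C.valid (by simpa using huv)⟩
    rw [Fintype.card_fin] at hG
    have hG' : (chrom G : ℝ) ≤ r + chrom (G.comap (Fin.castAddEmb (r * a))) := by exact_mod_cast hG
    have h1 : (chrom (G.comap (Fin.castAddEmb (r * a))) : ℝ) ≤ T := h1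
    change (chrom G : ℝ) < S
    linarith
  rw [hind] at hsub
  have hsq := gnpProb_inter_blocks_sq_le hp0 hp1 (A := {G : SimpleGraph (Fin (n + r * a)) |
    (chrom G : ℝ) < S}) (by intro σ G; simp only [Set.mem_ofPred_eq, chrom_comap_perm]) B hBdisj
    (C := 2) (Z := Z) (by norm_num) (θ := fun _ => 1 / (n + r * a : ℕ)) (fun _ => by positivity) (by
      intro m hm
      rw [Finset.prod_pow_eq_pow_sum]
      refine factorial_sub_le (le_trans ?_ hN)
      have : ∑ i, m i ≤ r * a := by
        refine (Finset.sum_le_sum fun i _ => hm i).trans ?_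
        simp [hBcard]
      gcongr) (by
      intro i j
      rw [hBcard, hBcard]
      exact hZ)
  have hq : 0 < 1 - p := by linarith
  have hP := gnpProb_nonneg (n := n) hp0 hp1.le {G | (chrom G : ℝ) ≤ T}
  have h1 := (pow_le_pow_left₀ (by positivity) hsub 2).trans hsq
  rw [Fintype.card_fin, mul_pow, ← pow_mul, mul_comm _ 2, mul_right_comm (gnpProb _ _ _)] at h1
  exact le_of_mul_le_mul_right h1 (by positivity)

/-- Lower bound for the probability of having a coloring with color classes of given sizes. -/
lemma one_le_gnpProb_chrom_le_mul {n : ℕ} {p : ℝ} (hp0 : 0 ≤ p) (hp1 : p < 1) {J : Type*}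
    [Fintype J] [DecidableEq J] (d : J → ℕ) (hd : ∑ j, d j ≤ n) {C Z : ℝ}
    (hC : 0 ≤ C) {θ : J → ℝ} (hθ : ∀ i, 0 ≤ θ i)
    (h : ∀ m : J → ℕ, (∀ i, m i ≤ d i) →
      ((n - ∑ i, m i).factorial : ℝ) ≤ C * n.factorial * ∏ i, θ i ^ m i)
    (hZ : ∀ i j, overlapSum (d i) (d j) (θ i) (1 - p)⁻¹ ≤ Z) {x : ℝ}
    (hx : Fintype.card J + ((n : ℝ) - ∑ j, (d j : ℝ)) ≤ x) :
    1 ≤ gnpProb n p {G | (chrom G : ℝ) ≤ x}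
      * (C * exp (Fintype.card J * (Fintype.card J * Z))) := by
  classical
  obtain ⟨φ⟩ : Nonempty ((Σ j, Fin (d j)) ↪ Fin n) :=
    Function.Embedding.nonempty_of_card_le (by simpa using hd)
  set B : J → Finset (Fin n) := fun j => Finset.univ.map
    ⟨fun i : Fin (d j) => φ ⟨j, i⟩, fun i i' h => by simpa using h⟩ with hB
  have hBcard : ∀ j, (B j).card = d j := fun j => by simp [hB]
  have hBmem : ∀ j x, x ∈ B j ↔ ∃ i, φ ⟨j, i⟩ = x := by
    intro j x
    simp only [hB, Finset.mem_map, Finset.mem_univ, true_and]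
    rfl
  have hBdisj : Pairwise fun i j => Disjoint (B i) (B j) := by
    intro i j hij
    rw [Finset.disjoint_left]
    intro x hx hx'
    rw [hBmem] at hx hx'
    obtain ⟨k, rfl⟩ := hx
    obtain ⟨l, h⟩ := hx'
    exact hij (congrArg Sigma.fst (φ.injective h)).symm
  have hsq := gnpProb_inter_blocks_sq_le hp0 hp1 (A := {G : SimpleGraph (Fin n) |
    (chrom G : ℝ) ≤ x}) (by intro σ G; simp only [Set.mem_ofPred_eq, chrom_comap_perm]) B hBdisj
    hC hθ (Z := Z) (by simpa only [hBcard] using h) (by simpa only [hBcard] using hZ)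
  have hsub : {G : SimpleGraph (Fin n) | ∀ e ∈ blockPairs B, e ∉ G.edgeSet}
      ⊆ {G | G ∈ {G | (chrom G : ℝ) ≤ x} ∧ ∀ e ∈ blockPairs B, e ∉ G.edgeSet} := by
    intro G hG
    refine ⟨?_, hG⟩
    have hcol : chrom G ≤ Fintype.card J + (n - ∑ j, d j) := by
      rw [chrom_le_iff]
      refine colorable_of_blocks hG ?_
      have hcard : Fintype.card {v // v ∈ {v | ∀ j, v ∉ B j}} = n - ∑ j, d j := by
        have e : ∑ j, d j = (Finset.univ.biUnion B).card := by
          rw [Finset.card_biUnion fun i _ j _ hij => hBdisj hij]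
          simp only [hBcard]
        rw [e, Fintype.card_subtype]
        have : (Finset.univ.filter fun v => v ∈ {v | ∀ j, v ∉ B j}) = (Finset.univ.biUnion B)ᶜ := by
          ext v
          simp
        rw [this, Finset.card_compl, Fintype.card_fin]
      rw [← hcard]
      exact SimpleGraph.colorable_of_fintype _
    have : ((chrom G : ℕ) : ℝ) ≤ ((Fintype.card J + (n - ∑ j, d j) : ℕ) : ℝ) := by
      exact_mod_cast hcol
    push_cast [Nat.cast_sub hd] at this
    exact this.trans hx
  have h1 := gnpProb_mono hp0 hp1.le hsub
  rw [gnpProb_avoid p (blockPairs_subset_allEdges B)] at h1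
  have hq : 0 < 1 - p := by linarith
  have h2 := (pow_le_pow_left₀ (by positivity) h1 2).trans hsq
  rw [← pow_mul, mul_comm _ 2, mul_right_comm (gnpProb _ _ _)] at h2
  refine le_of_mul_le_mul_right (a := (1 - p) ^ (2 * (blockPairs B).card)) ?_ (by positivity)
  rwa [one_mul]

lemma exists_surjective_coloring {V : Type*} [Fintype V] {G : SimpleGraph V} {k : ℕ}
    (hG : G.Colorable k) (hk : k ≤ Fintype.card V) :
    ∃ C : G.Coloring (Fin k), Function.Surjective C := by
  classical
  obtain ⟨C₀⟩ := hG
  obtain ⟨C, hC⟩ : ∃ C : G.Coloring (Fin k), ∀ C' : G.Coloring (Fin k),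
      (Finset.univ.image C').card ≤ (Finset.univ.image C).card := by
    have : Nonempty (G.Coloring (Fin k)) := ⟨C₀⟩
    have hfin : Finite (G.Coloring (Fin k)) := DFunLike.finite _
    exact Finite.exists_max fun C : G.Coloring (Fin k) => (Finset.univ.image C).card
  refine ⟨C, fun c => ?_⟩
  by_contra! hc
  have hlt : (Finset.univ.image C).card < k := by
    have : (Finset.univ.image C) ⊂ Finset.univ := by
      rw [Finset.ssubset_univ_iff]
      intro h
      have := h ▸ Finset.mem_univ c
      simp only [Finset.mem_image, Finset.mem_univ, true_and] at this
      obtain ⟨x, hx⟩ := this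
      exact hc x hx
    simpa using Finset.card_lt_card this
  obtain ⟨u, -, v, -, huv, hCuv⟩ := Finset.exists_ne_map_eq_of_card_lt_of_maps_to
    (s := Finset.univ) (t := Finset.univ.image C) (f := C) (by
      rw [Finset.card_univ]; omega) (by intro x _; simp)
  have hvalid : ∀ x y, G.Adj x y → Function.update C u c x ≠ Function.update C u c y := by
    intro x y hxy
    by_cases hx : x = u
    · subst hx
      rw [Function.update_self, Function.update_of_ne hxy.ne']
      exact (hc y).symm
    · by_cases hy : y = u
      · subst hy
        rw [Function.update_self, Function.update_of_ne hxy.ne]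
        exact hc x
      · rw [Function.update_of_ne hx, Function.update_of_ne hy]
        exact C.valid hxy
  obtain ⟨C', hC'⟩ : ∃ C' : G.Coloring (Fin k), ⇑C' = Function.update C u c :=
    ⟨⟨Function.update C u c, fun {x y} h => hvalid x y h⟩, rfl⟩
  have hC'u : C' u = c := by rw [hC', Function.update_self]
  have hC'ne : ∀ x, x ≠ u → C' x = C x := fun x hx => by
    rw [hC', Function.update_of_ne hx]
  have hsub : Finset.univ.image C ⊂ Finset.univ.image C' := by
    rw [Finset.ssubset_iff_of_subset]
    · refine ⟨c, Finset.mem_image.mpr ⟨u, Finset.mem_univ _, hC'u⟩, ?_⟩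
      simp only [Finset.mem_image, Finset.mem_univ, true_and, not_exists]
      exact hc
    · intro y hy
      obtain ⟨x, -, rfl⟩ := Finset.mem_image.mp hy
      by_cases hx : x = u
      · refine Finset.mem_image.mpr ⟨v, Finset.mem_univ _, ?_⟩
        rw [hC'ne v huv.symm, ← hCuv, hx]
      · exact Finset.mem_image.mpr ⟨x, Finset.mem_univ _, hC'ne x hx⟩
  exact absurd (Finset.card_lt_card hsub) (not_lt.mpr (hC C'))

lemma card_blockPairs {V J : Type*} [DecidableEq V] [Fintype J] (B : J → Finset V)
    (hB : Pairwise fun i j => Disjoint (B i) (B j)) :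
    (blockPairs B).card = ∑ j, (B j).card.choose 2 := by
  classical
  rw [blockPairs, Finset.card_biUnion]
  · simp only [card_innerPairs]
  · intro i _ j _ hij
    change Disjoint (innerPairs (B i)) (innerPairs (B j))
    rw [Finset.disjoint_left]
    intro e
    induction e with | _ u v =>
    rw [mk_mem_innerPairs, mk_mem_innerPairs]
    intro h h'
    exact Finset.disjoint_left.mp (hB hij) h.1 h'.1

/-- First moment bound for the existence of a coloring. -/
lemma gnpProb_chrom_le_mul_factorial_le {n k : ℕ} {p : ℝ} (hp0 : 0 ≤ p) (hp1 : p < 1)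
    (hkn : k ≤ n) (hk : 0 < k) :
    gnpProb n p {G | chrom G ≤ k} * k.factorial
      ≤ k ^ n * exp (log (1 - p) * (((n : ℝ) ^ 2 / k - n) / 2)) := by
  classical
  have hq : 0 < 1 - p := by linarith
  set B : (Fin n → Fin k) → Fin k → Finset (Fin n) := fun f i => Finset.univ.filter fun v => f v = i
  have hB : ∀ f, Pairwise fun i j => Disjoint (B f i) (B f j) := by
    intro f i j hij
    rw [Finset.disjoint_left]
    intro v hv hv'
    simp only [B, Finset.mem_filter] at hv hv'
    exact hij (hv.2.symm.trans hv'.2)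
  have hBsum : ∀ f, ∑ i, (B f i).card = n := by
    intro f
    have := Finset.card_eq_sum_card_fiberwise (s := Finset.univ) (t := Finset.univ) (f := f)
      (by intro x _; simp)
    simpa [B] using this.symm
  have hterm : ∀ f, gnpProb n p {G | ∀ e ∈ blockPairs (B f), e ∉ G.edgeSet}
      ≤ exp (log (1 - p) * (((n : ℝ) ^ 2 / k - n) / 2)) := by
    intro f
    rw [gnpProb_avoid p (blockPairs_subset_allEdges _), ← exp_log hq, ← exp_nat_mul, exp_le_exp,
      log_exp, mul_comm]
    refine mul_le_mul_of_nonpos_left ?_ (log_nonpos hq.le (by linarith))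
    rw [card_blockPairs _ (hB f), Nat.cast_sum]
    have h1 : ((n : ℝ)) = ∑ i, ((B f i).card : ℝ) := by exact_mod_cast (hBsum f).symm
    have h2 : (n : ℝ) ^ 2 ≤ k * ∑ i, ((B f i).card : ℝ) ^ 2 := by
      rw [h1]
      simpa using sq_sum_le_card_mul_sum_sq (s := Finset.univ) (f := fun i => ((B f i).card : ℝ))
    have h3 : (n : ℝ) ^ 2 / k ≤ ∑ i, ((B f i).card : ℝ) ^ 2 := by
      rw [div_le_iff₀' (by exact_mod_cast hk)]
      exact h2
    have h4 : ∑ i, (((B f i).card.choose 2 : ℕ) : ℝ)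
        = (∑ i, ((B f i).card : ℝ) ^ 2 - ∑ i, ((B f i).card : ℝ)) / 2 := by
      rw [← Finset.sum_sub_distrib, Finset.sum_div]
      refine Finset.sum_congr rfl fun i _ => ?_
      rw [Nat.cast_choose_two]
      ring
    rw [h4, ← h1]
    linarith
  have hcount : ∀ G : SimpleGraph (Fin n), (k.factorial : ℝ) * (if chrom G ≤ k then 1 else 0)
      ≤ ∑ f : Fin n → Fin k, if ∀ e ∈ blockPairs (B f), e ∉ G.edgeSet then 1 else 0 := by
    intro G
    split_ifs with h
    · obtain ⟨C, hC⟩ := exists_surjective_coloring (chrom_le_iff.mp h) (by simpa using hkn)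
      rw [Finset.sum_boole, mul_one, Nat.cast_le]
      have : k.factorial = (Finset.univ : Finset (Equiv.Perm (Fin k))).card := by
        simp [Fintype.card_perm]
      rw [this]
      refine Finset.card_le_card_of_injOn (fun σ v => σ (C v)) ?_ ?_
      · intro σ _
        simp only [Finset.coe_filter, Finset.mem_univ, true_and, Set.mem_ofPred_eq]
        intro e
        induction e with | _ u v =>
        rw [mk_mem_blockPairs]
        rintro ⟨-, i, hu, hv⟩ huv
        simp only [B, Finset.mem_filter] at hu hv
        exact C.valid huv (σ.injective (hu.2.trans hv.2.symm))
      · intro σ _ τ _ h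
        ext i
        obtain ⟨v, rfl⟩ := hC i
        exact congrArg Fin.val (congrFun h v)
    · rw [mul_zero]
      exact Finset.sum_nonneg fun f _ => by split_ifs <;> norm_num
  rw [gnpProb_eq_gnpMean, mul_comm, ← gnpMean_const_mul]
  refine (gnpMean_mono hp0 hp1.le fun G => (le_of_eq ?_).trans (hcount G)).trans ?_
  · by_cases h : chrom G ≤ k
    · rw [if_pos h, if_pos (show G ∈ {G : SimpleGraph (Fin n) | chrom G ≤ k} from h)]
    · rw [if_neg h, if_neg (show G ∉ {G : SimpleGraph (Fin n) | chrom G ≤ k} from h)]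
  rw [gnpMean_sum]
  calc _ ≤ ∑ _f : Fin n → Fin k, exp (log (1 - p) * (((n : ℝ) ^ 2 / k - n) / 2)) := by
        refine Finset.sum_le_sum fun f _ => ?_
        have := hterm f
        rw [gnpProb_eq_gnpMean] at this
        refine le_trans (le_of_eq ?_) this
        congr! 3
    _ = _ := by simp

lemma gnpProb_le_div {n : ℕ} {p : ℝ} (hp0 : 0 ≤ p) (hp1 : p ≤ 1) {f : SimpleGraph (Fin n) → ℝ}
    (hf : ∀ G, 0 ≤ f G) {T : ℝ} (hT : 0 < T) :
    gnpProb n p {G | T ≤ f G} ≤ gnpMean n p f / T := by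
  classical
  rw [le_div_iff₀ hT, mul_comm, gnpProb_eq_gnpMean, ← gnpMean_const_mul]
  refine gnpMean_mono hp0 hp1 fun G => ?_
  split_ifs with h
  · simpa using h
  · simpa using hf G

open scoped Classical in
/-- The number of independent sets of size `s`. -/
noncomputable def indepCount {n : ℕ} (s : ℕ) (G : SimpleGraph (Fin n)) : ℕ :=
  ((Finset.univ.powersetCard s).filter fun S => ∀ e ∈ innerPairs S, e ∉ G.edgeSet).card

lemma gnpMean_indepCount (n s : ℕ) (p : ℝ) :
    gnpMean n p (fun G => (indepCount s G : ℝ)) = n.choose s * (1 - p) ^ s.choose 2 := by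
  classical
  have : ∀ G : SimpleGraph (Fin n), (indepCount s G : ℝ)
      = ∑ S ∈ Finset.univ.powersetCard s, if ∀ e ∈ innerPairs S, e ∉ G.edgeSet then 1 else 0 := by
    intro G
    rw [Finset.sum_boole, indepCount]
  simp only [this]
  rw [gnpMean_sum]
  calc _ = ∑ S ∈ (Finset.univ : Finset (Fin n)).powersetCard s, (1 - p) ^ s.choose 2 := by
        refine Finset.sum_congr rfl fun S hS => ?_
        have hsub : innerPairs S ⊆ allEdges n := by
          intro e
          induction e with | _ u v =>
          rw [mk_mem_innerPairs]
          intro h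
          simpa [allEdges] using h.2.2
        have h := gnpProb_avoid p hsub
        rw [card_innerPairs, (Finset.mem_powersetCard.mp hS).2, gnpProb_eq_gnpMean] at h
        rw [← h]
        congr! 3
    _ = _ := by simp

/-- If there are few independent sets of size `a` and none of size `a + 1`, then colorings need
many colors. -/
lemma gnpProb_chrom_le_le_indepCount {n a : ℕ} {p : ℝ} (hp0 : 0 ≤ p) (hp1 : p ≤ 1) (ha : 1 ≤ a)
    {x T : ℝ} (hT : 0 < T) (hx : (a - 1) * x + T < n) :
    gnpProb n p {G | (chrom G : ℝ) ≤ x}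
      ≤ n.choose a * (1 - p) ^ a.choose 2 / T
        + n.choose (a + 1) * (1 - p) ^ (a + 1).choose 2 := by
  classical
  have h1 := gnpProb_le_div hp0 hp1 (n := n) (f := fun G => (indepCount a G : ℝ))
    (fun G => Nat.cast_nonneg _) hT
  have h2 := gnpProb_le_div hp0 hp1 (n := n) (f := fun G => (indepCount (a + 1) G : ℝ))
    (fun G => Nat.cast_nonneg _) one_pos
  rw [gnpMean_indepCount] at h1 h2
  rw [div_one] at h2
  refine le_trans ?_ (add_le_add h1 h2)
  refine (gnpProb_mono hp0 hp1 ?_).trans (gnpProb_union_le hp0 hp1 _ _)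
  intro G hG
  have hG : (chrom G : ℝ) ≤ x := hG
  by_contra hno
  simp only [Set.mem_union, Set.mem_ofPred_eq, not_or, not_le] at hno
  obtain ⟨hTlt, h0⟩ := hno
  have h0 : indepCount (a + 1) G = 0 := by
    have : indepCount (a + 1) G < 1 := by exact_mod_cast h0
    omega
  obtain ⟨C⟩ := colorable_chrom G
  set B : Fin (chrom G) → Finset (Fin n) := fun i => Finset.univ.filter fun v => C v = i
  have hind : ∀ i, ∀ e ∈ innerPairs (B i), e ∉ G.edgeSet := by
    intro i e
    induction e with | _ u v =>
    rw [mk_mem_innerPairs]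
    rintro ⟨hu, hv, -⟩ huv
    simp only [B, Finset.mem_filter] at hu hv
    exact C.valid huv (hu.2.trans hv.2.symm)
  have hle : ∀ i, (B i).card ≤ a := by
    intro i
    by_contra! hlt
    obtain ⟨S, hS, hcard⟩ := Finset.exists_subset_card_eq hlt
    rw [indepCount, Finset.card_eq_zero, Finset.filter_eq_empty_iff] at h0
    refine h0 (x := S) (Finset.mem_powersetCard.mpr ⟨Finset.subset_univ _, hcard⟩) ?_
    intro e he
    refine hind i e ?_
    induction e with | _ u v =>
    rw [mk_mem_innerPairs] at he ⊢
    exact ⟨hS he.1, hS he.2.1, he.2.2⟩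
  have hBsum : ∑ i, (B i).card = n := by
    have := Finset.card_eq_sum_card_fiberwise (s := Finset.univ) (t := Finset.univ) (f := C)
      (by intro x _; simp)
    simpa [B] using this.symm
  have hfew : (Finset.univ.filter fun i => (B i).card = a).card ≤ indepCount a G := by
    rw [indepCount]
    refine Finset.card_le_card_of_injOn B ?_ ?_
    · intro i hi
      simp only [Finset.coe_filter, Finset.mem_univ, true_and, Set.mem_ofPred_eq,
        Finset.mem_powersetCard] at hi ⊢
      exact ⟨⟨Finset.subset_univ _, hi⟩, hind i⟩
    · intro i hi j _ hij
      simp only [Finset.coe_filter, Finset.mem_univ, true_and, Set.mem_ofPred_eq] at hi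
      obtain ⟨v, hv⟩ : (B i).Nonempty := Finset.card_pos.mp (by omega)
      have hv' : v ∈ B j := hij ▸ hv
      simp only [B, Finset.mem_filter] at hv hv'
      exact hv.2.symm.trans hv'.2
  have hn : n ≤ (a - 1) * chrom G + indepCount a G := by
    calc n = ∑ i, (B i).card := hBsum.symm
      _ ≤ ∑ i, ((a - 1) + if (B i).card = a then 1 else 0) := by
          refine Finset.sum_le_sum fun i _ => ?_
          have := hle i
          split_ifs <;> omega
      _ = (a - 1) * chrom G + (Finset.univ.filter fun i => (B i).card = a).card := by
          rw [Finset.sum_add_distrib, Finset.sum_boole]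
          simp [mul_comm]
      _ ≤ _ := by omega
  have hn' : (n : ℝ) ≤ (a - 1) * chrom G + indepCount a G := by
    have : (n : ℝ) ≤ (((a - 1) * chrom G + indepCount a G : ℕ) : ℝ) := by exact_mod_cast hn
    push_cast [Nat.cast_sub ha] at this
    exact this
  have ha' : (0 : ℝ) ≤ a - 1 := by
    have : (1 : ℝ) ≤ a := by exact_mod_cast ha
    linarith
  have := mul_le_mul_of_nonneg_left hG ha'
  linarith

lemma log_factorial_le {n : ℕ} (hn : 1 ≤ n) :
    log n.factorial ≤ 1 + log n + n * log n - n := by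
  induction n, hn using Nat.le_induction with
  | base => simp
  | succ k hk ih =>
    have hk0 : (0 : ℝ) < k := by exact_mod_cast hk
    have hk1 : (0 : ℝ) < k + 1 := by linarith
    rw [Nat.factorial_succ, Nat.cast_mul, log_mul (by positivity) (by positivity)]
    push_cast
    have h := log_le_sub_one_of_pos (div_pos hk0 hk1)
    rw [log_div hk0.ne' hk1.ne'] at h
    have h' : (k + 1 : ℝ) * (log k - log (k + 1)) ≤ -1 := by
      calc _ ≤ (k + 1 : ℝ) * (k / (k + 1) - 1) := mul_le_mul_of_nonneg_left h hk1.le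
        _ = -1 := by field_simp; ring
    linarith

lemma le_log_factorial (n : ℕ) : n * log n - n ≤ log n.factorial := by
  rcases Nat.eq_zero_or_pos n with rfl | hn
  · simp
  have hn' : (0 : ℝ) < n := by exact_mod_cast hn
  have h := log_le_log (by positivity) (pow_div_factorial_le_exp (n : ℝ) hn'.le n)
  rw [log_div (by positivity) (by positivity), log_pow, log_exp] at h
  linarith

lemma descFactorial_mul_pow_mul_pow_le_of_le {n n' a c m : ℕ} {θ L : ℝ} (hn : n ≤ a) (hn' : n' ≤ a)
    (hθ : 0 ≤ θ) (hL : 0 ≤ L) (hc : 2 ≤ c) (hcm : c ≤ m) (hm : (a : ℝ) ^ 2 * θ * exp (L * m) ≤ 1) :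
    (n.choose c : ℝ) * (n'.descFactorial c * θ ^ c * exp L ^ c.choose 2)
      ≤ (a : ℝ) ^ 4 * θ ^ 2 * exp L := by
  have h1 : (n.choose c : ℝ) ≤ (a : ℝ) ^ c := by
    calc (n.choose c : ℝ) ≤ (n : ℝ) ^ c := by exact_mod_cast Nat.choose_le_pow n c
      _ ≤ (a : ℝ) ^ c := by gcongr
  have h2 : (n'.descFactorial c : ℝ) ≤ (a : ℝ) ^ c := by
    calc (n'.descFactorial c : ℝ) ≤ (n' : ℝ) ^ c := by exact_mod_cast Nat.descFactorial_le_pow n' c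
      _ ≤ (a : ℝ) ^ c := by gcongr
  have h3 : ∀ c, 2 ≤ c → c ≤ m →
      ((a : ℝ) ^ 2 * θ) ^ c * exp L ^ c.choose 2 ≤ (a : ℝ) ^ 4 * θ ^ 2 * exp L := by
    intro c hc
    induction c, hc using Nat.le_induction with
    | base =>
      intro _
      apply le_of_eq
      simp
      ring
    | succ k hk ih =>
      intro hkm
      refine le_trans ?_ (ih (by omega))
      have hle : (a : ℝ) ^ 2 * θ * exp L ^ k ≤ 1 := by
        refine le_trans ?_ hm
        rw [← exp_nat_mul, mul_comm (k : ℝ) L]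
        gcongr
        omega
      have hch : (k + 1).choose 2 = k + k.choose 2 := by
        rw [Nat.choose_succ_succ' k 1, Nat.choose_one_right]
      calc ((a : ℝ) ^ 2 * θ) ^ (k + 1) * exp L ^ (k + 1).choose 2
          = ((a : ℝ) ^ 2 * θ) ^ k * exp L ^ k.choose 2 * ((a : ℝ) ^ 2 * θ * exp L ^ k) := by
            rw [hch]; ring
        _ ≤ ((a : ℝ) ^ 2 * θ) ^ k * exp L ^ k.choose 2 * 1 := by gcongr
        _ = _ := mul_one _
  calc _ ≤ (a : ℝ) ^ c * ((a : ℝ) ^ c * θ ^ c * exp L ^ c.choose 2) := by gcongr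
    _ = ((a : ℝ) ^ 2 * θ) ^ c * exp L ^ c.choose 2 := by ring
    _ ≤ _ := h3 c hc hcm

lemma descFactorial_mul_pow_mul_pow_le_of_lt {n n' a h c m : ℕ} {θ L : ℝ} (hn : n ≤ a)
    (hn' : n' ≤ a) (ha : a ≤ min n n' + h) (ha1 : 1 ≤ a) (hθ : 0 ≤ θ) (hL : 0 ≤ L)
    (hc : c ≤ min n n') (hmc : m < c) (hm : (a : ℝ) ≤ θ * exp (L * (min n n' + m : ℕ) / 2)) :
    (n.choose c : ℝ) * (n'.descFactorial c * θ ^ c * exp L ^ c.choose 2)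
      ≤ (a : ℝ) ^ (2 * h) *
        ((min n n').factorial * θ ^ min n n' * exp L ^ (min n n').choose 2) := by
  set w := min n n' with hw
  have hwn : w ≤ n := min_le_left _ _
  have hwn' : w ≤ n' := min_le_right _ _
  have ha1' : (1 : ℝ) ≤ a := by exact_mod_cast ha1
  obtain ⟨d, hd⟩ := Nat.exists_eq_add_of_le hc
  have h1 : (n.choose c : ℝ) ≤ (a : ℝ) ^ (d + h) := by
    rw [← Nat.choose_symm (hc.trans hwn)]
    calc (n.choose (n - c) : ℝ) ≤ (n : ℝ) ^ (n - c) := by exact_mod_cast Nat.choose_le_pow n _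
      _ ≤ (a : ℝ) ^ (n - c) := by gcongr
      _ ≤ (a : ℝ) ^ (d + h) := pow_le_pow_right₀ ha1' (by omega)
  have h2 : (n'.descFactorial c : ℝ) ≤ w.factorial * (a : ℝ) ^ h := by
    have hle : n'.descFactorial c ≤ n'.factorial := by
      rw [← Nat.factorial_mul_descFactorial (hc.trans hwn')]
      exact Nat.le_mul_of_pos_left _ (Nat.factorial_pos _)
    have heq := Nat.factorial_mul_descFactorial (n := n') (k := n' - w) (by omega)
    rw [Nat.sub_sub_self hwn'] at heq
    calc (n'.descFactorial c : ℝ) ≤ (n'.factorial : ℝ) := by exact_mod_cast hle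
      _ = w.factorial * (n'.descFactorial (n' - w) : ℝ) := by exact_mod_cast heq.symm
      _ ≤ w.factorial * (n' : ℝ) ^ (n' - w) := by
          gcongr
          exact_mod_cast Nat.descFactorial_le_pow n' _
      _ ≤ w.factorial * (a : ℝ) ^ (n' - w) := by gcongr
      _ ≤ w.factorial * (a : ℝ) ^ h := by
          gcongr
          omega
  have h3 : (a : ℝ) ^ d * (θ ^ c * exp L ^ c.choose 2) ≤ θ ^ w * exp L ^ w.choose 2 := by
    have hle : (a : ℝ) ≤ θ * exp (L * (w + c - 1) / 2) := by
      refine hm.trans ?_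
      gcongr
      have : (m : ℝ) + 1 ≤ c := by exact_mod_cast hmc
      push_cast
      linarith
    have hexp : exp (L * (w + c - 1) / 2) ^ d * exp L ^ c.choose 2 = exp L ^ w.choose 2 := by
      rw [← exp_nat_mul, ← exp_nat_mul, ← exp_nat_mul, ← exp_add, Nat.cast_choose_two,
        Nat.cast_choose_two, hd]
      push_cast
      ring_nf
    calc (a : ℝ) ^ d * (θ ^ c * exp L ^ c.choose 2)
        ≤ (θ * exp (L * (w + c - 1) / 2)) ^ d * (θ ^ c * exp L ^ c.choose 2) := by gcongr
      _ = θ ^ (c + d) * (exp (L * (w + c - 1) / 2) ^ d * exp L ^ c.choose 2) := by ring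
      _ = _ := by rw [hexp, ← hd]
  calc _ ≤ (a : ℝ) ^ (d + h) * (w.factorial * (a : ℝ) ^ h * θ ^ c * exp L ^ c.choose 2) := by gcongr
    _ = (a : ℝ) ^ (2 * h) * (w.factorial * ((a : ℝ) ^ d * (θ ^ c * exp L ^ c.choose 2))) := by ring
    _ ≤ (a : ℝ) ^ (2 * h) * (w.factorial * (θ ^ w * exp L ^ w.choose 2)) := by gcongr
    _ = _ := by ring

/-- The overlap sum is controlled by its extreme terms. -/
lemma overlapSum_le {n n' a h m : ℕ} {θ L : ℝ} (hn : n ≤ a)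
    (hn' : n' ≤ a) (ha : a ≤ min n n' + h) (ha1 : 1 ≤ a) (hθ : 0 ≤ θ) (hL : 0 ≤ L)
    (hm : (a : ℝ) ^ 2 * θ * exp (L * m) ≤ 1)
    (hm' : (a : ℝ) ≤ θ * exp (L * (min n n' + m : ℕ) / 2)) :
    overlapSum n n' θ (exp L) ≤ a * ((a : ℝ) ^ 4 * θ ^ 2 * exp L + (a : ℝ) ^ (2 * h) *
        ((min n n').factorial * θ ^ min n n' * exp L ^ (min n n').choose 2)) := by
  set X := (a : ℝ) ^ 4 * θ ^ 2 * exp L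
  set Y := (a : ℝ) ^ (2 * h) *
        ((min n n').factorial * θ ^ min n n' * exp L ^ (min n n').choose 2)
  have hX : 0 ≤ X := by positivity
  have hY : 0 ≤ Y := by positivity
  calc overlapSum n n' θ (exp L) ≤ ∑ _c ∈ Finset.Icc 2 n, (X + Y) := by
        refine Finset.sum_le_sum fun c hc => ?_
        obtain ⟨hc2, hcn⟩ := Finset.mem_Icc.mp hc
        rcases le_or_gt c n' with hcn' | hcn'
        · rcases le_or_gt c m with hcm | hcm
          · exact (descFactorial_mul_pow_mul_pow_le_of_le hn hn' hθ hL hc2 hcm hm).trans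
              (le_add_of_nonneg_right hY)
          · exact (descFactorial_mul_pow_mul_pow_le_of_lt hn hn' ha ha1 hθ hL
              (le_min hcn hcn') hcm hm').trans (le_add_of_nonneg_left hX)
        · rw [Nat.descFactorial_of_lt hcn']
          simp only [Nat.cast_zero, zero_mul, mul_zero]
          positivity
    _ = ((Finset.Icc 2 n).card : ℝ) * (X + Y) := by rw [Finset.sum_const, nsmul_eq_mul]
    _ ≤ a * (X + Y) := by
        gcongr
        rw [Nat.card_Icc]
        omega

/-- The number of vertices for which the expected number of independent sets of size `a` is about
one. -/
noncomputable def blockScale (L : ℝ) (a : ℕ) : ℝ := a * exp (L * (a - 1) / 2 - 1)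

lemma log_blockScale (L : ℝ) {a : ℕ} (ha : 1 ≤ a) :
    log (blockScale L a) = log a + (L * (a - 1) / 2 - 1) := by
  have : (a : ℝ) ≠ 0 := by exact_mod_cast (by omega : a ≠ 0)
  rw [blockScale, log_mul this (exp_pos _).ne', log_exp]

lemma blockScale_pos (L : ℝ) {a : ℕ} (ha : 1 ≤ a) : 0 < blockScale L a := by
  have : (0 : ℝ) < a := by exact_mod_cast ha
  exact mul_pos this (exp_pos _)

lemma factorial_mul_pow_mul_pow_le {a w : ℕ} {N L lam y μ : ℝ} (hw : 1 ≤ w) (hwa : w ≤ a)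
    (hN : blockScale L a * exp y ≤ N)
    (hμ : μ ≤ y - lam + L * (a - w) / 2) :
    (w.factorial : ℝ) * (exp lam / N) ^ w * exp L ^ w.choose 2 ≤ exp 1 * a * exp (-(w * μ)) := by
  have ha1 : 1 ≤ a := hw.trans hwa
  have hD := blockScale_pos L ha1
  have hN0 : 0 < N := lt_of_lt_of_le (by positivity) hN
  have hw0 : (0 : ℝ) < w := by exact_mod_cast hw
  have ha0 : (0 : ℝ) < a := by exact_mod_cast ha1
  have hlogN : log a + (L * (a - 1) / 2 - 1) + y ≤ log N := by
    rw [← log_blockScale L ha1, ← log_exp y, ← log_mul hD.ne' (exp_pos _).ne']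
    exact log_le_log (by positivity) hN
  have hwlog : log w ≤ log a := log_le_log hw0 (by exact_mod_cast hwa)
  have hfac := log_factorial_le hw
  rw [← log_le_log_iff (by positivity) (by positivity), log_mul (by positivity) (by positivity),
    log_mul (by positivity) (by positivity), log_pow, log_div (by positivity) (by positivity),
    log_exp, log_pow, log_exp, log_mul (by positivity) (by positivity),
    log_mul (by positivity) (by positivity), log_exp, log_exp, Nat.cast_choose_two]
  have h1 : (w : ℝ) * (log a + (L * (a - 1) / 2 - 1) + y) ≤ w * log N := by gcongr
  have h2 : (w : ℝ) * μ ≤ w * (y - lam + L * (a - w) / 2) := by gcongr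
  have h3 : (w : ℝ) * log w ≤ w * log a := by gcongr
  nlinarith [h1, h2, h3, hwlog, hfac]

lemma eventually_mul_pow_le_exp {δ : ℝ} (hδ : 0 < δ) (C : ℝ) (m : ℕ) :
    ∀ᶠ a : ℕ in atTop, C * (a : ℝ) ^ m ≤ exp (δ * a) := by
  have h : Tendsto (fun a : ℕ => C / δ ^ m * ((δ * a) ^ m * exp (-(δ * a)))) atTop
      (nhds (C / δ ^ m * 0)) :=
    ((tendsto_pow_mul_exp_neg_atTop_nhds_zero m).comp
      (tendsto_natCast_atTop_atTop.const_mul_atTop hδ)).const_mul _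
  rw [mul_zero] at h
  filter_upwards [h.eventually_le_const one_pos] with a ha
  have hδm : δ ^ m ≠ 0 := by positivity
  have heq : C / δ ^ m * ((δ * a) ^ m * exp (-(δ * a))) = C * (a : ℝ) ^ m / exp (δ * a) := by
    rw [exp_neg, mul_pow]
    field_simp
  rwa [heq, div_le_one (exp_pos _)] at ha

lemma exp_le_blockScale (L : ℝ) {a : ℕ} (ha : 1 ≤ a) :
    exp (L / 2 * a) ≤ blockScale L a * exp (L / 2 + 1) := by
  rw [blockScale, mul_assoc, ← exp_add]
  have : (1 : ℝ) ≤ a := by exact_mod_cast ha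
  calc exp (L / 2 * a) = 1 * exp (L * (a - 1) / 2 - 1 + (L / 2 + 1)) := by
        rw [one_mul]; congr 1; ring
    _ ≤ _ := by gcongr

lemma blockScale_le_exp {L : ℝ} (hL : 0 ≤ L) (a : ℕ) :
    blockScale L a ≤ a * exp (L / 2 * a) := by
  rw [blockScale]
  gcongr
  linarith

lemma eventually_overlapSum_le {L y y' Λ : ℝ} (hL : 0 < L) (hy : 0 ≤ y) (μ : ℝ) (hμ : 0 ≤ μ)
    (h : ℕ) :
    ∀ᶠ a : ℕ in atTop, ∀ N : ℝ, blockScale L a * exp y ≤ N → N ≤ blockScale L a * exp y' →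
      ∀ n n' : ℕ, n ≤ a → n' ≤ a → a ≤ min n n' + h → ∀ lam : ℝ, 0 ≤ lam → lam ≤ Λ →
        μ ≤ y - lam + L * (a - (min n n' : ℕ)) / 2 →
        overlapSum n n' (exp lam / N) (exp L)
          ≤ (a : ℝ) ^ 5 * exp (2 * Λ + L) / N ^ 2
            + (a : ℝ) ^ (2 * h + 2) * exp (1 + h * μ) * exp (-(μ * a)) := by
  filter_upwards [eventually_ge_atTop (h + 1),
    eventually_mul_pow_le_exp (by positivity : 0 < L / 6) (exp (Λ + L / 2 + 1)) 2,
    eventually_mul_pow_le_exp (by positivity : 0 < L / 6) (exp (y' + L * (h + 1) / 2)) 2]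
    with a ha h1 h2 N hN hN' n n' hn hn' hnn lam hlam hlam' hμle
  have ha1 : 1 ≤ a := by omega
  have ha0 : (0 : ℝ) < a := by exact_mod_cast ha1
  have hD := blockScale_pos L ha1
  have hDN : blockScale L a ≤ N := by
    refine le_trans ?_ hN
    exact le_mul_of_one_le_right hD.le (one_le_exp hy)
  have hN0 : 0 < N := hD.trans_le hDN
  set w := min n n' with hw
  have hwa : w ≤ a := (min_le_left _ _).trans hn
  have hm3 : ((a / 3 : ℕ) : ℝ) ≤ a / 3 := Nat.cast_div_le
  have hm3' : (a : ℝ) / 3 - 1 ≤ ((a / 3 : ℕ) : ℝ) := by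
    have : a ≤ 3 * (a / 3) + 3 := by omega
    have : (a : ℝ) ≤ 3 * ((a / 3 : ℕ) : ℝ) + 3 := by exact_mod_cast this
    linarith
  have hwh : (a : ℝ) ≤ w + h := by exact_mod_cast hnn
  have key := overlapSum_le (θ := exp lam / N) (L := L) (m := a / 3) hn hn' hnn ha1 (by positivity)
    hL.le ?_ ?_
  · refine key.trans ?_
    rw [mul_add]
    refine add_le_add ?_ ?_
    · calc (a : ℝ) * ((a : ℝ) ^ 4 * (exp lam / N) ^ 2 * exp L)
          = (a : ℝ) ^ 5 * (exp lam ^ 2 * exp L) / N ^ 2 := by field_simp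
        _ ≤ (a : ℝ) ^ 5 * exp (2 * Λ + L) / N ^ 2 := by
            gcongr
            rw [← exp_nat_mul, ← exp_add]
            gcongr
            push_cast
            linarith
    · have hfac := factorial_mul_pow_mul_pow_le (w := w) (by omega) hwa hN hμle
      have hexp : exp (-(w * μ)) ≤ exp (h * μ) * exp (-(μ * a)) := by
        rw [← exp_add]
        gcongr
        nlinarith
      calc (a : ℝ) * ((a : ℝ) ^ (2 * h) * (w.factorial * (exp lam / N) ^ w * exp L ^ w.choose 2))
          ≤ (a : ℝ) * ((a : ℝ) ^ (2 * h) * (exp 1 * a * (exp (h * μ) * exp (-(μ * a))))) := by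
            refine mul_le_mul_of_nonneg_left (mul_le_mul_of_nonneg_left ?_ (by positivity))
              ha0.le
            exact hfac.trans (mul_le_mul_of_nonneg_left hexp (by positivity))
        _ = _ := by rw [exp_add]; ring
  · have h3 : exp (L / 2 * a) ≤ N * exp (L / 2 + 1) :=
      (exp_le_blockScale L ha1).trans (by gcongr)
    have h4 : exp (L / 2 * a) = exp (L / 6 * a) * exp (L / 3 * a) := by
      rw [← exp_add]; congr 1; ring
    rw [mul_div_assoc', div_mul_eq_mul_div, div_le_one hN0]
    have h5 : (a : ℝ) ^ 2 * exp lam * exp (L * ((a / 3 : ℕ) : ℝ))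
        ≤ (a : ℝ) ^ 2 * exp Λ * exp (L / 3 * a) := by
      refine mul_le_mul (by gcongr) (exp_le_exp.mpr ?_) (exp_pos _).le (by positivity)
      calc L * ((a / 3 : ℕ) : ℝ) ≤ L * (a / 3) := by gcongr
        _ = L / 3 * a := by ring
    have h6 : (a : ℝ) ^ 2 * exp Λ * exp (L / 3 * a) * exp (L / 2 + 1) ≤ N * exp (L / 2 + 1) := by
      refine le_trans ?_ h3
      rw [h4]
      calc _ = exp (Λ + L / 2 + 1) * (a : ℝ) ^ 2 * exp (L / 3 * a) := by
            rw [add_assoc, exp_add Λ]; ring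
        _ ≤ _ := by gcongr
    exact h5.trans (le_of_mul_le_mul_right h6 (exp_pos _))
  · rw [div_mul_eq_mul_div, le_div_iff₀ hN0]
    calc (a : ℝ) * N ≤ a * (a * exp (L / 2 * a) * exp y') := by
          gcongr
          exact hN'.trans (by gcongr; exact blockScale_le_exp hL.le a)
      _ = exp (y' + L * (h + 1) / 2) * (a : ℝ) ^ 2 * exp (L / 2 * a - L * (h + 1) / 2) := by
          rw [exp_sub, exp_add]
          field_simp
      _ ≤ exp (L / 6 * a) * exp (L / 2 * a - L * (h + 1) / 2) := by gcongr
      _ = 1 * exp (L / 6 * a + (L / 2 * a - L * (h + 1) / 2)) := by rw [exp_add, one_mul]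
      _ ≤ exp lam * exp (L * (w + a / 3 : ℕ) / 2) := by
          gcongr
          · exact one_le_exp hlam
          · push_cast
            nlinarith

lemma eventually_mul_overlap_le_one {L ρ y : ℝ} (hL : 0 < L) (hρL : 2 * ρ < L / 2)
    (hρy : 2 * ρ < y) (hy : 0 ≤ y) :
    ∀ᶠ a : ℕ in atTop, ∀ N r : ℝ, 0 ≤ r → r ≤ exp (ρ * a) → blockScale L a * exp y ≤ N →
      2 * (r * a) ^ 2 ≤ N ∧
      r * (r * ((a : ℝ) ^ 5 * exp L / N ^ 2 + (a : ℝ) ^ 2 * exp 1 * exp (-(y * a)))) ≤ 1 := by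
  filter_upwards [eventually_ge_atTop 1,
    eventually_mul_pow_le_exp (by linarith : 0 < L / 2 - 2 * ρ) (2 * exp (L / 2 + 1)) 2,
    eventually_mul_pow_le_exp (by linarith : 0 < L - 2 * ρ) (2 * exp L * exp (L / 2 + 1) ^ 2) 5,
    eventually_mul_pow_le_exp (by linarith : 0 < y - 2 * ρ) (2 * exp 1) 2]
    with a ha h1 h2 h3 N r hr0 hr hN
  have hD := blockScale_pos L ha
  have hDN : blockScale L a ≤ N := by
    refine le_trans ?_ hN
    exact le_mul_of_one_le_right hD.le (one_le_exp hy)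
  have hN0 : 0 < N := hD.trans_le hDN
  have hBN : exp (L / 2 * a) ≤ N * exp (L / 2 + 1) :=
      (exp_le_blockScale L ha).trans (by gcongr)
  have hr2 : r ^ 2 ≤ exp (2 * ρ * a) := by
    calc r ^ 2 ≤ exp (ρ * a) ^ 2 := by gcongr
      _ = _ := by rw [← exp_nat_mul]; congr 1; push_cast; ring
  constructor
  · have : 2 * (r * a) ^ 2 * exp (L / 2 + 1) ≤ N * exp (L / 2 + 1) := by
      refine le_trans ?_ hBN
      calc 2 * (r * a) ^ 2 * exp (L / 2 + 1)
          = r ^ 2 * (2 * exp (L / 2 + 1) * (a : ℝ) ^ 2) := by ring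
        _ ≤ exp (2 * ρ * a) * exp ((L / 2 - 2 * ρ) * a) := by gcongr
        _ = _ := by rw [← exp_add]; congr 1; ring
    exact le_of_mul_le_mul_right this (exp_pos _)
  have e1 : r ^ 2 * ((a : ℝ) ^ 5 * exp L / N ^ 2) ≤ 1 / 2 := by
    have hN2' : exp (L * a) ≤ N ^ 2 * exp (L / 2 + 1) ^ 2 := by
      calc exp (L * a) = exp (L / 2 * a) ^ 2 := by rw [← exp_nat_mul]; congr 1; push_cast; ring
        _ ≤ (N * exp (L / 2 + 1)) ^ 2 := by gcongr
        _ = _ := by ring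
    rw [mul_div_assoc', div_le_iff₀ (by positivity)]
    have : (2 * (r ^ 2 * ((a : ℝ) ^ 5 * exp L))) * exp (L / 2 + 1) ^ 2
        ≤ N ^ 2 * exp (L / 2 + 1) ^ 2 := by
      refine le_trans ?_ hN2'
      calc _ = r ^ 2 * (2 * exp L * exp (L / 2 + 1) ^ 2 * (a : ℝ) ^ 5) := by ring
        _ ≤ exp (2 * ρ * a) * exp ((L - 2 * ρ) * a) := by gcongr
        _ = _ := by rw [← exp_add]; congr 1; ring
    have := le_of_mul_le_mul_right this (by positivity)
    linarith
  have e2 : r ^ 2 * ((a : ℝ) ^ 2 * exp 1 * exp (-(y * a))) ≤ 1 / 2 := by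
    rw [exp_neg]
    have : 2 * (r ^ 2 * ((a : ℝ) ^ 2 * exp 1)) ≤ exp (y * a) := by
      calc _ = r ^ 2 * (2 * exp 1 * (a : ℝ) ^ 2) := by ring
        _ ≤ exp (2 * ρ * a) * exp ((y - 2 * ρ) * a) := by gcongr
        _ = _ := by rw [← exp_add]; congr 1; ring
    rw [← mul_assoc, ← div_eq_mul_inv, div_le_iff₀ (exp_pos _)]
    linarith
  linarith

lemma neg_log_one_sub_pos {p : ℝ} (hp0 : 0 < p) (hp1 : p < 1) : 0 < -log (1 - p) := by
  have := log_neg (by linarith : 0 < 1 - p) (by linarith)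
  linarith

lemma exp_neg_log_one_sub {p : ℝ} (hp1 : p < 1) : exp (-log (1 - p)) = (1 - p)⁻¹ := by
  rw [exp_neg, exp_log (by linarith)]

lemma eventually_planting {p ρ y y' : ℝ} (hp0 : 0 < p) (hp1 : p < 1) (hy : 0 ≤ y)
    (hρL : 2 * ρ < -log (1 - p) / 2) (hρy : 2 * ρ < y) :
    ∀ᶠ a : ℕ in atTop, ∀ n r : ℕ, (r : ℝ) ≤ exp (ρ * a) →
      blockScale (-log (1 - p)) a * exp y ≤ (n + r * a : ℕ) →
      ((n + r * a : ℕ) : ℝ) ≤ blockScale (-log (1 - p)) a * exp y' →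
      ∀ S T : ℝ, T + r < S →
        gnpProb n p {G | (chrom G : ℝ) ≤ T} ^ 2
          ≤ gnpProb (n + r * a) p {G | (chrom G : ℝ) < S} * (2 * exp 1) := by
  have hL := neg_log_one_sub_pos hp0 hp1
  have hq := exp_neg_log_one_sub hp1
  filter_upwards [eventually_overlapSum_le (y' := y') (Λ := 0) hL hy y hy 0,
    eventually_mul_overlap_le_one hL hρL hρy hy] with a hZ hone n r hr hN hN' S T hST
  obtain ⟨h1, h2⟩ := hone _ r (Nat.cast_nonneg r) hr hN
  have hZ' := hZ _ hN hN' a a le_rfl le_rfl (by simp) 0 le_rfl le_rfl (by simp)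
  rw [exp_zero, hq] at hZ'
  simp only [mul_zero, zero_add, Nat.cast_zero, zero_mul, add_zero] at hZ'
  have h1' : 2 * (r * a) ^ 2 ≤ n + r * a := by exact_mod_cast h1
  refine (gnpProb_chrom_le_sq_le hp0.le hp1 h1' hST hZ').trans ?_
  refine mul_le_mul_of_nonneg_left ?_ (gnpProb_nonneg hp0.le hp1.le _)
  exact mul_le_mul_of_nonneg_left (exp_le_exp.mpr h2) zero_le_two

lemma factorial_sub_le_exp {n M : ℕ} (hM : M ≤ n) (hn : 1 ≤ n) :
    ((n - M).factorial : ℝ) ≤ exp 1 * n * n.factorial * (exp ((M : ℝ) ^ 2 / n) / (n : ℝ) ^ M) := by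
  have hn0 : (0 : ℝ) < n := by exact_mod_cast hn
  have hlogn : 0 ≤ log n := log_nonneg (by exact_mod_cast hn)
  have hfac := le_log_factorial n
  rw [← log_le_log_iff (by positivity) (by positivity), log_mul (by positivity) (by positivity),
    log_mul (by positivity) (by positivity), log_mul (by positivity) (by positivity), log_exp,
    log_div (by positivity) (by positivity), log_exp, log_pow]
  rcases hM.eq_or_lt with rfl | hlt
  · rw [Nat.sub_self, Nat.factorial_zero, Nat.cast_one, log_one, sq, mul_div_assoc,
      div_self hn0.ne']
    linarith
  · have hcast : ((n - M : ℕ) : ℝ) = n - M := by rw [Nat.cast_sub hM]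
    have hpos : (0 : ℝ) < n - M := by rw [← hcast]; exact_mod_cast Nat.sub_pos_of_lt hlt
    have h1 := log_factorial_le (n := n - M) (by omega)
    rw [hcast] at h1
    have h2 : log ((n : ℝ) - M) ≤ log n - M / n := by
      have h := log_le_sub_one_of_pos (div_pos hpos hn0)
      rw [log_div hpos.ne' hn0.ne', sub_div, div_self hn0.ne'] at h
      linarith
    have h3 : ((n : ℝ) - M) * log (n - M) ≤ (n - M) * (log n - M / n) := by gcongr
    have h4 : ((n : ℝ) - M) * (log n - M / n) = n * log n - M * log n - M + (M : ℝ) ^ 2 / n := by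
      field_simp
      ring
    have h5 : (0 : ℝ) ≤ M / n := by positivity
    linarith

lemma sq_add_le_of_le {f l₁ l₂ x y : ℝ} (hf0 : 0 ≤ f) (hf1 : f ≤ 1) (h₁ : f ≤ l₁) (h₂ : 1 - f ≤ l₂)
    (h : 1 ≤ f * l₁ + (1 - f) * l₂) (hx0 : 0 ≤ x) (hxf : x ≤ f) (hy0 : 0 ≤ y) (hyf : y ≤ 1 - f) :
    (x + y) ^ 2 ≤ l₁ * x + l₂ * y := by
  have hA : 0 ≤ l₁ - f := by linarith
  have hB : 0 ≤ l₂ - (1 - f) := by linarith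
  have hx2 : x ^ 2 ≤ f * x := by nlinarith
  have hy2 : y ^ 2 ≤ (1 - f) * y := by nlinarith
  suffices 2 * x * y ≤ (l₁ - f) * x + (l₂ - (1 - f)) * y by nlinarith
  rcases hf0.eq_or_lt with rfl | hf0
  · obtain rfl : x = 0 := le_antisymm hxf hx0
    nlinarith
  rcases hf1.eq_or_lt with rfl | hf1
  · obtain rfl : y = 0 := by linarith
    nlinarith
  have hff : 0 < f * (1 - f) := mul_pos hf0 (by linarith)
  refine le_of_mul_le_mul_right ?_ hff
  have e1 : (l₁ - f) * x * f * y ≤ (l₁ - f) * x * f * (1 - f) := by gcongr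
  have e2 : (l₂ - (1 - f)) * y * (1 - f) * x ≤ (l₂ - (1 - f)) * y * (1 - f) * f := by
    have : 0 ≤ 1 - f := by linarith
    gcongr
  have e3 : x * y * (2 * (f * (1 - f))) ≤ x * y * ((l₁ - f) * f + (l₂ - (1 - f)) * (1 - f)) := by
    gcongr
    nlinarith
  nlinarith

lemma one_le_gnpProb_chrom_le_mul_exp {n s : ℕ} {p f l₁ l₂ Z : ℝ} (hp0 : 0 ≤ p) (hp1 : p < 1)
    (hn : 1 ≤ n) (hs : 2 ≤ s) (hf0 : 0 ≤ f) (hf1 : f ≤ 1) (hl₁ : f ≤ l₁) (hl₂ : 1 - f ≤ l₂)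
    (hl : 1 ≤ f * l₁ + (1 - f) * l₂) (hZ : 0 ≤ Z)
    (h₁ : ∀ d, s - 1 ≤ d → d ≤ s → overlapSum s d (exp l₁ / n) (1 - p)⁻¹ ≤ Z)
    (h₂ : ∀ d, s - 1 ≤ d → d ≤ s → overlapSum (s - 1) d (exp l₂ / n) (1 - p)⁻¹ ≤ Z) :
    1 ≤ gnpProb n p {G | (chrom G : ℝ) ≤ f * n / s + (1 - f) * n / (s - 1) + 2 * s}
      * (exp 1 * n * exp (n * (n * Z))) := by
  have hn0 : (0 : ℝ) < n := by exact_mod_cast hn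
  have hs0 : (0 : ℝ) < s := by exact_mod_cast (by omega : 0 < s)
  have hs1 : (0 : ℝ) < ((s - 1 : ℕ) : ℝ) := by exact_mod_cast (by omega : 0 < s - 1)
  have hscast : ((s - 1 : ℕ) : ℝ) = (s : ℝ) - 1 := by rw [Nat.cast_sub (by omega), Nat.cast_one]
  have hf1' : 0 ≤ 1 - f := by linarith
  set k₁ := ⌊f * n / s⌋₊ with hk₁
  set k₂ := ⌊(1 - f) * n / ((s - 1 : ℕ) : ℝ)⌋₊ with hk₂
  have hk₁le : (k₁ : ℝ) ≤ f * n / s := Nat.floor_le (by positivity)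
  have hk₂le : (k₂ : ℝ) ≤ (1 - f) * n / ((s - 1 : ℕ) : ℝ) := Nat.floor_le (by positivity)
  have hk₁lt := Nat.lt_floor_add_one (f * n / s)
  have hk₂lt := Nat.lt_floor_add_one ((1 - f) * n / ((s - 1 : ℕ) : ℝ))
  rw [← hk₁] at hk₁lt
  rw [← hk₂] at hk₂lt
  rw [le_div_iff₀ hs0] at hk₁le
  rw [le_div_iff₀ hs1] at hk₂le
  rw [div_lt_iff₀ hs0] at hk₁lt
  rw [div_lt_iff₀ hs1] at hk₂lt
  set d : Fin k₁ ⊕ Fin k₂ → ℕ := Sum.elim (fun _ => s) (fun _ => s - 1) with hd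
  set lam : Fin k₁ ⊕ Fin k₂ → ℝ := Sum.elim (fun _ => l₁) (fun _ => l₂) with hlam
  have hdsum : ∑ j, d j = k₁ * s + k₂ * (s - 1) := by
    simp [hd]
  have hdsumR : ∑ j, (d j : ℝ) = k₁ * s + k₂ * ((s - 1 : ℕ) : ℝ) := by
    rw [← Nat.cast_sum, hdsum]
    push_cast
    ring
  have hdn : ∑ j, d j ≤ n := by
    have : ((∑ j, d j : ℕ) : ℝ) ≤ n := by
      rw [Nat.cast_sum, hdsumR]
      linarith
    exact_mod_cast this
  have hcard : Fintype.card (Fin k₁ ⊕ Fin k₂) = k₁ + k₂ := by simp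
  have hJn : Fintype.card (Fin k₁ ⊕ Fin k₂) ≤ n := by
    rw [hcard]
    refine le_trans ?_ hdn
    rw [hdsum]
    exact add_le_add (Nat.le_mul_of_pos_right _ (by omega)) (Nat.le_mul_of_pos_right _ (by omega))
  have key := one_le_gnpProb_chrom_le_mul (n := n) hp0 hp1 d hdn (C := exp 1 * n)
    (θ := fun i => exp (lam i) / n) (Z := Z)
    (x := f * n / s + (1 - f) * n / (s - 1) + 2 * s) (by positivity) (fun i => by positivity)
    ?_ ?_ ?_
  · refine key.trans ?_
    have hP := gnpProb_nonneg hp0 hp1.le (n := n)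
      {G | (chrom G : ℝ) ≤ f * n / s + (1 - f) * n / (s - 1) + 2 * s}
    gcongr
  · intro m hm
    set M₁ := ∑ i, m (Sum.inl i) with hM₁
    set M₂ := ∑ i, m (Sum.inr i) with hM₂
    have hM : ∑ i, m i = M₁ + M₂ := Fintype.sum_sum_type _
    have hM₁le : M₁ ≤ k₁ * s := by
      calc M₁ ≤ ∑ _i : Fin k₁, s := Finset.sum_le_sum fun i _ => hm (Sum.inl i)
        _ = _ := by simp
    have hM₂le : M₂ ≤ k₂ * (s - 1) := by
      calc M₂ ≤ ∑ _i : Fin k₂, (s - 1) := Finset.sum_le_sum fun i _ => hm (Sum.inr i)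
        _ = _ := by simp
    have hM₁le' : (M₁ : ℝ) ≤ k₁ * s := by exact_mod_cast hM₁le
    have hM₂le' : (M₂ : ℝ) ≤ k₂ * ((s - 1 : ℕ) : ℝ) := by exact_mod_cast hM₂le
    have hMn : M₁ + M₂ ≤ n := by
      rw [← hM]
      exact (Finset.sum_le_sum fun i _ => hm i).trans hdn
    have hprod : ∏ i, (exp (lam i) / n) ^ m i = exp (l₁ * M₁ + l₂ * M₂) / (n : ℝ) ^ (M₁ + M₂) := by
      rw [Fintype.prod_sum_type]
      simp only [hlam, Sum.elim_inl, Sum.elim_inr]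
      rw [Finset.prod_pow_eq_pow_sum, Finset.prod_pow_eq_pow_sum, ← hM₁, ← hM₂, div_pow, div_pow,
        ← exp_nat_mul, ← exp_nat_mul, exp_add, pow_add, mul_comm l₁, mul_comm l₂]
      field_simp
    rw [hprod, hM]
    refine (factorial_sub_le_exp hMn hn).trans ?_
    gcongr
    have hq := sq_add_le_of_le (x := M₁ / n) (y := M₂ / n) hf0 hf1 hl₁ hl₂ hl (by positivity)
      (by rw [div_le_iff₀ hn0]; linarith) (by positivity) (by rw [div_le_iff₀ hn0]; linarith)
    calc ((M₁ + M₂ : ℕ) : ℝ) ^ 2 / n = n * (M₁ / n + M₂ / n : ℝ) ^ 2 := by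
          push_cast
          field_simp
      _ ≤ n * (l₁ * (M₁ / n) + l₂ * (M₂ / n)) := by gcongr
      _ = _ := by field_simp
  · rintro (i | i) (j | j)
    · exact h₁ s (by omega) le_rfl
    · exact h₁ (s - 1) le_rfl (by omega)
    · exact h₂ s (by omega) le_rfl
    · exact h₂ (s - 1) le_rfl (by omega)
  · rw [hcard, hdsumR, ← hscast]
    have e1 : (k₁ : ℝ) ≤ f * n / s := by rwa [le_div_iff₀ hs0]
    have e2 : (k₂ : ℝ) ≤ (1 - f) * n / ((s - 1 : ℕ) : ℝ) := by rwa [le_div_iff₀ hs1]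
    push_cast at *
    linarith

lemma gnpProb_le_chrom_le_half_of_le {n : ℕ} {p x z t E : ℝ} (hp0 : 0 ≤ p) (hp1 : p ≤ 1)
    (ht : 0 ≤ t) (hE : 1 ≤ gnpProb n p {G | (chrom G : ℝ) ≤ x} * exp E)
    (h : E + (t ^ 2 / 2 * n - t * (z - x)) ≤ -1) :
    gnpProb n p {G | z ≤ (chrom G : ℝ)} ≤ 1 / 2 := by
  have hconc := gnpProb_chrom_le_mul_gnpProb_le_chrom (n := n) hp0 hp1 ht x z
  set P := gnpProb n p {G | (chrom G : ℝ) ≤ x}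
  set Q := gnpProb n p {G | z ≤ (chrom G : ℝ)}
  have hQ : 0 ≤ Q := gnpProb_nonneg hp0 hp1 _
  calc Q = Q * 1 := (mul_one _).symm
    _ ≤ Q * (P * exp E) := by gcongr
    _ = P * Q * exp E := by ring
    _ ≤ exp (t ^ 2 / 2 * n - t * (z - x)) * exp E := by gcongr
    _ ≤ exp (-1) := by
        rw [← exp_add, exp_le_exp]
        linarith
    _ ≤ 1 / 2 := by
        rw [exp_neg, one_div]
        have := add_one_le_exp (1 : ℝ)
        exact inv_anti₀ two_pos (by linarith)

lemma eventually_gnpProb_le_chrom_le_half {p y y' f l₁ l₂ μ : ℝ} (hp0 : 0 < p) (hp1 : p < 1)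
    (hy : 0 ≤ y) (hf0 : 0 ≤ f) (hf1 : f ≤ 1) (hl₁ : f ≤ l₁) (hl₂ : 1 - f ≤ l₂)
    (hl : 1 ≤ f * l₁ + (1 - f) * l₂) (j : ℕ) (hμ : -log (1 - p) / 2 < μ)
    (h₁ : μ ≤ y - l₁ + -log (1 - p) * j / 2) (h₂ : μ ≤ y - l₂ + -log (1 - p) * (j + 1) / 2) :
    ∃ δ : ℝ, 0 < δ ∧ ∀ᶠ a : ℕ in atTop, ∀ n : ℕ,
      blockScale (-log (1 - p)) a * exp y ≤ n → n ≤ blockScale (-log (1 - p)) a * exp y' →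
      gnpProb n p {G | f * n / (a - j) + (1 - f) * n / (a - j - 1)
        + exp ((-log (1 - p) / 2 - δ) * a) ≤ (chrom G : ℝ)} ≤ 1 / 2 := by
  have hL := neg_log_one_sub_pos hp0 hp1
  have hq := exp_neg_log_one_sub hp1
  set L := -log (1 - p)
  set δ := min ((μ - L / 2) / 4) (L / 8) with hδ
  have hδ0 : 0 < δ := lt_min (by linarith) (by linarith)
  have hδμ : 4 * δ ≤ μ - L / 2 := by
    have := min_le_left ((μ - L / 2) / 4) (L / 8)
    rw [← hδ] at this
    linarith
  have hδL : δ ≤ L / 8 := min_le_right _ _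
  have hμ0 : 0 ≤ μ := by linarith
  set Λ := max l₁ l₂
  refine ⟨δ, hδ0, ?_⟩
  filter_upwards [eventually_ge_atTop (j + 2),
    eventually_overlapSum_le (y' := y') (Λ := Λ) hL hy μ hμ0 (j + 1),
    eventually_mul_pow_le_exp (by linarith : 0 < L / 2 - 3 * δ) (2 * exp (2 * Λ + L)) 5,
    eventually_mul_pow_le_exp hδ0 (2 * exp (1 + (j + 1 : ℕ) * μ) * exp y' ^ 2) (2 * (j + 1) + 4),
    eventually_mul_pow_le_exp (by linarith : 0 < L / 2 - 3 * δ) (1 + L / 2 + |y'|) 1,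
    eventually_mul_pow_le_exp (by linarith : 0 < δ / 2) (6 + exp y') 1,
    eventually_mul_pow_le_exp (by linarith : 0 < L / 2 - δ) 4 1]
    with a ha hov A1 A2 A3 A4 A5 n hn hn'
  rw [pow_one] at A3 A4 A5
  have ha1 : 1 ≤ a := by omega
  have ha1' : (1 : ℝ) ≤ a := by exact_mod_cast ha1
  have hD := blockScale_pos L ha1
  have hn0 : (0 : ℝ) < n := lt_of_lt_of_le (by positivity) hn
  have hn1 : 1 ≤ n := by exact_mod_cast hn0
  have hnle : (n : ℝ) ≤ a * exp (L / 2 * a) * exp y' :=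
    hn'.trans (by gcongr; exact blockScale_le_exp hL.le a)
  set E := exp ((L / 2 - 3 * δ) * a) with hE
  have hE1 : 1 ≤ E := one_le_exp (mul_nonneg (by linarith) (by linarith))
  set Z := (a : ℝ) ^ 5 * exp (2 * Λ + L) / (n : ℝ) ^ 2
            + (a : ℝ) ^ (2 * (j + 1) + 2) * exp (1 + (j + 1 : ℕ) * μ) * exp (-(μ * a)) with hZdef
  have hZ0 : 0 ≤ Z := by positivity
  have hs : ((a - j : ℕ) : ℝ) = a - j := by rw [Nat.cast_sub (by omega)]
  have hZE : n * (n * Z) ≤ E := by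
    have e1 : (n : ℝ) ^ 2 * ((a : ℝ) ^ 5 * exp (2 * Λ + L) / (n : ℝ) ^ 2) ≤ E / 2 := by
      rw [mul_div_cancel₀ _ (by positivity)]
      linarith
    have e2 : (n : ℝ) ^ 2 * ((a : ℝ) ^ (2 * (j + 1) + 2) * exp (1 + (j + 1 : ℕ) * μ)
        * exp (-(μ * a))) ≤ E / 2 := by
      calc (n : ℝ) ^ 2 * ((a : ℝ) ^ (2 * (j + 1) + 2) * exp (1 + (j + 1 : ℕ) * μ)
              * exp (-(μ * a)))
          ≤ (a * exp (L / 2 * a) * exp y') ^ 2 * ((a : ℝ) ^ (2 * (j + 1) + 2)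
              * exp (1 + (j + 1 : ℕ) * μ) * exp (-(μ * a))) := by gcongr
        _ = (2 * exp (1 + (j + 1 : ℕ) * μ) * exp y' ^ 2 * (a : ℝ) ^ (2 * (j + 1) + 4))
              * (exp (L / 2 * a) ^ 2 * exp (-(μ * a))) / 2 := by ring
        _ ≤ exp (δ * a) * (exp (L / 2 * a) ^ 2 * exp (-(μ * a))) / 2 := by gcongr
        _ ≤ E / 2 := by
            rw [← exp_nat_mul, ← exp_add, ← exp_add, hE]
            gcongr
            push_cast
            have := mul_le_mul_of_nonneg_right hδμ (by linarith : (0 : ℝ) ≤ a)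
            linarith
    rw [← mul_assoc, ← sq, hZdef, mul_add]
    linarith
  have hnE : exp 1 * n ≤ exp E := by
    rw [← log_le_log_iff (by positivity) (exp_pos _), log_mul (by positivity) hn0.ne', log_exp,
      log_exp]
    have h := log_le_log hn0 hn'
    rw [log_mul hD.ne' (exp_pos _).ne', log_blockScale L ha1, log_exp] at h
    have h' := log_le_sub_one_of_pos (by linarith : (0 : ℝ) < a)
    have h'' : |y'| ≤ |y'| * a := le_mul_of_one_le_right (abs_nonneg _) ha1'
    linarith [le_abs_self y']
  have key := one_le_gnpProb_chrom_le_mul_exp (n := n) (s := a - j) (Z := Z) hp0.le hp1 hn1 (by omega)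
    hf0 hf1 hl₁ hl₂ hl hZ0 ?_ ?_
  · set x := f * n / (a - j : ℕ) + (1 - f) * n / ((a - j : ℕ) - 1) + 2 * (a - j : ℕ) with hx
    set z := f * n / (a - j) + (1 - f) * n / (a - j - 1) + exp ((L / 2 - δ) * a) with hz
    have hgap : exp ((L / 2 - δ) * a) / 2 ≤ z - x := by
      rw [hz, hx, hs]
      have : (0 : ℝ) ≤ j := Nat.cast_nonneg j
      linarith
    have hkey : 1 ≤ gnpProb n p {G | (chrom G : ℝ) ≤ x} * exp (2 * E) := by
      refine key.trans (mul_le_mul_of_nonneg_left ?_ (gnpProb_nonneg hp0.le hp1.le _))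
      rw [two_mul, exp_add]
      gcongr
    have ht : exp (-(3 / 2 * δ * a)) ^ 2 / 2 * n ≤ exp y' / 2 * a * E := by
      calc exp (-(3 / 2 * δ * a)) ^ 2 / 2 * n
          ≤ exp (-(3 / 2 * δ * a)) ^ 2 / 2 * (a * exp (L / 2 * a) * exp y') := by gcongr
        _ = exp y' / 2 * a * (exp (-(3 / 2 * δ * a)) ^ 2 * exp (L / 2 * a)) := by ring
        _ = _ := by
            rw [← exp_nat_mul, ← exp_add, hE]
            congr 2
            push_cast
            ring
    have htgap : exp (δ / 2 * a) * E / 2 ≤ exp (-(3 / 2 * δ * a)) * (z - x) := by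
      calc exp (δ / 2 * a) * E / 2
          = exp (-(3 / 2 * δ * a)) * (exp ((L / 2 - δ) * a) / 2) := by
            rw [mul_div_assoc', hE, ← exp_add, ← exp_add]
            congr 2
            ring
        _ ≤ _ := by gcongr
    have hA4E : (6 + exp y') * a * E ≤ exp (δ / 2 * a) * E := by gcongr
    have haE : 1 * E ≤ a * E := by gcongr
    have hneg : 2 * E + (exp (-(3 / 2 * δ * a)) ^ 2 / 2 * n - exp (-(3 / 2 * δ * a)) * (z - x))
        ≤ -1 := by
      linarith
    exact gnpProb_le_chrom_le_half_of_le hp0.le hp1.le (exp_pos _).le hkey hneg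
  · intro d hd hd'
    rw [← hq]
    refine hov n hn hn' (a - j) d (by omega) (by omega) (by omega) l₁ (hf0.trans hl₁)
      (le_max_left _ _) (h₁.trans ?_)
    have : ((min (a - j) d : ℕ) : ℝ) ≤ a - j := by
      rw [← hs]
      exact_mod_cast min_le_left _ _
    have := mul_le_mul_of_nonneg_left (by linarith : (j : ℝ) ≤ a - (min (a - j) d : ℕ)) hL.le
    linarith
  · intro d hd hd'
    rw [← hq]
    refine hov n hn hn' (a - j - 1) d (by omega) (by omega) (by omega) l₂
      ((by linarith : 0 ≤ 1 - f).trans hl₂) (le_max_right _ _) (h₂.trans ?_)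
    have : ((min (a - j - 1) d : ℕ) : ℝ) + 1 ≤ a - j := by
      rw [← hs]
      have : min (a - j - 1) d + 1 ≤ a - j := by omega
      exact_mod_cast this
    have := mul_le_mul_of_nonneg_left
      (by linarith : (j : ℝ) + 1 ≤ a - (min (a - j - 1) d : ℕ)) hL.le
    linarith

lemma exp_neg_one_le_half : exp (-1) ≤ 1 / 2 := by
  rw [exp_neg, one_div]
  have := add_one_le_exp (1 : ℝ)
  exact inv_anti₀ two_pos (by linarith)

lemma gnpProb_chrom_le_le_exp {n : ℕ} {p x : ℝ} (hp0 : 0 ≤ p) (hp1 : p < 1) (hx1 : 1 ≤ x)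
    (hxn : x ≤ n) :
    gnpProb n p {G | (chrom G : ℝ) ≤ x}
      ≤ exp ((n - x + 1) * log x + x + log (1 - p) * ((n : ℝ) ^ 2 / x - n) / 2) := by
  have hx0 : 0 < x := by linarith
  have hn0 : (0 : ℝ) < n := by linarith
  set k := ⌊x⌋₊ with hk
  have hkx : (k : ℝ) ≤ x := Nat.floor_le hx0.le
  have hxk : x < k + 1 := Nat.lt_floor_add_one x
  have hk1 : 1 ≤ k := Nat.one_le_floor_iff x |>.mpr hx1
  have hk0 : (0 : ℝ) < k := by exact_mod_cast hk1
  have hkn : k ≤ n := by exact_mod_cast hkx.trans hxn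
  have hset : {G : SimpleGraph (Fin n) | (chrom G : ℝ) ≤ x} = {G | chrom G ≤ k} := by
    ext G
    exact (Nat.le_floor_iff hx0.le).symm
  have hfac : exp (k * log k - k) ≤ k.factorial := by
    rw [← exp_log (by positivity : (0 : ℝ) < k.factorial)]
    exact exp_le_exp.mpr (le_log_factorial k)
  have hP := gnpProb_nonneg hp0 hp1.le (n := n) {G | chrom G ≤ k}
  have hmain := gnpProb_chrom_le_mul_factorial_le hp0 hp1 hkn hk1
  have hpow : (k : ℝ) ^ n = exp (n * log k) := by rw [exp_nat_mul, exp_log hk0]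
  have hle : gnpProb n p {G | chrom G ≤ k} * exp (k * log k - k)
      ≤ exp (n * log k + log (1 - p) * (((n : ℝ) ^ 2 / k - n) / 2)) := by
    rw [exp_add, ← hpow]
    exact (mul_le_mul_of_nonneg_left hfac hP).trans hmain
  rw [hset]
  refine le_of_mul_le_mul_right (hle.trans ?_) (exp_pos (k * log k - k))
  rw [← exp_add, exp_le_exp]
  have hlogk : 0 ≤ log k := log_nonneg (by exact_mod_cast hk1)
  have hlog : log k ≤ log x := log_le_log hk0 hkx
  have hq : log (1 - p) ≤ 0 := log_nonpos (by linarith) (by linarith)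
  have h1 : ((n : ℝ) - k) * log k ≤ (n - x + 1) * log x := by
    have hnk : (k : ℝ) ≤ n := by exact_mod_cast hkn
    exact mul_le_mul (by linarith) hlog hlogk (by linarith)
  have h2 : (n : ℝ) ^ 2 / x ≤ (n : ℝ) ^ 2 / k := by gcongr
  have h3 := mul_le_mul_of_nonpos_left h2 hq
  linarith

lemma eventually_gnpProb_chrom_le_le_half {p y v : ℝ} (hp0 : 0 < p) (hp1 : p < 1)
    (hv : 0 ≤ v) (hyv : y + -log (1 - p) * v / 2 < 1 + -log (1 - p) / 2) :
    ∀ᶠ a : ℕ in atTop, ∀ n : ℕ, blockScale (-log (1 - p)) a ≤ n →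
      n ≤ blockScale (-log (1 - p)) a * exp y →
      gnpProb n p {G | (chrom G : ℝ) ≤ n / (a - v)} ≤ 1 / 2 := by
  have hL := neg_log_one_sub_pos hp0 hp1
  obtain ⟨L, hLdef⟩ : ∃ L, L = -log (1 - p) := ⟨_, rfl⟩
  have hlogp : log (1 - p) = -L := by linarith
  simp only [hlogp, neg_neg] at hyv hL ⊢
  set γ := 1 + L / 2 - (y + L * v / 2) with hγ
  have hγ0 : 0 < γ := by linarith
  filter_upwards [(tendsto_natCast_atTop_atTop (R := ℝ)).eventually_ge_atTop (v + 1 + (v + 3) / γ),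
    (tendsto_natCast_atTop_atTop (R := ℝ)).eventually_ge_atTop (1 + 2 / L)] with a ha ha' n hn hn'
  have ha1r : (1 : ℝ) ≤ a := le_trans (by linarith [div_pos two_pos hL]) ha'
  have ha1 : 1 ≤ a := by exact_mod_cast ha1r
  have hvγ : 0 ≤ (v + 3) / γ := by positivity
  have hav : 1 ≤ a - v := by linarith
  have hav0 : 0 < a - v := by linarith
  have hD := blockScale_pos L ha1
  have haD : (a : ℝ) ≤ blockScale L a := by
    rw [blockScale]
    refine le_mul_of_one_le_right (by linarith) (one_le_exp ?_)
    have : L * (2 / L) ≤ L * (a - 1) := mul_le_mul_of_nonneg_left (by linarith) hL.le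
    rw [mul_div_cancel₀ _ hL.ne'] at this
    linarith
  have hn0 : (0 : ℝ) < n := hD.trans_le hn
  obtain ⟨x, hx⟩ : ∃ x, x = (n : ℝ) / (a - v) := ⟨_, rfl⟩
  have hnx : (n : ℝ) = x * (a - v) := by rw [hx]; field_simp
  have hx1 : 1 ≤ x := by
    rw [hx, one_le_div hav0]
    linarith
  have hx0 : 0 < x := by linarith
  have hxn : x ≤ n := by
    rw [hnx]
    exact le_mul_of_one_le_right hx0.le hav
  rw [← hx]
  refine (gnpProb_chrom_le_le_exp hp0.le hp1 hx1 hxn).trans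
    (le_trans (exp_le_exp.mpr ?_) exp_neg_one_le_half)
  have hlogx : log x ≤ L * (a - 1) / 2 - 1 + y + v / (a - v) := by
    have h := log_le_log hn0 hn'
    rw [log_mul hD.ne' (exp_pos _).ne', log_blockScale L ha1, log_exp] at h
    have h2 := log_le_sub_one_of_pos (div_pos (by linarith : (0 : ℝ) < a) hav0)
    rw [log_div (by linarith) hav0.ne'] at h2
    have h3 : (a : ℝ) / (a - v) - 1 = v / (a - v) := by field_simp; ring
    rw [hx, log_div hn0.ne' hav0.ne']
    linarith
  have hlogx0 : 0 ≤ log x := log_nonneg hx1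
  have hlogxx : log x ≤ x := (log_le_sub_one_of_pos hx0).trans (by linarith)
  have hbr : (a - v - 1) * log x ≤ (a - v - 1) * (L * (a - 1) / 2 - 1 + y) + v := by
    have h1 : (a - v - 1) * log x ≤ (a - v - 1) * (L * (a - 1) / 2 - 1 + y + v / (a - v)) :=
      mul_le_mul_of_nonneg_left hlogx (by linarith)
    have h2 : (a - v - 1) * (v / (a - v)) ≤ v := by
      rw [mul_div_assoc', div_le_iff₀ hav0]
      nlinarith
    linarith
  have hγa : v + 3 ≤ (a - v - 1) * γ := by
    rw [← div_le_iff₀ hγ0]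
    linarith
  have hn2 : (n : ℝ) ^ 2 / x - n = x * ((a - v) * (a - v - 1)) := by
    rw [hnx]
    field_simp
  have hsum : (a - v - 1) * log x + 2 - L / 2 * ((a - v) * (a - v - 1)) ≤ -1 := by
    have : (a - v - 1) * (L * (a - 1) / 2 - 1 + y) - L / 2 * ((a - v) * (a - v - 1))
        = -((a - v - 1) * γ) := by
      rw [hγ]; ring
    linarith
  have hfinal := mul_le_mul_of_nonneg_left hsum hx0.le
  rw [hn2, hnx, hlogp]
  linarith

lemma choose_mul_pow_le_exp {n a : ℕ} {p y : ℝ} (hp1 : p < 1) (ha : 1 ≤ a)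
    (hn : n ≤ blockScale (-log (1 - p)) a * exp y) :
    (n.choose a : ℝ) * (1 - p) ^ a.choose 2 ≤ exp (y * a) := by
  have ha0 : (0 : ℝ) < a := by exact_mod_cast ha
  have hD := blockScale_pos (-log (1 - p)) ha
  have hq : 0 < 1 - p := by linarith
  rcases Nat.eq_zero_or_pos n with rfl | hn0
  · rw [Nat.choose_eq_zero_of_lt (by omega), Nat.cast_zero, zero_mul]
    exact (exp_pos _).le
  have hn0 : (0 : ℝ) < n := by exact_mod_cast hn0
  have h := log_le_log hn0 hn
  rw [log_mul hD.ne' (exp_pos _).ne', log_blockScale _ ha, log_exp] at h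
  refine (mul_le_mul_of_nonneg_right (Nat.choose_le_pow_div (α := ℝ) a n) (by positivity)).trans ?_
  rw [← log_le_log_iff (by positivity) (exp_pos _), log_mul (by positivity) (by positivity),
    log_div (by positivity) (by positivity), log_pow, log_pow, log_exp, Nat.cast_choose_two]
  have hfac := le_log_factorial a
  have h' := mul_le_mul_of_nonneg_left h ha0.le
  linarith

lemma eventually_gnpProb_chrom_le_le_half' {p y : ℝ} (hp0 : 0 < p) (hp1 : p < 1)
    (hy : y < -log (1 - p) / 2) :
    ∃ δ : ℝ, 0 < δ ∧ ∀ᶠ a : ℕ in atTop, ∀ n : ℕ,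
      n ≤ blockScale (-log (1 - p)) a * exp y →
      gnpProb n p {G | (chrom G : ℝ) ≤ n / (a - 1) - exp ((-log (1 - p) / 2 - δ) * a)}
        ≤ 1 / 2 := by
  have hL := neg_log_one_sub_pos hp0 hp1
  obtain ⟨L, hLdef⟩ : ∃ L, L = -log (1 - p) := ⟨_, rfl⟩
  have hδ0 : 0 < (L / 2 - y) / 2 := by rw [hLdef]; linarith
  refine ⟨(L / 2 - y) / 2, hδ0, ?_⟩
  rw [← hLdef]
  filter_upwards [eventually_ge_atTop 3, eventually_mul_pow_le_exp hδ0 4 0] with a ha h4 n hn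
  rw [pow_zero, mul_one] at h4
  have ha0 : (3 : ℝ) ≤ a := by exact_mod_cast ha
  refine (gnpProb_chrom_le_le_indepCount (a := a) (T := exp ((L / 2 - (L / 2 - y) / 2) * a)) hp0.le hp1.le
    (by omega) (exp_pos _) ?_).trans ?_
  · have h1 : ((a : ℝ) - 1) * (n / (a - 1)) = n := by
      have : (a : ℝ) - 1 ≠ 0 := (by linarith : (0 : ℝ) < a - 1).ne'
      field_simp
    have h2 := exp_pos ((L / 2 - (L / 2 - y) / 2) * a)
    nlinarith
  · have hinv : exp (-((L / 2 - y) / 2 * a)) ≤ 1 / 4 := by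
      rw [exp_neg, one_div]
      exact inv_anti₀ (by norm_num) h4
    have h1 : (n.choose a : ℝ) * (1 - p) ^ a.choose 2 / exp ((L / 2 - (L / 2 - y) / 2) * a)
        ≤ 1 / 4 := by
      rw [div_le_iff₀ (exp_pos _)]
      refine (choose_mul_pow_le_exp hp1 (by omega) (hLdef ▸ hn)).trans ?_
      calc exp (y * a)
          = exp (-((L / 2 - y) / 2 * a)) * exp ((L / 2 - (L / 2 - y) / 2) * a) := by
            rw [← exp_add]; congr 1; ring
        _ ≤ _ := by gcongr
    have h2 : (n.choose (a + 1) : ℝ) * (1 - p) ^ (a + 1).choose 2 ≤ 1 / 4 := by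
      have hn' : n ≤ blockScale (-log (1 - p)) (a + 1) * exp (y - L / 2) := by
        refine hn.trans ?_
        rw [← hLdef, blockScale, blockScale, mul_assoc, mul_assoc, ← exp_add, ← exp_add]
        push_cast
        exact mul_le_mul (by linarith) (exp_le_exp.mpr (by linarith)) (exp_pos _).le
          (by positivity)
      refine (choose_mul_pow_le_exp hp1 (by omega) hn').trans (le_trans ?_ hinv)
      rw [exp_le_exp]
      push_cast
      nlinarith
    linarith

lemma eventually_mul_pow_mul_exp_le_blockScale {L α : ℝ} (hα : α < L / 2) (C : ℝ) (m : ℕ) :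
    ∀ᶠ a : ℕ in atTop, C * (a : ℝ) ^ m * exp (α * a) ≤ blockScale L a := by
  filter_upwards [eventually_mul_pow_le_exp (sub_pos.mpr hα) (C * exp (L / 2 + 1)) m,
    eventually_ge_atTop 1] with a h ha
  have hD := exp_le_blockScale L ha
  refine le_of_mul_le_mul_right (le_trans ?_ hD) (exp_pos (L / 2 + 1))
  calc C * (a : ℝ) ^ m * exp (α * a) * exp (L / 2 + 1)
      = C * exp (L / 2 + 1) * (a : ℝ) ^ m * exp (α * a) := by ring
    _ ≤ exp ((L / 2 - α) * a) * exp (α * a) := mul_le_mul_of_nonneg_right h (exp_pos _).le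
    _ = exp (L / 2 * a) := by rw [← exp_add]; congr 1; ring

lemma rpow_le_of_le_blockScale_mul_exp {L y c : ℝ} (hL : 0 ≤ L) (hy : 0 ≤ y) (hc0 : 0 ≤ c)
    (hc1 : c ≤ 1) {a : ℕ} (ha : 1 ≤ a) {x : ℝ} (hx0 : 0 ≤ x) (hx : x ≤ blockScale L a * exp y) :
    x ^ c ≤ exp y * a * exp (c * (L / 2) * a) := by
  have ha1 : (1 : ℝ) ≤ a := by exact_mod_cast ha
  have hya : 1 ≤ exp y * a := one_le_mul_of_one_le_of_one_le (one_le_exp hy) ha1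
  have hx' : x ≤ exp y * a * exp (L / 2 * a) := by
    refine hx.trans ?_
    have := mul_le_mul_of_nonneg_right (blockScale_le_exp hL a) (exp_pos y).le
    linarith
  calc x ^ c ≤ (exp y * a * exp (L / 2 * a)) ^ c := rpow_le_rpow hx0 hx' hc0
    _ = (exp y * a) ^ c * exp (L / 2 * a) ^ c := mul_rpow (by positivity) (exp_pos _).le
    _ ≤ exp y * a * exp (c * (L / 2) * a) := by
      rw [← exp_mul]
      refine mul_le_mul ?_ (exp_le_exp.mpr (by linarith)) (exp_pos _).le (by positivity)
      calc (exp y * a) ^ c ≤ (exp y * a) ^ (1 : ℝ) := rpow_le_rpow_of_exponent_le hya hc1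
        _ = exp y * a := rpow_one _

lemma le_add_nat_mul_of_steps {s : ℕ → ℝ} {n d K : ℕ} {e : ℝ}
    (hstep : ∀ k < K, s (n + (k + 1) * d) ≤ s (n + k * d) + e) :
    s (n + K * d) ≤ s n + K * e := by
  induction K with
  | zero => simp
  | succ K ih =>
    have h1 := ih fun k hk => hstep k (hk.trans K.lt_succ_self)
    have h2 := hstep K K.lt_succ_self
    push_cast
    linarith

/-- The elementary growth estimate behind non-concentration: on the window
`[D * exp y₀, D * exp y₁]` with `D = blockScale L a`, a sequence cannot increase on average by less
than about `1 / a` per step while staying below `n / a + w * n / a ^ 2` at the bottom of the window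
and above `n / a + v * n / a ^ 2` at its top. -/
lemma eventually_false_of_window_bounds {L ρ c v w δ y₀ y₁ : ℝ} (hL : 0 < L) (hc0 : 0 ≤ c)
    (hc1 : c ≤ 1) (hcρ : c * (L / 2) < ρ) (hρL : ρ < L / 2) (hδ : 0 < δ) (hv : 0 ≤ v) (hw : 0 ≤ w)
    (hy₀ : 0 ≤ y₀) (hy : y₀ < y₁) (hvw : w * exp y₀ < v * exp y₁) :
    ∀ᶠ a : ℕ in atTop, ∀ s t : ℕ → ℝ, ∀ r : ℕ, r = ⌊exp (ρ * a)⌋₊ →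
      (∀ n : ℕ, blockScale L a * exp y₀ ≤ n → n ≤ blockScale L a * exp y₁ →
        t n - s n ≤ (n : ℝ) ^ c ∧
        s n ≤ n * (1 / a + w / a ^ 2) + exp ((L / 2 - δ) * a) ∧
        n * (1 / a + v / a ^ 2) - exp ((L / 2 - δ) * a) ≤ t n) →
      (∀ n : ℕ, blockScale L a * exp y₀ ≤ n → ((n + r * a : ℕ) : ℝ) ≤ blockScale L a * exp y₁ →
        s (n + r * a) ≤ t n + r) → False := by
  have hcL : c * (L / 2) < L / 2 := hcρ.trans hρL
  have hρ0 : 0 < ρ := lt_of_le_of_lt (by positivity) hcρ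
  have hy₁ : 0 ≤ y₁ := hy₀.trans hy.le
  have hexp : 0 < exp y₁ - exp y₀ := sub_pos.mpr (exp_lt_exp.mpr hy)
  obtain ⟨σ, hσ⟩ : ∃ σ, σ = v * exp y₁ - w * exp y₀ := ⟨_, rfl⟩
  have hσ0 : 0 < σ := by rw [hσ]; linarith
  filter_upwards [eventually_ge_atTop 1,
    eventually_mul_pow_mul_exp_le_blockScale (L := L) (α := 0) (by linarith)
      (1 / (exp y₁ - exp y₀)) 0,
    eventually_mul_pow_mul_exp_le_blockScale hρL (6 * v / σ) 1,
    eventually_mul_pow_mul_exp_le_blockScale (L := L) (α := 0) (by linarith) (6 * w / σ) 0,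
    eventually_mul_pow_mul_exp_le_blockScale (sub_lt_self (L / 2) hδ) (12 / σ) 2,
    eventually_mul_pow_mul_exp_le_blockScale hcL (6 * exp y₁ / σ) 3,
    eventually_mul_pow_le_exp (sub_pos.mpr hcρ) (12 * exp y₁ * exp y₁ / σ) 2,
    eventually_mul_pow_le_exp hρ0 2 0]
    with a ha hgap hvr hw' hB hE hEr hr s t r hrdef hn hstep
  have ha1 : (1 : ℝ) ≤ a := by exact_mod_cast ha
  have ha0 : (0 : ℝ) < a := by linarith
  obtain ⟨E, hEdef⟩ : ∃ E, E = exp y₁ * a * exp (c * (L / 2) * a) := ⟨_, rfl⟩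
  have hE0 : 0 < E := by rw [hEdef]; positivity
  have hlen : ∀ n : ℕ, blockScale L a * exp y₀ ≤ n → n ≤ blockScale L a * exp y₁ →
      t n - s n ≤ E := by
    intro n h1 h2
    rw [hEdef]
    exact (hn n h1 h2).1.trans (rpow_le_of_le_blockScale_mul_exp hL.le hy₁ hc0 hc1 ha
      (Nat.cast_nonneg n) h2)
  have hD0 := blockScale_pos L ha
  generalize blockScale L a = D at hgap hvr hw' hB hE hn hstep hlen hD0
  simp only [pow_zero, mul_one, pow_one, zero_mul, exp_zero] at hgap hvr hw' hr
  have hr1 : (r : ℝ) ≤ exp (ρ * a) := hrdef ▸ Nat.floor_le (exp_pos _).le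
  have hr2 : exp (ρ * a) < r + 1 := hrdef ▸ Nat.lt_floor_add_one _
  have hr0 : 0 < (r : ℝ) := by linarith
  have hra0 : 0 < (r : ℝ) * a := by positivity
  obtain ⟨M, hM⟩ : ∃ M, M = D * exp y₁ := ⟨_, rfl⟩
  rw [← hM] at hn hstep hlen
  obtain ⟨B, hBdef⟩ : ∃ B, B = exp ((L / 2 - δ) * a) := ⟨_, rfl⟩
  rw [← hBdef] at hn hB
  obtain ⟨n₀, hn₀⟩ : ∃ n, n = ⌈D * exp y₀⌉₊ := ⟨_, rfl⟩
  have hn₀le : D * exp y₀ ≤ n₀ := hn₀ ▸ Nat.le_ceil _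
  have hn₀lt : (n₀ : ℝ) < D * exp y₀ + 1 := hn₀ ▸ Nat.ceil_lt_add_one (by positivity)
  have hn₀M : (n₀ : ℝ) ≤ M := by
    rw [div_le_iff₀ hexp] at hgap
    rw [hM]
    linarith
  obtain ⟨K, hK⟩ : ∃ K, K = ⌊(M - n₀) / (r * a)⌋₊ := ⟨_, rfl⟩
  have hK1 : K * (r * a) ≤ M - n₀ := by
    rw [← le_div_iff₀ hra0, hK]
    exact Nat.floor_le (div_nonneg (by linarith) hra0.le)
  have hK2 : M - n₀ < (K + 1) * (r * a) := by
    rw [← div_lt_iff₀ hra0, hK]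
    exact Nat.lt_floor_add_one _
  have hwin : ∀ k ≤ K, D * exp y₀ ≤ (n₀ + k * (r * a) : ℕ) ∧ ((n₀ + k * (r * a) : ℕ) : ℝ) ≤ M := by
    intro k hk
    have hkK : (k : ℝ) * (r * a) ≤ K * (r * a) := by
      have : (k : ℝ) ≤ K := by exact_mod_cast hk
      exact mul_le_mul_of_nonneg_right this hra0.le
    have hk0 : 0 ≤ (k : ℝ) * (r * a) := by positivity
    push_cast
    constructor <;> linarith
  have hiter : s (n₀ + K * (r * a)) ≤ s n₀ + K * (r + E) := by
    refine le_add_nat_mul_of_steps fun k hk => ?_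
    have h1 := hwin k hk.le
    have h2 := hwin (k + 1) hk
    have heq : n₀ + (k + 1) * (r * a) = n₀ + k * (r * a) + r * a := by ring
    rw [heq] at h2 ⊢
    have h3 := hstep _ h1.1 h2.2
    have h4 := hlen _ h1.1 h1.2
    linarith
  obtain ⟨hN1, hN2⟩ := hwin K le_rfl
  obtain ⟨N, hN⟩ : ∃ N, N = n₀ + K * (r * a) := ⟨_, rfl⟩
  rw [← hN] at hiter hN1 hN2
  have hNr : (N : ℝ) = n₀ + K * (r * a) := by rw [hN]; push_cast; ring
  have hlow := (hn N hN1 hN2).2.2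
  have hlenN := hlen N hN1 hN2
  have hup := (hn n₀ hn₀le hn₀M).2.1
  have hmain : N * (1 / a + v / a ^ 2) ≤ n₀ * (1 / a + w / a ^ 2) + 2 * B + K * r + (K + 1) * E := by
    linarith
  have hmain2 : N * v ≤ n₀ * w + 2 * a ^ 2 * B + a ^ 2 * E + a * (K * a) * E := by
    have h := mul_le_mul_of_nonneg_left hmain (by positivity : (0 : ℝ) ≤ a ^ 2)
    have h1 : (a : ℝ) ^ 2 * (N * (1 / a + v / a ^ 2)) = N * a + N * v := by field_simp
    have h2 : (a : ℝ) ^ 2 * (n₀ * (1 / a + w / a ^ 2) + 2 * B + K * r + (K + 1) * E)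
        = n₀ * a + n₀ * w + a ^ 2 * (2 * B + K * r + (K + 1) * E) := by
      field_simp; ring
    rw [h1, h2, hNr] at h
    rw [hNr]
    linarith
  have hKa : a * (K * a) * E ≤ D * σ / 6 := by
    have hKM : K * a * r ≤ M := by
      have : (0 : ℝ) ≤ n₀ := Nat.cast_nonneg _
      linarith
    have hEr' : a * E * exp y₁ ≤ σ / 6 * r := by
      have h1 : exp ((ρ - c * (L / 2)) * a) * exp (c * (L / 2) * a) = exp (ρ * a) := by
        rw [← exp_add]; congr 1; ring
      have h2 := mul_le_mul_of_nonneg_right hEr (exp_pos (c * (L / 2) * a)).le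
      rw [h1, div_mul_eq_mul_div, div_mul_eq_mul_div, div_le_iff₀ hσ0] at h2
      have h3 : exp (ρ * a) * σ ≤ 2 * r * σ := mul_le_mul_of_nonneg_right (by linarith) hσ0.le
      rw [hEdef]
      linarith
    refine le_of_mul_le_mul_right ?_ hr0
    calc a * (K * a) * E * r = a * E * (K * a * r) := by ring
      _ ≤ a * E * M := mul_le_mul_of_nonneg_left hKM (by positivity)
      _ = D * (a * E * exp y₁) := by rw [hM]; ring
      _ ≤ D * (σ / 6 * r) := mul_le_mul_of_nonneg_left hEr' hD0.le
      _ = D * σ / 6 * r := by ring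
  have hvr' : v * (r * a) ≤ D * σ / 6 := by
    rw [div_mul_eq_mul_div, div_mul_eq_mul_div, div_le_iff₀ hσ0] at hvr
    have := mul_le_mul_of_nonneg_left hr1 (by positivity : 0 ≤ v * a)
    linarith
  have hw6 : w ≤ D * σ / 6 := by
    rw [div_le_iff₀ hσ0] at hw'
    linarith
  have hB6 : 2 * a ^ 2 * B ≤ D * σ / 6 := by
    rw [div_mul_eq_mul_div, div_mul_eq_mul_div, div_le_iff₀ hσ0] at hB
    linarith
  have hE6 : a ^ 2 * E ≤ D * σ / 6 := by
    rw [div_mul_eq_mul_div, div_mul_eq_mul_div, div_le_iff₀ hσ0] at hE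
    rw [hEdef]
    linarith
  have hNM : M - r * a ≤ N := by linarith
  have h1 := mul_le_mul_of_nonneg_right hNM hv
  have h2 := mul_le_mul_of_nonneg_right hn₀lt.le hw
  have h3 : D * σ = M * v - D * exp y₀ * w := by rw [hσ, hM]; ring
  have h4 : 0 < D * σ := mul_pos hD0 hσ0
  linarith

lemma eventually_one_div_sub_le (k : ℕ) {θ : ℝ} (hθ : 0 < θ) :
    ∀ᶠ a : ℕ in atTop, 1 / ((a : ℝ) - k) ≤ 1 / a + (k + θ) / a ^ 2 := by
  filter_upwards [(tendsto_natCast_atTop_atTop (R := ℝ)).eventually_ge_atTop (k + 1),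
    (tendsto_natCast_atTop_atTop (R := ℝ)).eventually_ge_atTop (k * (k + θ) / θ)] with a h1 h2
  have hk : (0 : ℝ) ≤ k := Nat.cast_nonneg k
  have ha : (0 : ℝ) < a := by linarith
  have hak : (0 : ℝ) < a - k := by linarith
  rw [div_le_iff₀ hθ] at h2
  have h3 : 1 / (a : ℝ) + (k + θ) / a ^ 2 = (a + (k + θ)) / a ^ 2 := by field_simp
  rw [h3, div_le_div_iff₀ hak (by positivity)]
  linarith

/-- Upper bound for the median of the chromatic number, with the loss expressed through the second
order coefficient `w`. -/
lemma eventually_gnpProb_le_chrom_le_half' {p y y' f l₁ l₂ μ w : ℝ} (hp0 : 0 < p) (hp1 : p < 1)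
    (hy : 0 ≤ y) (hf0 : 0 ≤ f) (hf1 : f ≤ 1) (hl₁ : f ≤ l₁) (hl₂ : 1 - f ≤ l₂)
    (hl : 1 ≤ f * l₁ + (1 - f) * l₂) (j : ℕ) (hμ : -log (1 - p) / 2 < μ)
    (h₁ : μ ≤ y - l₁ + -log (1 - p) * j / 2) (h₂ : μ ≤ y - l₂ + -log (1 - p) * (j + 1) / 2)
    (hw : j + 1 - f < w) :
    ∃ δ : ℝ, 0 < δ ∧ ∀ᶠ a : ℕ in atTop, ∀ n : ℕ,
      blockScale (-log (1 - p)) a * exp y ≤ n → n ≤ blockScale (-log (1 - p)) a * exp y' →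
      gnpProb n p {G | n * (1 / a + w / a ^ 2) + exp ((-log (1 - p) / 2 - δ) * a) ≤ (chrom G : ℝ)}
        ≤ 1 / 2 := by
  obtain ⟨δ, hδ, h⟩ := eventually_gnpProb_le_chrom_le_half (y' := y') hp0 hp1 hy hf0 hf1 hl₁ hl₂ hl j
    hμ h₁ h₂
  refine ⟨δ, hδ, ?_⟩
  have hθ := sub_pos.mpr hw
  filter_upwards [h, eventually_one_div_sub_le j hθ, eventually_one_div_sub_le (j + 1) hθ]
    with a ha hj hj1 n hn hn'
  refine (gnpProb_mono hp0.le hp1.le ?_).trans (ha n hn hn')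
  intro G hG
  rw [Set.mem_ofPred_eq] at hG ⊢
  refine le_trans ?_ hG
  have hn0 : (0 : ℝ) ≤ n := Nat.cast_nonneg n
  have h1 := mul_le_mul_of_nonneg_left (mul_le_mul_of_nonneg_left hj hf0) hn0
  have h2 := mul_le_mul_of_nonneg_left (mul_le_mul_of_nonneg_left hj1 (sub_nonneg.mpr hf1)) hn0
  push_cast at h2
  rw [← sub_sub] at h2
  have h3 : n * (f * (1 / (a : ℝ) + (j + (w - (j + 1 - f))) / a ^ 2))
      + n * ((1 - f) * (1 / (a : ℝ) + (j + 1 + (w - (j + 1 - f))) / a ^ 2))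
      = n * (1 / a + w / a ^ 2) := by ring
  have h4 : f * n / (a - j) = n * (f * (1 / ((a : ℝ) - j))) := by ring
  have h5 : (1 - f) * n / (a - j - 1) = n * ((1 - f) * (1 / ((a : ℝ) - j - 1))) := by ring
  rw [h4, h5]
  linarith

lemma mul_one_div_add_le_div_sub {n a v : ℝ} (hn : 0 ≤ n) (ha : 0 < a) (hav : v < a) :
    n * (1 / a + v / a ^ 2) ≤ n / (a - v) := by
  have h : 1 / a + v / a ^ 2 = (a + v) / a ^ 2 := by field_simp
  rw [div_eq_mul_one_div n]
  refine mul_le_mul_of_nonneg_left ?_ hn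
  rw [h, div_le_div_iff₀ (by positivity) (by linarith)]
  linarith [sq_nonneg v]

/-- The second order coefficients in the bounds for the median of the chromatic number at the two
ends of a window just below `blockScale L a * exp (L / 2)` are incompatible with average growth
`1 / a`. -/
lemma exists_window_bounds {p ε₀ : ℝ} (hp0 : 0 < p) (hp1 : p < 1) (hε₀ : 0 < ε₀) :
    ∃ ε v w δ : ℝ, 0 < ε ∧ ε < ε₀ ∧ ε ≤ 1 / 4 ∧ 0 ≤ v ∧ 0 ≤ w ∧ 0 < δ ∧
      w * exp (-log (1 - p) / 2 * (1 - 2 * ε)) < v * exp (-log (1 - p) / 2 * (1 - ε)) ∧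
      ∀ᶠ a : ℕ in atTop, ∀ n : ℕ,
        blockScale (-log (1 - p)) a * exp (-log (1 - p) / 2 * (1 - 2 * ε)) ≤ n →
        n ≤ blockScale (-log (1 - p)) a * exp (-log (1 - p) / 2 * (1 - ε)) →
        gnpProb n p {G | n * (1 / a + w / a ^ 2) + exp ((-log (1 - p) / 2 - δ) * a)
          ≤ (chrom G : ℝ)} ≤ 1 / 2 ∧
        gnpProb n p {G | (chrom G : ℝ)
          ≤ n * (1 / a + v / a ^ 2) - exp ((-log (1 - p) / 2 - δ) * a)} ≤ 1 / 2 := by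
  have hL := neg_log_one_sub_pos hp0 hp1
  obtain ⟨L, hLdef⟩ : ∃ L, L = -log (1 - p) := ⟨_, rfl⟩
  rw [← hLdef] at hL ⊢
  have hexp : ∀ ε, exp (L / 2 * (1 - ε)) = exp (L / 2 * ε) * exp (L / 2 * (1 - 2 * ε)) := by
    intro ε
    rw [← exp_add]; congr 1; ring
  rcases le_or_gt L 2 with hL2 | hL2
  · obtain ⟨β, hβ⟩ : ∃ β, β = 2 / L := ⟨_, rfl⟩
    have hβL : L * β = 2 := by rw [hβ]; field_simp
    have hβ1 : 1 ≤ β := by rw [hβ, one_le_div hL]; exact hL2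
    have hβ0 : 0 < β := by linarith
    obtain ⟨j, hj⟩ : ∃ j, j = ⌊β⌋₊ := ⟨_, rfl⟩
    have hjβ : (j : ℝ) ≤ β := hj ▸ Nat.floor_le hβ0.le
    have hβj : β < j + 1 := hj ▸ Nat.lt_floor_add_one β
    have hg0 : 0 < j + 1 - β := by linarith
    obtain ⟨ε, hε0, hεmin⟩ : ∃ ε, 0 < ε ∧ ε < min ε₀ (min (1 / 4) ((j + 1 - β) / 3)) :=
      exists_between (lt_min hε₀ (lt_min (by norm_num) (by positivity)))
    obtain ⟨hε1, hε2, hε3⟩ : ε < ε₀ ∧ ε < 1 / 4 ∧ ε < (j + 1 - β) / 3 := by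
      simpa only [lt_min_iff] using hεmin
    obtain ⟨τ, hτ⟩ : ∃ τ, τ = ε ^ 2 / (8 * β) := ⟨_, rfl⟩
    have hτ0 : 0 < τ := by rw [hτ]; positivity
    have hτβ : 8 * (τ * β) = ε ^ 2 := by rw [hτ]; field_simp
    have hτε : τ ≤ ε := by
      have h1 : ε ^ 2 ≤ ε * 1 := by rw [sq]; exact mul_le_mul_of_nonneg_left (by linarith) hε0.le
      have h2 : τ * 1 ≤ τ * β := mul_le_mul_of_nonneg_left hβ1 hτ0.le
      linarith
    obtain ⟨κ, hκ⟩ : ∃ κ, κ = 2 * ε + τ := ⟨_, rfl⟩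
    have hκ0 : 0 < κ := by linarith
    have hκg : 0 ≤ j + 1 - β - κ := by linarith
    have hy0 : 0 ≤ L / 2 * (1 - 2 * ε) := mul_nonneg (by linarith) (by linarith)
    have hLτ : 0 < L / 2 * τ := by positivity
    obtain ⟨δ, hδ, hup⟩ := eventually_gnpProb_le_chrom_le_half'
      (p := p) (y := L / 2 * (1 - 2 * ε)) (y' := L / 2 * (1 - ε)) (f := j + 1 - β - κ)
      (l₁ := L / 2 * (j - κ)) (l₂ := L / 2 * (j + 1 - κ)) (μ := L / 2 * (1 + τ))
      (w := β + κ + τ) hp0 hp1 hy0 hκg (by linarith)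
      (by
        refine le_of_mul_le_mul_left ?_ hβ0
        have h1 : β * (L / 2 * (j - κ)) = j - κ := by
          rw [show β * (L / 2 * (j - κ)) = L * β / 2 * (j - κ) by ring, hβL]; ring
        have h2 := mul_nonneg (sub_nonneg.mpr hβ1) (sub_nonneg.mpr hjβ)
        have h3 := mul_nonneg (sub_nonneg.mpr hβ1) hκ0.le
        rw [h1]
        linarith)
      (by
        refine le_of_mul_le_mul_left ?_ hβ0
        have h1 : β * (L / 2 * (j + 1 - κ)) = j + 1 - κ := by
          rw [show β * (L / 2 * (j + 1 - κ)) = L * β / 2 * (j + 1 - κ) by ring, hβL]; ring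
        have h2 := mul_nonneg (by linarith : 0 ≤ β + 1) hκg
        rw [h1]
        linarith)
      (by
        have : (j + 1 - β - κ) * (L / 2 * (j - κ)) + (1 - (j + 1 - β - κ)) * (L / 2 * (j + 1 - κ))
            = L * β / 2 := by ring
        rw [this, hβL]; norm_num)
      j (by rw [← hLdef]; linarith) (by rw [← hLdef, hκ]; linarith) (by rw [← hLdef, hκ]; linarith)
      (by linarith)
    have hlow := eventually_gnpProb_chrom_le_le_half
      (p := p) (y := L / 2 * (1 - ε)) (v := β + ε - τ) hp0 hp1 (by linarith)
      (by
        rw [← hLdef]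
        have : L / 2 * (1 - ε) + L * (β + ε - τ) / 2 = L * β / 2 + L / 2 - L / 2 * τ := by ring
        rw [this, hβL]
        linarith)
    rw [← hLdef] at hup hlow
    refine ⟨ε, β + ε - τ, β + κ + τ, δ, hε0, hε1, hε2.le, by linarith, by linarith, hδ, ?_, ?_⟩
    · rw [hexp ε, ← mul_assoc]
      refine mul_lt_mul_of_pos_right ?_ (exp_pos _)
      have h1 := add_one_le_exp (L / 2 * ε)
      have h2 : (β + ε - τ) * (L / 2 * ε + 1) ≤ (β + ε - τ) * exp (L / 2 * ε) :=
        mul_le_mul_of_nonneg_left h1 (by linarith)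
      refine lt_of_lt_of_le ?_ h2
      have h3 : (β + ε - τ) * (L / 2 * ε + 1) = L * β / 2 * ε + L / 2 * (ε ^ 2 - τ * ε) + β + ε - τ := by
        ring
      have h4 : L / 2 * ε ^ 2 = 8 * τ * (L * β / 2) := by rw [← hτβ]; ring
      have h5 : L / 2 * (τ * ε) ≤ 1 * (τ * ε) :=
        mul_le_mul_of_nonneg_right (by linarith) (by positivity)
      have h6 : τ * ε ≤ τ * (1 / 4) := mul_le_mul_of_nonneg_left hε2.le hτ0.le
      rw [hβL] at h3 h4
      rw [h3, hκ]
      linarith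
    · filter_upwards [hup, hlow,
        (tendsto_natCast_atTop_atTop (R := ℝ)).eventually_gt_atTop (β + ε - τ)]
        with a hup hlow ha n hn hn'
      refine ⟨hup n hn hn', (gnpProb_mono hp0.le hp1.le ?_).trans (hlow n ?_ hn')⟩
      · intro G hG
        rw [Set.mem_ofPred_eq] at hG ⊢
        refine le_trans hG ?_
        have h1 := mul_one_div_add_le_div_sub (n := (n : ℝ)) (Nat.cast_nonneg n)
          (by linarith : (0 : ℝ) < a) ha
        linarith [exp_pos ((L / 2 - δ) * a)]
      · refine le_trans (le_mul_of_one_le_right ?_ (one_le_exp hy0)) hn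
        rw [blockScale]
        positivity
  · obtain ⟨ε, hε0, hεmin⟩ : ∃ ε, 0 < ε ∧ ε < min ε₀ (min (1 / 4) ((L - 2) / (2 * L))) :=
      exists_between (lt_min hε₀ (lt_min (by norm_num)
        (div_pos (by linarith) (by linarith))))
    obtain ⟨hε1, hε2, hε3⟩ : ε < ε₀ ∧ ε < 1 / 4 ∧ ε < (L - 2) / (2 * L) := by
      simpa only [lt_min_iff] using hεmin
    rw [lt_div_iff₀ (by positivity)] at hε3
    have hLε : 0 < L * ε := mul_pos hL hε0
    have hy0 : 0 ≤ L / 2 * (1 - 2 * ε) := mul_nonneg (by linarith) (by linarith)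
    obtain ⟨δ₁, hδ₁, hup⟩ := eventually_gnpProb_le_chrom_le_half'
      (p := p) (y := L / 2 * (1 - 2 * ε)) (y' := L / 2 * (1 - ε)) (f := 1)
      (l₁ := 1) (l₂ := 1) (μ := L / 2 * (1 - 2 * ε) - 1 + L / 2) (w := 1 + L * ε / 4)
      hp0 hp1 hy0 zero_le_one le_rfl le_rfl (by norm_num) (by norm_num) 1
      (by rw [← hLdef]; linarith) (by rw [← hLdef]; push_cast; linarith)
      (by rw [← hLdef]; push_cast; linarith) (by push_cast; linarith)
    obtain ⟨δ₂, hδ₂, hlow⟩ := eventually_gnpProb_chrom_le_le_half'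
      (p := p) (y := L / 2 * (1 - ε)) hp0 hp1 (by rw [← hLdef]; linarith)
    rw [← hLdef] at hup hlow
    refine ⟨ε, 1, 1 + L * ε / 4, min δ₁ δ₂, hε0, hε1, hε2.le, zero_le_one, by linarith,
      lt_min hδ₁ hδ₂, ?_, ?_⟩
    · rw [hexp ε, ← mul_assoc]
      refine mul_lt_mul_of_pos_right ?_ (exp_pos _)
      linarith [add_one_le_exp (L / 2 * ε)]
    · filter_upwards [hup, hlow, eventually_gt_atTop 1] with a hup hlow ha n hn hn'
      have ha1 : (1 : ℝ) < a := by exact_mod_cast ha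
      have hB : ∀ δ, min δ₁ δ₂ ≤ δ → exp ((L / 2 - δ) * a) ≤ exp ((L / 2 - min δ₁ δ₂) * a) :=
        fun δ hδ => exp_le_exp.mpr (mul_le_mul_of_nonneg_right (by linarith) (by linarith))
      refine ⟨(gnpProb_mono hp0.le hp1.le ?_).trans (hup n hn hn'),
        (gnpProb_mono hp0.le hp1.le ?_).trans (hlow n hn')⟩
      · intro G hG
        rw [Set.mem_ofPred_eq] at hG ⊢
        refine le_trans ?_ hG
        linarith [hB δ₁ (min_le_left _ _)]
      · intro G hG
        rw [Set.mem_ofPred_eq] at hG ⊢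
        refine le_trans hG ?_
        have h1 := mul_one_div_add_le_div_sub (n := (n : ℝ)) (Nat.cast_nonneg n)
          (by linarith : (0 : ℝ) < a) ha1
        linarith [hB δ₂ (min_le_right _ _)]

lemma lower_endpoint_le {n : ℕ} {p s t U : ℝ} (hp0 : 0 ≤ p) (hp1 : p ≤ 1)
    (hconc : 9 / 10 ≤ gnpProb n p {G | (chrom G : ℝ) ∈ Set.Icc s t})
    (hU : gnpProb n p {G | U ≤ (chrom G : ℝ)} ≤ 1 / 2) : s ≤ U := by
  by_contra! h
  have := gnpProb_mono (n := n) hp0 hp1 (A := {G | (chrom G : ℝ) ∈ Set.Icc s t})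
    (B := {G | U ≤ (chrom G : ℝ)}) fun G hG => h.le.trans hG.1
  linarith

lemma le_upper_endpoint {n : ℕ} {p s t U : ℝ} (hp0 : 0 ≤ p) (hp1 : p ≤ 1)
    (hconc : 9 / 10 ≤ gnpProb n p {G | (chrom G : ℝ) ∈ Set.Icc s t})
    (hU : gnpProb n p {G | (chrom G : ℝ) ≤ U} ≤ 1 / 2) : U ≤ t := by
  by_contra! h
  have := gnpProb_mono (n := n) hp0 hp1 (A := {G | (chrom G : ℝ) ∈ Set.Icc s t})
    (B := {G | (chrom G : ℝ) ≤ U}) fun G hG => hG.2.trans h.le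
  linarith

/-- If the distribution of the chromatic number on `m` vertices dominates the one on `n` vertices
shifted by `r`, up to a constant and a square, then concentration intervals cannot jump by more
than `r`. -/
lemma lower_endpoint_le_upper_endpoint_add {n m : ℕ} {p s t s' t' r : ℝ} (hp0 : 0 ≤ p) (hp1 : p ≤ 1)
    (hn : 9 / 10 ≤ gnpProb n p {G | (chrom G : ℝ) ∈ Set.Icc s t})
    (hm : 9 / 10 ≤ gnpProb m p {G | (chrom G : ℝ) ∈ Set.Icc s' t'})
    (hplant : ∀ S T : ℝ, T + r < S → gnpProb n p {G | (chrom G : ℝ) ≤ T} ^ 2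
      ≤ gnpProb m p {G | (chrom G : ℝ) < S} * (2 * exp 1)) : s' ≤ t + r := by
  by_contra! h
  have h1 := gnpProb_mono (n := n) hp0 hp1 (A := {G | (chrom G : ℝ) ∈ Set.Icc s t})
    (B := {G | (chrom G : ℝ) ≤ t}) fun G hG => hG.2
  have h2 := gnpProb_mono (n := m) hp0 hp1 (A := {G | (chrom G : ℝ) < s'})
    (B := {G | (chrom G : ℝ) ∈ Set.Icc s' t'}ᶜ) fun G hG hG' => not_le.mpr hG hG'.1
  rw [gnpProb_compl] at h2
  have h3 : gnpProb m p {G | (chrom G : ℝ) < s'} * (2 * exp 1) ≤ 1 / 10 * (2 * 2.7182818286) :=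
    mul_le_mul (by linarith) (by linarith [exp_one_lt_d9]) (by positivity) (by norm_num)
  have h4 : (9 / 10 : ℝ) ^ 2 ≤ gnpProb n p {G | (chrom G : ℝ) ≤ t} ^ 2 :=
    pow_le_pow_left₀ (by norm_num) (hn.trans h1) 2
  have h5 := (h4.trans (hplant s' t h)).trans h3
  norm_num at h5

/-- Fix `p ∈ (0,1)` and `c < 1/2`.  For every sequence of pairs of reals
`(s n, t n)` such that `P(χ(G_{n,p}) ∈ [s n, t n]) → 1`, there are infinitely many `n`
with `t n - s n > n ^ c`. -/
theorem chromatic_nonconcentration_nc (p c : ℝ) (hp0 : 0 < p) (hp1 : p < 1) (hc : c < 1 / 2)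
    (s t : ℕ → ℝ)
    (hconc : Tendsto (fun n : ℕ =>
        gnpProb n p {G | (chrom G : ℝ) ∈ Set.Icc (s n) (t n)}) atTop (nhds 1)) :
    ∀ N : ℕ, ∃ n : ℕ, N ≤ n ∧ (n : ℝ) ^ c < t n - s n := by
  intro N
  by_contra! hlen
  have hL := neg_log_one_sub_pos hp0 hp1
  have hc0 : 0 ≤ max c 0 := le_max_right _ _
  have hc2 : max c 0 < 1 / 2 := max_lt hc (by norm_num)
  obtain ⟨N', hN'⟩ := eventually_atTop.mp
    (hconc.eventually (eventually_ge_nhds (by norm_num : (9 / 10 : ℝ) < 1)))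
  obtain ⟨ε, v, w, δ, hε0, hε1, hε2, hv, hw, hδ, hvw, hbounds⟩ :=
    exists_window_bounds hp0 hp1 (half_pos (sub_pos.mpr hc2))
  have hplant := eventually_planting (ρ := -log (1 - p) / 2 * (1 / 4 + max c 0 / 2))
    (y' := -log (1 - p) / 2 * (1 - ε)) hp0 hp1
    (mul_nonneg (by linarith) (by linarith) : 0 ≤ -log (1 - p) / 2 * (1 - 2 * ε))
    (by
      have := mul_pos hL (by linarith : 0 < 1 - 2 * (1 / 4 + max c 0 / 2))
      linarith)
    (by
      have := mul_pos hL (by linarith : 0 < (1 - 2 * ε) - 2 * (1 / 4 + max c 0 / 2))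
      linarith)
  have hfalse := eventually_false_of_window_bounds
    (L := -log (1 - p)) (ρ := -log (1 - p) / 2 * (1 / 4 + max c 0 / 2)) (c := max c 0)
    (y₀ := -log (1 - p) / 2 * (1 - 2 * ε)) (y₁ := -log (1 - p) / 2 * (1 - ε))
    hL hc0 (by linarith)
    (by
      have := mul_pos hL (by linarith : 0 < (1 / 4 + max c 0 / 2) - max c 0)
      linarith)
    (by
      have := mul_pos hL (by linarith : 0 < 1 - (1 / 4 + max c 0 / 2))
      linarith)
    hδ hv hw (mul_nonneg (by linarith) (by linarith))
    (by
      have := mul_pos hL hε0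
      linarith)
    hvw
  obtain ⟨a, ha, hDN, hbounds, hplant, hfalse⟩ := ((eventually_ge_atTop 1).and
    ((eventually_mul_pow_mul_exp_le_blockScale (half_pos hL) (N + N' + 1 : ℕ) 0).and
      (hbounds.and (hplant.and hfalse)))).exists
  have hlarge : ∀ n : ℕ, blockScale (-log (1 - p)) a * exp (-log (1 - p) / 2 * (1 - 2 * ε)) ≤ n →
      N + N' + 1 ≤ n := by
    intro n hn
    rw [pow_zero, mul_one, zero_mul, exp_zero, mul_one] at hDN
    have h1 := le_mul_of_one_le_right (blockScale_pos (-log (1 - p)) ha).le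
      (one_le_exp (mul_nonneg (by linarith) (by linarith) : 0 ≤ -log (1 - p) / 2 * (1 - 2 * ε)))
    exact_mod_cast hDN.trans (h1.trans hn)
  refine hfalse s t _ rfl (fun n hn hn' => ?_) (fun n hn hn' => ?_)
  · have hnN := hlarge n hn
    have hn9 := hN' n (by omega)
    have hb := hbounds n hn hn'
    refine ⟨(hlen n (by omega)).trans (rpow_le_rpow_of_exponent_le ?_ (le_max_left _ _)),
      lower_endpoint_le hp0.le hp1.le hn9 hb.1, le_upper_endpoint hp0.le hp1.le hn9 hb.2⟩
    exact_mod_cast (by omega : 1 ≤ n)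
  · have hnN := hlarge n hn
    refine lower_endpoint_le_upper_endpoint_add hp0.le hp1.le (hN' n (by omega)) (hN' _ (by omega))
      (hplant n _ (Nat.floor_le (exp_pos _).le) (hn.trans ?_) hn')
    exact_mod_cast Nat.le_add_right _ _
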